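/- Let N ≥ 5, set d = N², let ρ ∈ ℝ^N have coordinates ρ_j = (N+1)/2 − j for 1 ≤ j ≤ N, and define the multiplicity polynomial m(x) = ∏_{1≤j<k≤N} (x_j − x_k)²/(k−j)². Define, for λ > 0, 𝓝(λ) = (1/N!) Σ_{b∈ℤ^N} m(b+ρ) · 1_{|b+ρ|² ≤ λ + |ρ|²}. Then as λ → ∞, 𝓝(λ) = C λ^{d/2} + O(λ^{(d−2)/2}), where C = (1/N!) ∫_{|x|≤1} m(x) dx. -/

import Mathlib

open MeasureTheory Filter Asymptotics Finset

lemma exists_pow_mul_exp_neg_sq_le (k : ℕ) :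
    ∃ C : ℝ, 0 < C ∧ ∀ P : ℝ, 0 < P → ∀ x : ℝ,
      |x| ^ k * Real.exp (-(1 / P ^ 2) * x ^ 2) ≤ C * P ^ k := by
  refine ⟨1 + k.factorial, by positivity, fun P hP x => ?_⟩
  have key : ∀ y : ℝ, 0 ≤ y → y ^ k * Real.exp (-y ^ 2) ≤ 1 + k.factorial := by
    intro y hy
    have h1 : (y ^ 2) ^ k / k.factorial ≤ Real.exp (y ^ 2) :=
      Real.pow_div_factorial_le_exp _ (by positivity) k
    have h2 : y ^ k ≤ 1 + (y ^ 2) ^ k := by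
      rw [← pow_mul, mul_comm 2 k, pow_mul]
      nlinarith [sq_nonneg (y ^ k - 1 / 2)]
    have h3 : (y ^ 2) ^ k ≤ k.factorial * Real.exp (y ^ 2) := by
      rw [div_le_iff₀ (by positivity)] at h1; linarith
    have h4 : 1 ≤ Real.exp (y ^ 2) := Real.one_le_exp (by positivity)
    rw [Real.exp_neg, ← div_eq_mul_inv, div_le_iff₀ (Real.exp_pos _)]
    linarith
  have := key (|x| / P) (by positivity)
  rw [div_pow, div_mul_eq_mul_div, div_le_iff₀ (by positivity)] at this
  have e : -(|x| / P) ^ 2 = -(1 / P ^ 2) * x ^ 2 := by rw [div_pow, sq_abs]; ring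
  rwa [e] at this

/-- The function `x ^ k * exp (-w x ^ 2 - 2 π i ξ x)`. -/
noncomputable def gaussMono (k : ℕ) (w : ℂ) (ξ : ℝ) (x : ℝ) : ℂ :=
  (x : ℂ) ^ k * Complex.exp (-w * (x : ℂ) ^ 2 - 2 * Real.pi * Complex.I * ξ * x)

/-- The Fourier transform at `ξ` of `x ^ k * exp (-w x ^ 2)`. -/
noncomputable def gaussMoment (k : ℕ) (w : ℂ) (ξ : ℝ) : ℂ := ∫ x : ℝ, gaussMono k w ξ x

lemma norm_gaussMono (k : ℕ) (w : ℂ) (ξ x : ℝ) :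
    ‖gaussMono k w ξ x‖ = |x| ^ k * Real.exp (-w.re * x ^ 2) := by
  have : (-w * (x : ℂ) ^ 2 - 2 * Real.pi * Complex.I * ξ * x).re = -w.re * x ^ 2 := by
    have e : -w * (x : ℂ) ^ 2 - 2 * Real.pi * Complex.I * ξ * x =
      -w * ((x ^ 2 : ℝ) : ℂ) - ((2 * Real.pi * ξ * x : ℝ) : ℂ) * Complex.I := by push_cast; ring
    rw [e, Complex.sub_re, Complex.re_mul_ofReal, Complex.re_ofReal_mul]
    simp
  rw [gaussMono, norm_mul, norm_pow, Complex.norm_exp, this, Complex.norm_real, Real.norm_eq_abs]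

lemma continuous_gaussMono (k : ℕ) (w : ℂ) (ξ : ℝ) : Continuous (gaussMono k w ξ) := by
  unfold gaussMono; fun_prop

lemma integrable_abs_pow_mul_exp (k : ℕ) {ε : ℝ} (hε : 0 < ε) :
    Integrable fun x : ℝ => |x| ^ k * Real.exp (-ε * x ^ 2) := by
  have h := (integrable_rpow_mul_exp_neg_mul_sq hε (s := k)
    (by have : (0 : ℝ) ≤ k := by positivity
        linarith)).norm
  refine h.congr (.of_forall fun x => ?_)
  simp [Real.rpow_natCast]

lemma integrable_gaussMono (k : ℕ) {w : ℂ} (hw : 0 < w.re) (ξ : ℝ) :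
    Integrable (gaussMono k w ξ) := by
  rw [← integrable_norm_iff (continuous_gaussMono k w ξ).aestronglyMeasurable]
  simp_rw [norm_gaussMono]
  exact integrable_abs_pow_mul_exp k hw

lemma hasDerivAt_gaussMono (k : ℕ) (w : ℂ) (ξ x : ℝ) :
    HasDerivAt (gaussMono k w ξ) (k * gaussMono (k - 1) w ξ x - 2 * w * gaussMono (k + 1) w ξ x
      - 2 * Real.pi * Complex.I * ξ * gaussMono k w ξ x) x := by
  have h1 : HasDerivAt (fun z : ℂ => z ^ k *
      Complex.exp (-w * z ^ 2 - 2 * Real.pi * Complex.I * ξ * z)) _ (x : ℂ) :=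
    (hasDerivAt_pow k (x : ℂ)).mul
      ((((hasDerivAt_pow 2 (x : ℂ)).const_mul (-w)).sub
        ((hasDerivAt_id (x : ℂ)).const_mul (2 * Real.pi * Complex.I * ξ))).cexp)
  convert h1.comp_ofReal using 1
  · rfl
  · simp only [gaussMono, id, Pi.sub_apply]
    push_cast
    ring

lemma gaussMoment_rec (k : ℕ) {w : ℂ} (hw : 0 < w.re) (ξ : ℝ) :
    2 * Real.pi * Complex.I * ξ * gaussMoment k w ξ =
      k * gaussMoment (k - 1) w ξ - 2 * w * gaussMoment (k + 1) w ξ := by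
  have i (j : ℕ) := integrable_gaussMono j hw ξ
  have i1 : Integrable fun x => (k : ℂ) * gaussMono (k - 1) w ξ x := (i _).const_mul _
  have i2 : Integrable fun x => 2 * w * gaussMono (k + 1) w ξ x := (i _).const_mul _
  have i3 : Integrable fun x => 2 * Real.pi * Complex.I * ξ * gaussMono k w ξ x :=
    (i _).const_mul _
  have i12 : Integrable fun x => k * gaussMono (k - 1) w ξ x - 2 * w * gaussMono (k + 1) w ξ x :=
    i1.sub i2
  have h := integral_eq_zero_of_hasDerivAt_of_integrable
    (fun x => hasDerivAt_gaussMono k w ξ x) (i12.sub i3) (i k)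
  rw [integral_sub i12 i3, integral_sub i1 i2, integral_const_mul, integral_const_mul,
    integral_const_mul] at h
  simp only [gaussMoment]
  linear_combination -h

lemma norm_gaussMoment_le (k : ℕ) : ∃ C : ℝ, 0 < C ∧ ∀ P : ℝ, 0 < P → ∀ w : ℂ,
    w.re = 1 / P ^ 2 → ∀ ξ : ℝ, ‖gaussMoment k w ξ‖ ≤ C * P ^ (k + 1) := by
  refine ⟨(∫ y : ℝ, |y| ^ k * Real.exp (-1 * y ^ 2)) + 1, ?_, fun P hP w hw ξ => ?_⟩
  · have : 0 ≤ ∫ y : ℝ, |y| ^ k * Real.exp (-1 * y ^ 2) :=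
      integral_nonneg fun y => by positivity
    linarith
  · refine (norm_integral_le_integral_norm _).trans ?_
    simp_rw [norm_gaussMono, hw]
    have h := Measure.integral_comp_div (fun y : ℝ => |y| ^ k * Real.exp (-1 * y ^ 2)) P
    have e : ∀ x : ℝ, |x| ^ k * Real.exp (-(1 / P ^ 2) * x ^ 2) =
        P ^ k * (|x / P| ^ k * Real.exp (-1 * (x / P) ^ 2)) := by
      intro x
      rw [abs_div, abs_of_pos hP, div_pow, div_pow]
      field_simp
    simp_rw [e]
    rw [integral_const_mul, h, abs_of_pos hP, smul_eq_mul]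
    have : 0 < P ^ (k + 1) := by positivity
    rw [pow_succ] at *
    nlinarith

lemma one_le_norm_mul_sq {P : ℝ} (hP : 0 < P) {w : ℂ} (hw : w.re = 1 / P ^ 2) :
    1 ≤ ‖w‖ * P ^ 2 := by
  have := Complex.re_le_norm w
  rw [hw, div_le_iff₀ (by positivity)] at this
  exact this

lemma pow_mul_norm_gaussMoment_le (j : ℕ) : ∀ k : ℕ, ∃ C : ℝ, 0 < C ∧ ∀ P : ℝ, 0 < P → ∀ w : ℂ,
    w.re = 1 / P ^ 2 → ∀ ξ : ℝ,
      |ξ| ^ j * ‖gaussMoment k w ξ‖ ≤ C * (‖w‖ * P) ^ j * P ^ (k + 1) := by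
  induction j with
  | zero => simpa using norm_gaussMoment_le
  | succ j ih =>
    intro k
    obtain ⟨C₁, hC₁, h₁⟩ := ih (k - 1)
    obtain ⟨C₂, hC₂, h₂⟩ := ih (k + 1)
    refine ⟨k * C₁ + 2 * C₂, by positivity, fun P hP w hw ξ => ?_⟩
    have hw0 : 0 < w.re := by rw [hw]; positivity
    have hrec := congrArg norm (gaussMoment_rec k hw0 ξ)
    have e1 : ‖2 * Real.pi * Complex.I * ξ * gaussMoment k w ξ‖ =
        2 * Real.pi * |ξ| * ‖gaussMoment k w ξ‖ := by
      simp [abs_of_pos Real.pi_pos]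
    have e2 : ‖k * gaussMoment (k - 1) w ξ - 2 * w * gaussMoment (k + 1) w ξ‖ ≤
        k * ‖gaussMoment (k - 1) w ξ‖ + 2 * ‖w‖ * ‖gaussMoment (k + 1) w ξ‖ := by
      refine (norm_sub_le _ _).trans (le_of_eq ?_)
      simp
    rw [e1] at hrec
    have h3 : |ξ| * ‖gaussMoment k w ξ‖ ≤ 2 * Real.pi * |ξ| * ‖gaussMoment k w ξ‖ := by
      have : 0 ≤ |ξ| * ‖gaussMoment k w ξ‖ := by positivity
      nlinarith [Real.pi_gt_three]
    have h4 := one_le_norm_mul_sq hP hw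
    have hk : (k : ℝ) * P ^ (k - 1 + 1) ≤ k * (‖w‖ * P * P ^ (k + 1)) := by
      rcases k with _ | k
      · simp
      · have : (0 : ℝ) < P ^ (k + 1) := by positivity
        simp only [Nat.add_sub_cancel]
        gcongr
        calc P ^ (k + 1) = 1 * P ^ (k + 1) := by ring
          _ ≤ (‖w‖ * P ^ 2) * P ^ (k + 1) := by gcongr
          _ = _ := by ring
    calc |ξ| ^ (j + 1) * ‖gaussMoment k w ξ‖
        = |ξ| ^ j * (|ξ| * ‖gaussMoment k w ξ‖) := by ring
      _ ≤ |ξ| ^ j * (k * ‖gaussMoment (k - 1) w ξ‖ + 2 * ‖w‖ * ‖gaussMoment (k + 1) w ξ‖) := by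
          gcongr; linarith
      _ = k * (|ξ| ^ j * ‖gaussMoment (k - 1) w ξ‖) +
          2 * ‖w‖ * (|ξ| ^ j * ‖gaussMoment (k + 1) w ξ‖) := by ring
      _ ≤ k * (C₁ * (‖w‖ * P) ^ j * P ^ (k - 1 + 1)) +
          2 * ‖w‖ * (C₂ * (‖w‖ * P) ^ j * P ^ (k + 1 + 1)) := by
          have := h₁ P hP w hw ξ
          have := h₂ P hP w hw ξ
          gcongr ?_ * ?_ + 2 * ‖w‖ * ?_
      _ = C₁ * (‖w‖ * P) ^ j * (k * P ^ (k - 1 + 1)) +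
          2 * ‖w‖ * (C₂ * (‖w‖ * P) ^ j * P ^ (k + 1 + 1)) := by ring
      _ ≤ C₁ * (‖w‖ * P) ^ j * (k * (‖w‖ * P * P ^ (k + 1))) +
          2 * ‖w‖ * (C₂ * (‖w‖ * P) ^ j * P ^ (k + 1 + 1)) := by gcongr
      _ = _ := by ring

lemma gaussMono_isBigO (k : ℕ) {w : ℂ} (hw : 0 < w.re) (ξ : ℝ) :
    gaussMono k w ξ =O[cocompact ℝ] fun x : ℝ => |x| ^ (-2 : ℝ) := by
  obtain ⟨C, hC, h⟩ := exists_pow_mul_exp_neg_sq_le (k + 2)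
  have hs : 0 < Real.sqrt (1 / w.re) := Real.sqrt_pos.2 (by positivity)
  have hP : 1 / Real.sqrt (1 / w.re) ^ 2 = w.re := by
    rw [Real.sq_sqrt (by positivity)]; field_simp
  refine IsBigO.of_bound (C * Real.sqrt (1 / w.re) ^ (k + 2)) ?_
  have : ∀ᶠ x : ℝ in cocompact ℝ, x ≠ 0 := by
    have := (isCompact_singleton (x := (0 : ℝ))).compl_mem_cocompact
    filter_upwards [this] with x hx using by simpa using hx
  filter_upwards [this] with x hx
  have := h _ hs x
  rw [hP] at this
  have hx' : 0 < |x| := abs_pos.2 hx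
  rw [norm_gaussMono, Real.norm_of_nonneg (by positivity), Real.rpow_neg hx'.le,
    ← div_eq_mul_inv, le_div_iff₀ (by positivity)]
  norm_cast
  calc _ = |x| ^ (k + 2) * Real.exp (-w.re * x ^ 2) := by ring
    _ ≤ _ := this

lemma summable_gaussMono (k : ℕ) {w : ℂ} (hw : 0 < w.re) (ξ s : ℝ) :
    Summable fun n : ℤ => gaussMono k w ξ (n + s) := by
  have h1 := (gaussMono_isBigO k hw ξ).comp_tendsto
    ((Homeomorph.addRight s).isClosedEmbedding.tendsto_cocompact.comp Int.tendsto_coe_cofinite)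
  have h2 : (fun x : ℝ => |x + s| ^ (-2 : ℝ)) =O[cocompact ℝ] fun x : ℝ => |x| ^ (-2 : ℝ) := by
    refine IsBigO.of_bound 4 ?_
    have : ∀ᶠ x : ℝ in cocompact ℝ, x ∉ Set.Icc (-(2 * |s| + 1)) (2 * |s| + 1) :=
      (isCompact_Icc (a := -(2 * |s| + 1)) (b := 2 * |s| + 1)).compl_mem_cocompact
    filter_upwards [this] with x hx
    have hx1 : 2 * |s| + 1 < |x| := by
      by_contra h
      exact hx (abs_le.1 (not_lt.1 h))
    have hx2 : |x| / 2 ≤ |x + s| := by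
      have := abs_sub_abs_le_abs_sub x (-s)
      rw [abs_neg, sub_neg_eq_add] at this
      linarith
    have hx0 : 0 < |x| := by linarith [abs_nonneg s]
    rw [Real.norm_of_nonneg (by positivity), Real.norm_of_nonneg (by positivity),
      Real.rpow_neg (abs_nonneg _), Real.rpow_neg (abs_nonneg _)]
    norm_cast
    have : (|x| / 2) ^ 2 ≤ |x + s| ^ 2 := by gcongr
    rw [inv_eq_one_div, inv_eq_one_div, mul_one_div, div_le_div_iff₀ (by nlinarith) (by positivity)]
    nlinarith
  exact summable_of_isBigO (Real.summable_abs_int_rpow one_lt_two)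
    (h1.trans (h2.comp_tendsto Int.tendsto_coe_cofinite))

lemma summable_inv_one_add_sq {δ : ℝ} (hδ : 0 < δ) (s : ℝ) :
    (Summable fun n : ℤ => (1 + (s + δ * n) ^ 2)⁻¹) ∧
      ∑' n : ℤ, (1 + (s + δ * n) ^ 2)⁻¹ ≤ (2 + 2 * δ ^ 2) * (Real.pi / δ) := by
  have hi : Integrable fun t : ℝ => (1 + (s + δ * t) ^ 2)⁻¹ := by
    have := (integrable_inv_one_add_sq.comp_add_left s).comp_mul_left' hδ.ne'
    exact this
  have hI : ∫ t : ℝ, (1 + (s + δ * t) ^ 2)⁻¹ = Real.pi / δ := by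
    have h1 := Measure.integral_comp_mul_left (fun t : ℝ => (1 + (s + t) ^ 2)⁻¹) δ
    rw [h1, integral_add_left_eq_self (fun t : ℝ => (1 + t ^ 2)⁻¹), integral_univ_inv_one_add_sq,
      smul_eq_mul, abs_of_pos (by positivity)]
    ring
  have hs := (hi.hasSum_intervalIntegral 0).mul_left (2 + 2 * δ ^ 2)
  rw [hI] at hs
  have hle : ∀ n : ℤ, (1 + (s + δ * n) ^ 2)⁻¹ ≤
      (2 + 2 * δ ^ 2) * ∫ t in (0 : ℝ) + n..0 + n + 1, (1 + (s + δ * t) ^ 2)⁻¹ := by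
    intro n
    rw [← intervalIntegral.integral_const_mul]
    have : (1 + (s + δ * n) ^ 2)⁻¹ = ∫ t in (0 : ℝ) + n..0 + n + 1, (1 + (s + δ * n) ^ 2)⁻¹ := by
      simp
    rw [this]
    refine intervalIntegral.integral_mono_on (by linarith) (by simp)
      (hi.intervalIntegrable.const_mul _) fun t ht => ?_
    rw [← div_eq_mul_inv, inv_eq_one_div, div_le_div_iff₀ (by positivity) (by positivity)]
    have h1 : 0 ≤ t - n := by linarith [ht.1]
    have h2 : t - n ≤ 1 := by linarith [ht.2]
    have h3 : (δ * (t - n)) ^ 2 ≤ δ ^ 2 := by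
      have : (t - n) ^ 2 ≤ 1 := by nlinarith
      rw [mul_pow]; exact mul_le_of_le_one_right (sq_nonneg δ) this
    have h4 : s + δ * t = (s + δ * n) + δ * (t - n) := by ring
    rw [h4]
    generalize δ * (t - n) = b at *
    generalize s + δ * n = a at *
    nlinarith [sq_nonneg (2 * a + b), sq_nonneg (a - b), mul_nonneg (sq_nonneg δ) (sq_nonneg a)]
  have h0 : ∀ n : ℤ, 0 ≤ (1 + (s + δ * n) ^ 2)⁻¹ := fun n => by positivity
  have hsum := Summable.of_nonneg_of_le h0 hle hs.summable
  exact ⟨hsum, (hsum.tsum_le_tsum hle hs.summable).trans_eq hs.tsum_eq⟩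

lemma fourier_gaussMono (k : ℕ) (w : ℂ) (ξ η : ℝ) :
    FourierTransform.fourier (gaussMono k w ξ) η = gaussMoment k w (ξ + η) := by
  rw [Real.fourier_real_eq_integral_exp_smul, gaussMoment]
  congr 1 with x
  rw [smul_eq_mul, gaussMono, gaussMono, mul_left_comm, ← Complex.exp_add]
  congr 2
  push_cast
  ring

lemma summable_gaussMoment (k : ℕ) {w : ℂ} (hw : 0 < w.re) (θ : ℝ) :
    Summable fun l : ℤ => ‖gaussMoment k w (θ + l)‖ := by
  obtain ⟨C₀, -, h₀⟩ := norm_gaussMoment_le k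
  obtain ⟨C₂, -, h₂⟩ := pow_mul_norm_gaussMoment_le 2 k
  have hs : 0 < Real.sqrt (1 / w.re) := Real.sqrt_pos.2 (by positivity)
  have hP : w.re = 1 / Real.sqrt (1 / w.re) ^ 2 := by
    rw [Real.sq_sqrt (by positivity)]; field_simp
  generalize Real.sqrt (1 / w.re) = P at hs hP
  refine Summable.of_nonneg_of_le (fun _ => norm_nonneg _) (fun l => ?_)
    ((summable_inv_one_add_sq one_pos θ).1.mul_left
      (C₀ * P ^ (k + 1) + C₂ * (‖w‖ * P) ^ 2 * P ^ (k + 1)))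
  rw [← div_eq_mul_inv, le_div_iff₀ (by positivity), one_mul]
  have e0 := h₀ P hs w hP (θ + l)
  have e2 := h₂ P hs w hP (θ + l)
  rw [sq_abs] at e2
  linarith

lemma poisson_gaussMono (k : ℕ) {w : ℂ} (hw : 0 < w.re) (θ s : ℝ) :
    ∑' n : ℤ, gaussMono k w θ (s + n) =
      ∑' l : ℤ, gaussMoment k w (θ + l) * fourier l (s : UnitAddCircle) := by
  have h := Real.tsum_eq_tsum_fourier_of_rpow_decay_of_summable (continuous_gaussMono k w θ)
    one_lt_two (gaussMono_isBigO k hw θ) ?_ s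
  · simpa only [fourier_gaussMono] using h
  · simpa only [fourier_gaussMono] using (summable_gaussMoment k hw θ).of_norm

lemma norm_fourier_coe (l : ℤ) (s : ℝ) : ‖fourier l (s : UnitAddCircle)‖ = 1 := by
  rw [fourier_apply]; exact Circle.norm_coe _

lemma norm_tsum_gaussMono_le (k : ℕ) {w : ℂ} (hw : 0 < w.re) (θ s : ℝ) :
    ‖∑' n : ℤ, gaussMono k w θ (s + n)‖ ≤ ∑' l : ℤ, ‖gaussMoment k w (θ + l)‖ := by
  rw [poisson_gaussMono k hw]
  have e : ∀ l : ℤ, ‖gaussMoment k w (θ + l) * fourier l (s : UnitAddCircle)‖ =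
      ‖gaussMoment k w (θ + l)‖ := fun l => by rw [norm_mul, norm_fourier_coe, mul_one]
  refine (norm_tsum_le_tsum_norm ?_).trans_eq ?_
  · simpa only [e] using summable_gaussMoment k hw θ
  · simp only [e]

/-- A smooth Gaussian sum over a shifted lattice differs from its integral by a cubic error. -/
lemma norm_tsum_gaussMono_sub_le (k : ℕ) : ∃ C : ℝ, 0 < C ∧ ∀ P : ℝ, 0 < P → ∀ w : ℂ,
    w.re = 1 / P ^ 2 → ∀ s : ℝ, ‖∑' n : ℤ, gaussMono k w 0 (s + n) - gaussMoment k w 0‖ ≤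
      C * (‖w‖ * P) ^ 3 * P ^ (k + 1) := by
  obtain ⟨C, hC, h⟩ := pow_mul_norm_gaussMoment_le 3 k
  have hsum : Summable fun l : ℤ => (|(l : ℝ)| ^ 3)⁻¹ := by
    have := Real.summable_abs_int_rpow (b := 3) (by norm_num)
    refine this.congr fun l => ?_
    rw [Real.rpow_neg (abs_nonneg _)]
    norm_cast
  refine ⟨C * (∑' l : ℤ, (|(l : ℝ)| ^ 3)⁻¹ + 1), ?_, fun P hP w hw s => ?_⟩
  · have : 0 ≤ ∑' l : ℤ, (|(l : ℝ)| ^ 3)⁻¹ := tsum_nonneg fun _ => by positivity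
    positivity
  have hw0 : 0 < w.re := by rw [hw]; positivity
  have hs1 : Summable fun l : ℤ => gaussMoment k w (0 + l) * fourier l (s : UnitAddCircle) := by
    refine Summable.of_norm ?_
    simpa only [norm_mul, norm_fourier_coe, mul_one] using summable_gaussMoment k hw0 0
  rw [poisson_gaussMono k hw0, hs1.tsum_eq_add_tsum_ite 0]
  simp only [Int.cast_zero, add_zero, fourier_zero, mul_one, zero_add, add_sub_cancel_left]
  have hb : ∀ l : ℤ, ‖if l = 0 then 0 else gaussMoment k w l * fourier l (s : UnitAddCircle)‖ ≤
      C * (‖w‖ * P) ^ 3 * P ^ (k + 1) * (|(l : ℝ)| ^ 3)⁻¹ := by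
    intro l
    split_ifs with hl
    · rw [norm_zero]; positivity
    · have : 0 < |(l : ℝ)| := abs_pos.2 (by exact_mod_cast hl)
      rw [norm_mul, norm_fourier_coe, mul_one, ← div_eq_mul_inv, le_div_iff₀ (by positivity),
        mul_comm]
      exact h P hP w hw l
  refine (tsum_of_norm_bounded (hsum.mul_left _).hasSum hb).trans ?_
  rw [tsum_mul_left]
  have : 0 ≤ C * (‖w‖ * P) ^ 3 * P ^ (k + 1) := by positivity
  linarith [mul_comm C (∑' l : ℤ, (|(l : ℝ)| ^ 3)⁻¹)]

/-- The Gaussian integral itself decays like the inverse square root of the parameter. -/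
lemma norm_gaussMoment_zero_le (k : ℕ) : ∃ C : ℝ, 0 < C ∧ ∀ P : ℝ, 0 < P → ∀ w : ℂ,
    w.re = 1 / P ^ 2 → ‖gaussMoment k w 0‖ ≤ C * P ^ k * Real.sqrt (1 / ‖w‖) := by
  induction k using Nat.twoStepInduction with
  | zero =>
    refine ⟨Real.sqrt Real.pi, Real.sqrt_pos.2 Real.pi_pos, fun P hP w hw => ?_⟩
    have hw0 : 0 < w.re := by rw [hw]; positivity
    have : gaussMoment 0 w 0 = ∫ x : ℝ, Complex.exp (-w * (x : ℂ) ^ 2) := by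
      simp [gaussMoment, gaussMono]
    have hwn : w ≠ 0 := by rintro rfl; simp at hw0
    rw [this, integral_gaussian_complex hw0, Complex.norm_cpow_of_ne_zero (by
      simp [hwn, Real.pi_ne_zero])]
    have e : (1 / 2 : ℂ) = ((1 / 2 : ℝ) : ℂ) := by push_cast; rfl
    rw [e, Complex.ofReal_im, Complex.ofReal_re, mul_zero, Real.exp_zero, div_one,
      ← Real.sqrt_eq_rpow, pow_zero, mul_one, ← Real.sqrt_mul Real.pi_pos.le, norm_div,
      Complex.norm_real, Real.norm_of_nonneg Real.pi_pos.le, mul_one_div]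
  | one =>
    refine ⟨1, one_pos, fun P hP w hw => ?_⟩
    have hw0 : 0 < w.re := by rw [hw]; positivity
    have hwn : w ≠ 0 := by rintro rfl; simp at hw0
    have h := gaussMoment_rec 0 hw0 0
    have : gaussMoment 1 w 0 = 0 := by simpa [hwn] using h
    rw [this, norm_zero]; positivity
  | more k ih _ =>
    obtain ⟨C, hC, h⟩ := ih
    refine ⟨(k + 1) * C, by positivity, fun P hP w hw => ?_⟩
    have hw0 : 0 < w.re := by rw [hw]; positivity
    have hrec := gaussMoment_rec (k + 1) hw0 0
    have e : 2 * w * gaussMoment (k + 2) w 0 = (k + 1) * gaussMoment k w 0 := by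
      simp only [Complex.ofReal_zero, mul_zero, zero_mul, Nat.add_sub_cancel] at hrec
      push_cast at hrec
      linear_combination hrec
    have e' := congrArg norm e
    have ek : ‖((k : ℂ) + 1)‖ = k + 1 := by
      have : ((k : ℂ) + 1) = ((k + 1 : ℕ) : ℂ) := by push_cast; rfl
      rw [this, Complex.norm_natCast]; push_cast; rfl
    rw [norm_mul, norm_mul, norm_mul, ek, Complex.norm_ofNat] at e'
    have h1 := one_le_norm_mul_sq hP hw
    have h2 := h P hP w hw
    have hn := norm_nonneg (gaussMoment (k + 2) w 0)
    calc ‖gaussMoment (k + 2) w 0‖ = 1 * ‖gaussMoment (k + 2) w 0‖ := by ring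
      _ ≤ (‖w‖ * P ^ 2) * ‖gaussMoment (k + 2) w 0‖ := by gcongr
      _ ≤ P ^ 2 * (2 * ‖w‖ * ‖gaussMoment (k + 2) w 0‖) := by
          have : 0 ≤ ‖w‖ * P ^ 2 * ‖gaussMoment (k + 2) w 0‖ := by positivity
          linarith
      _ = P ^ 2 * ((k + 1) * ‖gaussMoment k w 0‖) := by rw [e']
      _ ≤ P ^ 2 * ((k + 1) * (C * P ^ k * Real.sqrt (1 / ‖w‖))) := by gcongr
      _ = _ := by ring

lemma tsum_ofReal_inv_one_add_sq_le {δ : ℝ} (hδ : 0 < δ) (s : ℝ) :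
    ∑' n : ℤ, ENNReal.ofReal (1 + (s + δ * n) ^ 2)⁻¹ ≤
      ENNReal.ofReal ((2 + 2 * δ ^ 2) * (Real.pi / δ)) := by
  obtain ⟨h1, h2⟩ := summable_inv_one_add_sq hδ s
  rw [← ENNReal.ofReal_tsum_of_nonneg (fun n => by positivity) h1]
  exact ENNReal.ofReal_le_ofReal h2

/-- Counting lattice points `(h, l)` with `h ≪ P` and `|α h - l| ≪ 1 / P`, with smooth weights. -/
lemma tsum_lattice_le {P : ℝ} (hP : 0 < P) {α : ℝ} {a : ℤ} {q : ℕ} (hq : 0 < q) (hqP : q ≤ P)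
    (haq : IsCoprime a (q : ℤ)) (hβ : |α - a / q| ≤ 1 / (q * P)) :
    ∑' h : ℤ, ∑' l : ℤ, ENNReal.ofReal
      (((1 + (h / P) ^ 2) ^ 2)⁻¹ * ((1 + (P * (α * h - l)) ^ 2) ^ 2)⁻¹) ≤
      ENNReal.ofReal (160 * Real.pi ^ 2 / (q * P * (1 / P ^ 2 + |α - a / q|))) := by
  obtain ⟨u, v, huv⟩ := haq
  have hq' : (0 : ℝ) < q := by exact_mod_cast hq
  set β := α - a / q with hβd
  obtain ⟨ε, hε, hεβ⟩ : ∃ ε : ℝ, ε ^ 2 = 1 ∧ ε * β = |β| := by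
    rcases le_total 0 β with h | h
    · exact ⟨1, by norm_num, by rw [abs_of_nonneg h, one_mul]⟩
    · exact ⟨-1, by norm_num, by rw [abs_of_nonpos h]; ring⟩
  set δ := q / P + P * q * |β| with hδd
  have hδ : 0 < δ := by positivity
  have hPq : P * q * |β| ≤ 1 := by
    rw [le_div_iff₀ (by positivity)] at hβ; linarith
  have hqP1 : q / P ≤ 1 := by rw [div_le_one hP]; exact hqP
  have hδ2 : δ ≤ 2 := by linarith
  let e : ℤ × ℤ ≃ ℤ × ℤ :=
    { toFun := fun p => (q * p.2 + u * p.1, a * p.2 - v * p.1)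
      invFun := fun p => (a * p.1 - q * p.2, v * p.1 + u * p.2)
      left_inv := fun p => by
        ext
        · linear_combination p.1 * huv
        · linear_combination p.2 * huv
      right_inv := fun p => by
        ext
        · linear_combination p.1 * huv
        · linear_combination p.2 * huv }
  have key : ∀ i j : ℤ, ((1 + (((e (i, j)).1 : ℤ) / P) ^ 2) ^ 2)⁻¹ *
      ((1 + (P * (α * ((e (i, j)).1 : ℤ) - ((e (i, j)).2 : ℤ))) ^ 2) ^ 2)⁻¹ ≤
      4 * (1 + ((0 : ℝ) + 1 * i) ^ 2)⁻¹ *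
        (1 + ((u * i / P + ε * (P * β * u * i + P * i / q)) + δ * j) ^ 2)⁻¹ := by
    intro i j
    have huv' : (u : ℝ) * a + v * q = 1 := by exact_mod_cast huv
    have hα : α = β + a / q := by rw [hβd]; ring
    have hA : P * (α * ((e (i, j)).1 : ℤ) - ((e (i, j)).2 : ℤ)) =
        P * β * (q * j + u * i) + P * i / q := by
      simp only [e, Equiv.coe_fn_mk]
      push_cast
      rw [hα]
      field_simp
      linear_combination (i : ℝ) * huv'
    have hB : (((e (i, j)).1 : ℤ) : ℝ) / P = (q * j + u * i) / P := by
      simp only [e, Equiv.coe_fn_mk]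
      push_cast
      ring
    rw [hA, hB]
    have hlin : (u * i / P + ε * (P * β * u * i + P * i / q)) + δ * j =
        (q * j + u * i) / P + ε * (P * β * (q * j + u * i) + P * i / q) := by
      rw [hδd, ← hεβ]; ring
    rw [hlin]
    have hi : (i : ℝ) = q / P * (P * β * (q * j + u * i) + P * i / q) -
        P * q * β * ((q * j + u * i) / P) := by
      field_simp; ring
    have hc1 : (q / P) ^ 2 ≤ 1 := pow_le_one₀ (by positivity) hqP1
    have hc2 : (P * q * β) ^ 2 ≤ 1 := by
      rw [← sq_abs, abs_mul, abs_of_pos (by positivity : 0 < P * q)]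
      exact pow_le_one₀ (by positivity) hPq
    generalize P * β * (q * j + u * i) + P * i / q = A at *
    generalize ((q : ℝ) * j + u * i) / P = B at *
    generalize (q : ℝ) / P = c at *
    generalize P * q * β = c' at *
    have h1 : 1 + (0 + 1 * (i : ℝ)) ^ 2 ≤ 2 * ((1 + A ^ 2) * (1 + B ^ 2)) := by
      have : (i : ℝ) ^ 2 ≤ 2 * (c ^ 2 * A ^ 2) + 2 * (c' ^ 2 * B ^ 2) := by
        rw [hi]; nlinarith [sq_nonneg (c * A + c' * B)]
      have a1 : c ^ 2 * A ^ 2 ≤ A ^ 2 := mul_le_of_le_one_left (sq_nonneg _) hc1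
      have a2 : c' ^ 2 * B ^ 2 ≤ B ^ 2 := mul_le_of_le_one_left (sq_nonneg _) hc2
      nlinarith [mul_nonneg (sq_nonneg A) (sq_nonneg B)]
    have h2 : 1 + (B + ε * A) ^ 2 ≤ 2 * ((1 + A ^ 2) * (1 + B ^ 2)) := by
      have : (B + ε * A) ^ 2 ≤ 2 * B ^ 2 + 2 * A ^ 2 := by
        have : (ε * A) ^ 2 = A ^ 2 := by rw [mul_pow, hε, one_mul]
        nlinarith [sq_nonneg (B - ε * A)]
      nlinarith [mul_nonneg (sq_nonneg A) (sq_nonneg B)]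
    rw [← mul_inv, mul_assoc, ← mul_inv, ← div_eq_mul_inv 4, inv_eq_one_div,
      div_le_div_iff₀ (by positivity) (by positivity), one_mul]
    calc _ ≤ (2 * ((1 + A ^ 2) * (1 + B ^ 2))) * (2 * ((1 + A ^ 2) * (1 + B ^ 2))) := by
          gcongr
      _ = _ := by ring
  rw [← ENNReal.tsum_prod (f := fun h l : ℤ => ENNReal.ofReal
      (((1 + (h / P) ^ 2) ^ 2)⁻¹ * ((1 + (P * (α * h - l)) ^ 2) ^ 2)⁻¹)), ← e.tsum_eq,
    ENNReal.tsum_prod']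
  calc _ ≤ ∑' i : ℤ, ∑' j : ℤ, ENNReal.ofReal (4 * (1 + ((0 : ℝ) + 1 * i) ^ 2)⁻¹ *
        (1 + ((u * i / P + ε * (P * β * u * i + P * i / q)) + δ * j) ^ 2)⁻¹) :=
        ENNReal.tsum_le_tsum fun i => ENNReal.tsum_le_tsum fun j =>
          ENNReal.ofReal_le_ofReal (key i j)
    _ ≤ ∑' i : ℤ, ENNReal.ofReal (1 + ((0 : ℝ) + 1 * i) ^ 2)⁻¹ *
        ENNReal.ofReal (4 * ((2 + 2 * δ ^ 2) * (Real.pi / δ))) := by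
        refine ENNReal.tsum_le_tsum fun i => ?_
        have : ∀ j : ℤ, ENNReal.ofReal (4 * (1 + ((0 : ℝ) + 1 * i) ^ 2)⁻¹ *
            (1 + ((u * i / P + ε * (P * β * u * i + P * i / q)) + δ * j) ^ 2)⁻¹) =
            ENNReal.ofReal (1 + ((0 : ℝ) + 1 * i) ^ 2)⁻¹ * (ENNReal.ofReal 4 *
            ENNReal.ofReal
              (1 + ((u * i / P + ε * (P * β * u * i + P * i / q)) + δ * j) ^ 2)⁻¹) := by
          intro j
          rw [← ENNReal.ofReal_mul (by positivity), ← ENNReal.ofReal_mul (by positivity)]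
          ring_nf
        simp_rw [this]
        rw [ENNReal.tsum_mul_left, ENNReal.tsum_mul_left,
          ENNReal.ofReal_mul (by norm_num : (0 : ℝ) ≤ 4)]
        gcongr
        exact tsum_ofReal_inv_one_add_sq_le hδ _
    _ ≤ ENNReal.ofReal ((2 + 2 * 1 ^ 2) * (Real.pi / 1)) *
        ENNReal.ofReal (4 * ((2 + 2 * δ ^ 2) * (Real.pi / δ))) := by
        rw [ENNReal.tsum_mul_right]
        gcongr
        exact tsum_ofReal_inv_one_add_sq_le one_pos 0
    _ ≤ _ := by
        rw [← ENNReal.ofReal_mul (by positivity)]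
        refine ENNReal.ofReal_le_ofReal ?_
        have e1 : q * P * (1 / P ^ 2 + |β|) = δ := by rw [hδd]; field_simp
        rw [e1]
        have : δ ^ 2 ≤ 4 := by nlinarith
        calc _ = Real.pi ^ 2 / δ * (16 * (2 + 2 * δ ^ 2)) := by ring
          _ ≤ Real.pi ^ 2 / δ * 160 := by gcongr; linarith
          _ = _ := by ring

/-- Fourier transforms of real Gaussian monomials decay like the inverse fourth power. -/
lemma norm_gaussMoment_real_le (k : ℕ) : ∃ C : ℝ, 0 < C ∧ ∀ P : ℝ, 0 < P → ∀ ξ : ℝ,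
    ‖gaussMoment k ((2 / P ^ 2 : ℝ) : ℂ) ξ‖ ≤ C * P ^ (k + 1) * ((1 + (P * ξ) ^ 2) ^ 2)⁻¹ := by
  obtain ⟨C₀, hC₀, h₀⟩ := norm_gaussMoment_le k
  obtain ⟨C₂, hC₂, h₂⟩ := pow_mul_norm_gaussMoment_le 2 k
  obtain ⟨C₄, hC₄, h₄⟩ := pow_mul_norm_gaussMoment_le 4 k
  refine ⟨C₀ + 4 * C₂ * 2 + 4 * C₄ * 4, by positivity, fun P hP ξ => ?_⟩
  have hs : 0 < Real.sqrt 2 := by positivity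
  have hs2 : Real.sqrt 2 ^ 2 = 2 := Real.sq_sqrt (by norm_num)
  have hs1 : 1 ≤ Real.sqrt 2 := by
    rw [Real.one_le_sqrt]; norm_num
  set R := P / Real.sqrt 2 with hR
  have hR0 : 0 < R := by positivity
  have hPR : P ^ 2 = 2 * R ^ 2 := by rw [hR, div_pow, hs2]; ring
  have hRP : R ≤ P := div_le_self hP.le hs1
  have hw : ((2 / P ^ 2 : ℝ) : ℂ).re = 1 / R ^ 2 := by
    rw [Complex.ofReal_re, hPR]; field_simp
  have hn : ‖((2 / P ^ 2 : ℝ) : ℂ)‖ * R = 1 / R := by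
    rw [Complex.norm_real, Real.norm_of_nonneg (by positivity), hPR]; field_simp
  have e0 := h₀ R hR0 _ hw ξ
  have e2 := h₂ R hR0 _ hw ξ
  have e4 := h₄ R hR0 _ hw ξ
  rw [hn] at e2 e4
  set J := ‖gaussMoment k ((2 / P ^ 2 : ℝ) : ℂ) ξ‖
  have hJ : 0 ≤ J := norm_nonneg _
  rw [← div_eq_mul_inv, le_div_iff₀ (by positivity)]
  have e2' : R ^ 2 * ξ ^ 2 * J ≤ C₂ * R ^ (k + 1) := by
    have := mul_le_mul_of_nonneg_left e2 (sq_nonneg R)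
    rw [sq_abs] at this
    calc _ = R ^ 2 * (ξ ^ 2 * J) := by ring
      _ ≤ _ := this
      _ = _ := by field_simp
  have e4' : R ^ 4 * ξ ^ 4 * J ≤ C₄ * R ^ (k + 1) := by
    have := mul_le_mul_of_nonneg_left e4 (by positivity : 0 ≤ R ^ 4)
    rw [show |ξ| ^ 4 = ξ ^ 4 from Even.pow_abs (by decide) ξ] at this
    calc _ = R ^ 4 * (ξ ^ 4 * J) := by ring
      _ ≤ _ := this
      _ = _ := by field_simp
  have hpow : R ^ (k + 1) ≤ P ^ (k + 1) := by gcongr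
  have ex : J * (1 + (P * ξ) ^ 2) ^ 2 = J + 4 * (R ^ 2 * ξ ^ 2 * J) + 4 * (R ^ 4 * ξ ^ 4 * J) := by
    rw [mul_pow, hPR]; ring
  rw [ex]
  have hcc : 0 ≤ C₂ * R ^ (k + 1) := by positivity
  have hcd : 0 ≤ C₄ * R ^ (k + 1) := by positivity
  calc _ ≤ C₀ * R ^ (k + 1) + 4 * (C₂ * R ^ (k + 1)) + 4 * (C₄ * R ^ (k + 1)) := by gcongr
    _ ≤ (C₀ + 4 * C₂ * 2 + 4 * C₄ * 4) * R ^ (k + 1) := by linarith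
    _ ≤ _ := by gcongr

lemma exists_pow_mul_exp_le_inv_sq (k : ℕ) : ∃ C : ℝ, 0 < C ∧ ∀ P : ℝ, 0 < P → ∀ x : ℝ,
    |x| ^ k * Real.exp (-(1 / P ^ 2) * (x ^ 2 / 2)) ≤ C * P ^ k * ((1 + (x / P) ^ 2) ^ 2)⁻¹ := by
  obtain ⟨C₀, hC₀, h₀⟩ := exists_pow_mul_exp_neg_sq_le k
  obtain ⟨C₂, hC₂, h₂⟩ := exists_pow_mul_exp_neg_sq_le (k + 2)
  obtain ⟨C₄, hC₄, h₄⟩ := exists_pow_mul_exp_neg_sq_le (k + 4)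
  have hs : 0 < Real.sqrt 2 := by positivity
  have hs2 : Real.sqrt 2 ^ 2 = 2 := Real.sq_sqrt (by norm_num)
  refine ⟨C₀ * Real.sqrt 2 ^ k + 2 * (C₂ * Real.sqrt 2 ^ (k + 2)) + C₄ * Real.sqrt 2 ^ (k + 4),
    by positivity, fun P hP x => ?_⟩
  have hexp : Real.exp (-(1 / P ^ 2) * (x ^ 2 / 2)) =
      Real.exp (-(1 / (Real.sqrt 2 * P) ^ 2) * x ^ 2) := by
    congr 1; rw [mul_pow, hs2]; field_simp
  have e0 := h₀ (Real.sqrt 2 * P) (by positivity) x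
  have e2 := h₂ (Real.sqrt 2 * P) (by positivity) x
  have e4 := h₄ (Real.sqrt 2 * P) (by positivity) x
  rw [hexp]
  generalize Real.exp (-(1 / (Real.sqrt 2 * P) ^ 2) * x ^ 2) = E at *
  rw [← div_eq_mul_inv, le_div_iff₀ (by positivity), ← sq_abs (x / P), abs_div,
    abs_of_pos hP]
  have ex : |x| ^ k * E * (1 + (|x| / P) ^ 2) ^ 2 =
      |x| ^ k * E + 2 * ((|x| ^ (k + 2) * E) / P ^ 2) +
      (|x| ^ (k + 4) * E) / P ^ 4 := by
    field_simp; ring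
  rw [ex]
  calc _ ≤ C₀ * (Real.sqrt 2 * P) ^ k + 2 * (C₂ * (Real.sqrt 2 * P) ^ (k + 2) / P ^ 2) +
        C₄ * (Real.sqrt 2 * P) ^ (k + 4) / P ^ 4 := by gcongr
    _ = _ := by
      simp only [mul_pow]; field_simp; ring

lemma summable_norm_gaussMono (k : ℕ) {w : ℂ} (hw : 0 < w.re) (ξ s : ℝ) :
    Summable fun n : ℤ => ‖gaussMono k w ξ (s + n)‖ := by
  simpa only [add_comm s] using (summable_gaussMono k hw ξ s).norm

/-- The sum along the `h`-th diagonal in the squared modulus of a quadratic Gaussian sum. -/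
lemma gaussMono_mul_conj (k : ℕ) (P α y h : ℝ) :
    gaussMono k (1 / P ^ 2 - 2 * Real.pi * Complex.I * α) 0 (y + h) *
      (starRingEnd ℂ) (gaussMono k (1 / P ^ 2 - 2 * Real.pi * Complex.I * α) 0 y) =
    ∑ i ∈ range (k + 1), (Real.exp (-(1 / P ^ 2) * (h ^ 2 / 2)) * (-(h ^ 2) / 4) ^ (k - i) *
      k.choose i : ℂ) *
      gaussMono (2 * i) ((2 / P ^ 2 : ℝ) : ℂ) (-(α * (2 * h))) (y + h / 2) := by
  simp only [gaussMono, map_mul, map_pow, Complex.conj_ofReal, ← Complex.exp_conj]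
  have e1 : ∀ i : ℕ, (Real.exp (-(1 / P ^ 2) * (h ^ 2 / 2)) * (-(h ^ 2) / 4) ^ (k - i) *
      k.choose i : ℂ) * (((y + h / 2 : ℝ) : ℂ) ^ (2 * i) *
        Complex.exp (-((2 / P ^ 2 : ℝ) : ℂ) * ((y + h / 2 : ℝ) : ℂ) ^ 2 -
          2 * Real.pi * Complex.I * ((-(α * (2 * h)) : ℝ) : ℂ) * ((y + h / 2 : ℝ) : ℂ))) =
      ((((y : ℂ) + h / 2) ^ 2) ^ i * (-(h ^ 2) / 4) ^ (k - i) * k.choose i) *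
      (Real.exp (-(1 / P ^ 2) * (h ^ 2 / 2)) *
        Complex.exp (-((2 / P ^ 2 : ℝ) : ℂ) * ((y + h / 2 : ℝ) : ℂ) ^ 2 -
          2 * Real.pi * Complex.I * ((-(α * (2 * h)) : ℝ) : ℂ) * ((y + h / 2 : ℝ) : ℂ))) := by
    intro i; rw [← pow_mul]; push_cast; ring
  simp_rw [e1]
  rw [← sum_mul, ← add_pow, Complex.ofReal_exp, ← Complex.exp_add, mul_mul_mul_comm,
    ← Complex.exp_add, ← mul_pow]
  congr 1
  · congr 1; push_cast; ring
  · congr 1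
    simp only [map_sub, map_neg, map_mul, map_pow, map_div₀, map_one, Complex.conj_ofReal,
      Complex.conj_I, map_ofNat, Complex.ofReal_zero, map_zero]
    push_cast
    ring

lemma summable_mul_conj_shift {f : ℤ → ℂ} (hf : Summable fun n => ‖f n‖) :
    Summable fun p : ℤ × ℤ => f (p.2 + p.1) * (starRingEnd ℂ) (f p.2) := by
  have hgs : Summable fun n => ‖(starRingEnd ℂ) (f n)‖ := by
    simpa only [Complex.norm_conj] using hf
  refine (summable_mul_of_summable_norm hf hgs).comp_injective
      (i := fun p : ℤ × ℤ => (p.2 + p.1, p.2)) fun p p' h => ?_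
  simp only [Prod.mk.injEq] at h
  exact Prod.ext (by linarith [h.1, h.2]) h.2

lemma norm_tsum_sq_eq {f : ℤ → ℂ}
    (hsum : Summable fun p : ℤ × ℤ => f (p.2 + p.1) * (starRingEnd ℂ) (f p.2)) :
    (‖∑' n, f n‖ : ℂ) ^ 2 = ∑' h : ℤ, ∑' n : ℤ, f (n + h) * (starRingEnd ℂ) (f n) := by
  have hs : Summable (Function.uncurry fun h n : ℤ => f (n + h) * (starRingEnd ℂ) (f n)) := hsum
  refine Eq.trans ?_ hs.tsum_comm
  rw [← Complex.mul_conj', Complex.conj_tsum, ← tsum_mul_left]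
  refine tsum_congr fun n => ?_
  rw [tsum_mul_right, ← (Equiv.addLeft n).tsum_eq f]
  rfl

set_option maxHeartbeats 1000000 in
/-- Weyl differencing for the quadratic Gaussian sums. -/
lemma norm_sq_tsum_gaussMono_le (k : ℕ) : ∃ C : ℝ, 0 < C ∧ ∀ P : ℝ, 0 < P → ∀ α : ℝ, ∀ a : ℤ,
    ∀ q : ℕ, 0 < q → q ≤ P → IsCoprime a (q : ℤ) → |α - a / q| ≤ 1 / (q * P) → ∀ s : ℝ,
      ‖∑' n : ℤ, gaussMono k (1 / P ^ 2 - 2 * Real.pi * Complex.I * α) 0 (s + n)‖ ^ 2 ≤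
        C * P ^ (2 * k) / (q * (1 / P ^ 2 + |α - a / q|)) := by
  choose A hA hA' using norm_gaussMoment_real_le
  choose B hB hB' using exists_pow_mul_exp_le_inv_sq
  set D : ℝ := ∑ i ∈ range (k + 1), B (2 * (k - i)) * k.choose i * A (2 * i) with hD
  have hD0 : 0 ≤ D := sum_nonneg fun i _ => by
    have := hA (2 * i)
    have := hB (2 * (k - i))
    positivity
  refine ⟨16 * D * (160 * Real.pi ^ 2) + 1, by positivity,
    fun P hP α a q hq hqP haq hβ s => ?_⟩
  have hq' : (0 : ℝ) < q := by exact_mod_cast hq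
  set w : ℂ := 1 / P ^ 2 - 2 * Real.pi * Complex.I * α with hw
  have hwre : w.re = 1 / P ^ 2 := by
    have : w = ((1 / P ^ 2 : ℝ) : ℂ) - ((2 * Real.pi * α : ℝ) : ℂ) * Complex.I := by
      rw [hw]; push_cast; ring
    rw [this, Complex.sub_re, Complex.ofReal_re, Complex.re_ofReal_mul, Complex.I_re, mul_zero,
      sub_zero]
  have hw0 : 0 < w.re := by rw [hwre]; positivity
  set f : ℤ → ℂ := fun n => gaussMono k w 0 (s + n) with hf
  have hfs : Summable fun n => ‖f n‖ := summable_norm_gaussMono k hw0 0 s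
  set T : ℤ → ℂ := fun h => ∑' n : ℤ, f (n + h) * (starRingEnd ℂ) (f n) with hT
  have hsq : (‖∑' n, f n‖ : ℂ) ^ 2 = ∑' h, T h := 
    norm_tsum_sq_eq (summable_mul_conj_shift hfs)
  have hTn : ∀ h : ℤ, ‖T h‖ₑ ≤ ENNReal.ofReal (16 * D * P ^ (2 * k + 1)) *
      ∑' l : ℤ, ENNReal.ofReal (((1 + ((2 * h : ℤ) / P) ^ 2) ^ 2)⁻¹ *
        ((1 + (P * (α * (2 * h : ℤ) - l)) ^ 2) ^ 2)⁻¹) := by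
    intro h
    have hu : 0 < ((2 / P ^ 2 : ℝ) : ℂ).re := by rw [Complex.ofReal_re]; positivity
    have e1 : T h = ∑ i ∈ range (k + 1), (Real.exp (-(1 / P ^ 2) * ((h : ℝ) ^ 2 / 2)) *
        (-(((h : ℝ) : ℂ) ^ 2) / 4) ^ (k - i) * k.choose i : ℂ) *
        ∑' n : ℤ, gaussMono (2 * i) ((2 / P ^ 2 : ℝ) : ℂ) (-(α * (2 * (h : ℝ))))
          ((s + (h : ℝ) / 2) + n) := by
      simp_rw [← tsum_mul_left]
      rw [← Summable.tsum_finsetSum]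
      · refine tsum_congr fun n => ?_
        have := gaussMono_mul_conj k P α (s + n) h
        rw [← hw] at this
        simp only [hf]
        push_cast
        rw [← add_assoc, this]
        refine sum_congr rfl fun i _ => ?_
        rw [add_right_comm]
        push_cast
        rfl
      · intro i _
        exact ((summable_norm_gaussMono _ hu _ _).of_norm).mul_left _
    set x : ℝ := (1 + ((2 * h : ℤ) / P) ^ 2) with hx
    set G : ℝ := ∑' l : ℤ, ((1 + (P * (α * (2 * h : ℤ) - l)) ^ 2) ^ 2)⁻¹ with hG
    have hGs : Summable fun l : ℤ => ((1 + (P * (α * (2 * h : ℤ) - l)) ^ 2) ^ 2)⁻¹ := by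
      have := (summable_inv_one_add_sq hP (-(P * (α * (2 * h : ℤ))))).1
      refine Summable.of_nonneg_of_le (fun l => by positivity) (fun l => ?_) this
      rw [show -(P * (α * (2 * h : ℤ))) + P * l = -(P * (α * (2 * h : ℤ) - l)) by ring, neg_sq]
      refine inv_anti₀ (by positivity) ?_
      exact le_self_pow₀ (by nlinarith [sq_nonneg (P * (α * (2 * h : ℤ) - l))]) two_ne_zero
    have hG0 : 0 ≤ G := tsum_nonneg fun l => by positivity
    have hmain : ‖T h‖ ≤ 16 * D * P ^ (2 * k + 1) * ((x ^ 2)⁻¹ * G) := by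
      rw [e1]
      refine (norm_sum_le _ _).trans ?_
      have hterm : ∀ i ∈ range (k + 1), ‖(Real.exp (-(1 / P ^ 2) * ((h : ℝ) ^ 2 / 2)) *
          (-(((h : ℝ) : ℂ) ^ 2) / 4) ^ (k - i) * k.choose i : ℂ) *
          ∑' n : ℤ, gaussMono (2 * i) ((2 / P ^ 2 : ℝ) : ℂ) (-(α * (2 * (h : ℝ))))
            ((s + (h : ℝ) / 2) + n)‖ ≤
          (B (2 * (k - i)) * k.choose i * A (2 * i)) *
            (16 * P ^ (2 * k + 1) * ((x ^ 2)⁻¹ * G)) := by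
        intro i hi
        have hik : i ≤ k := Nat.lt_succ_iff.1 (mem_range.1 hi)
        have b1 : ‖∑' n : ℤ, gaussMono (2 * i) ((2 / P ^ 2 : ℝ) : ℂ) (-(α * (2 * (h : ℝ))))
            ((s + (h : ℝ) / 2) + n)‖ ≤ A (2 * i) * P ^ (2 * i + 1) * G := by
          refine (norm_tsum_gaussMono_le _ hu _ _).trans ?_
          rw [hG, ← tsum_mul_left]
          refine (summable_gaussMoment _ hu _).tsum_le_tsum (fun l => ?_) (hGs.mul_left _)
          refine (hA' (2 * i) P hP _).trans_eq ?_
          congr 3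
          push_cast
          ring
        have b2 : ‖(Real.exp (-(1 / P ^ 2) * ((h : ℝ) ^ 2 / 2)) *
            (-(((h : ℝ) : ℂ) ^ 2) / 4) ^ (k - i) * k.choose i : ℂ)‖ ≤
            B (2 * (k - i)) * P ^ (2 * (k - i)) * (16 * (x ^ 2)⁻¹) * k.choose i := by
          rw [norm_mul, norm_mul, norm_pow, norm_div, norm_neg, norm_pow, Complex.norm_real,
            Complex.norm_real, Complex.norm_natCast, Real.norm_of_nonneg (Real.exp_pos _).le,
            Real.norm_eq_abs, Complex.norm_ofNat, div_pow, ← pow_mul]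
          have := hB' (2 * (k - i)) P hP h
          have hx2 : ((1 + ((h : ℝ) / P) ^ 2) ^ 2)⁻¹ ≤ 16 * (x ^ 2)⁻¹ := by
            rw [← div_eq_mul_inv, inv_eq_one_div, div_le_div_iff₀ (by positivity) (by positivity),
              one_mul]
            have : x ≤ 4 * (1 + ((h : ℝ) / P) ^ 2) := by
              rw [hx]; push_cast
              rw [mul_div_assoc, mul_pow]; nlinarith [sq_nonneg ((h : ℝ) / P)]
            calc x ^ 2 ≤ (4 * (1 + ((h : ℝ) / P) ^ 2)) ^ 2 := by gcongr
              _ = _ := by ring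
          have h4 : (1 : ℝ) ≤ 4 ^ (k - i) := one_le_pow₀ (by norm_num)
          refine mul_le_mul_of_nonneg_right ?_ (Nat.cast_nonneg _)
          calc _ = (|(h : ℝ)| ^ (2 * (k - i)) * Real.exp (-(1 / P ^ 2) * ((h : ℝ) ^ 2 / 2))) /
                4 ^ (k - i) := by ring
            _ ≤ |(h : ℝ)| ^ (2 * (k - i)) * Real.exp (-(1 / P ^ 2) * ((h : ℝ) ^ 2 / 2)) :=
                div_le_self (by positivity) h4
            _ ≤ _ := this
            _ ≤ B (2 * (k - i)) * P ^ (2 * (k - i)) * (16 * (x ^ 2)⁻¹) := by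
                have := hB (2 * (k - i))
                gcongr
        rw [norm_mul]
        refine (mul_le_mul b2 b1 (norm_nonneg _) ?_).trans_eq ?_
        · have := hB (2 * (k - i))
          positivity
        · have : P ^ (2 * k + 1) = P ^ (2 * (k - i)) * P ^ (2 * i + 1) := by
            rw [← pow_add]; congr 1; omega
          rw [this]; ring
      refine (sum_le_sum hterm).trans_eq ?_
      rw [← sum_mul, ← hD]; ring
    rw [← ofReal_norm]
    refine (ENNReal.ofReal_le_ofReal hmain).trans_eq ?_
    rw [ENNReal.ofReal_mul (by positivity), ← ENNReal.ofReal_tsum_of_nonneg, tsum_mul_left]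
    · intro l; positivity
    · exact hGs.mul_left _
  have hfin : ENNReal.ofReal (‖∑' n, f n‖ ^ 2) ≤ ENNReal.ofReal (16 * D * P ^ (2 * k + 1) *
      (160 * Real.pi ^ 2 / (q * P * (1 / P ^ 2 + |α - a / q|)))) := by
    have : ENNReal.ofReal (‖∑' n, f n‖ ^ 2) = ‖∑' h, T h‖ₑ := by
      rw [← hsq, ← ofReal_norm, norm_pow, Complex.norm_real, norm_norm]
    rw [this]
    calc _ ≤ ∑' h, ‖T h‖ₑ := enorm_tsum_le_tsum_enorm
      _ ≤ _ := ENNReal.tsum_le_tsum hTn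
      _ ≤ ENNReal.ofReal (16 * D * P ^ (2 * k + 1)) * ∑' h : ℤ, ∑' l : ℤ,
          ENNReal.ofReal (((1 + (h / P) ^ 2) ^ 2)⁻¹ *
            ((1 + (P * (α * h - l)) ^ 2) ^ 2)⁻¹) := by
          rw [ENNReal.tsum_mul_left]
          exact mul_le_mul_right (α := ENNReal) (ENNReal.tsum_comp_le_tsum_of_injective
            (f := fun h : ℤ => 2 * h) (fun a b hab => by simpa using hab)
            (fun h : ℤ => ∑' l : ℤ, ENNReal.ofReal (((1 + (h / P) ^ 2) ^ 2)⁻¹ *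
              ((1 + (P * (α * h - l)) ^ 2) ^ 2)⁻¹))) _
      _ ≤ _ := by
          rw [ENNReal.ofReal_mul (p := 16 * D * P ^ (2 * k + 1)) (by positivity)]
          refine mul_le_mul_right (α := ENNReal) ?_ _
          exact tsum_lattice_le hP hq hqP haq hβ
  rw [ENNReal.ofReal_le_ofReal_iff (by positivity)] at hfin
  refine hfin.trans ?_
  have ht : 0 < 1 / P ^ 2 + |α - a / q| := by positivity
  generalize 1 / P ^ 2 + |α - a / q| = t at ht
  calc _ = (16 * D * (160 * Real.pi ^ 2)) * P ^ (2 * k) / (q * t) := by field_simp; ring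
    _ ≤ _ := by gcongr; linarith

/-- Products of absolutely convergent series over `ℤ` are series over the lattice `ℤ ^ N`. -/
lemma summable_norm_prod_and_tsum_prod_eq (N : ℕ) (f : Fin N → ℤ → ℂ)
    (hf : ∀ i, Summable fun n => ‖f i n‖) :
    (Summable fun b : Fin N → ℤ => ‖∏ i, f i (b i)‖) ∧
      ∑' b : Fin N → ℤ, ∏ i, f i (b i) = ∏ i, ∑' n, f i n := by
  induction N with
  | zero => exact ⟨(hasSum_fintype _).summable, by simp⟩
  | succ N ih =>
    obtain ⟨h1, h2⟩ := ih (fun i => f i.succ) fun i => hf i.succ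
    have e : ∀ p : ℤ × (Fin N → ℤ), ∏ i, f i (Fin.consEquiv (fun _ => ℤ) p i) =
        f 0 p.1 * ∏ i, f (Fin.succ i) (p.2 i) := fun p => by
      rw [Fin.prod_univ_succ]; rfl
    constructor
    · rw [← (Fin.consEquiv fun _ => ℤ).summable_iff]
      refine (summable_mul_of_summable_norm (hf 0) h1).norm.congr fun p => ?_
      rw [← e]; rfl
    · rw [← (Fin.consEquiv fun _ => ℤ).tsum_eq, Fin.prod_univ_succ, ← h2,
        tsum_mul_tsum_of_summable_norm (hf 0) h1]
      exact tsum_congr e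

/-- Telescoping bound for the difference of two products. -/
lemma norm_prod_sub_prod_le_of_le (N : ℕ) {x y : Fin N → ℂ} {Y E : ℝ} (hY : 0 ≤ Y)
    (hx : ∀ i, ‖x i‖ ≤ Y) (hy : ∀ i, ‖y i‖ ≤ Y) (hxy : ∀ i, ‖x i - y i‖ ≤ E) :
    ‖∏ i, x i - ∏ i, y i‖ ≤ N * (Y ^ (N - 1) * E) := by
  induction N with
  | zero => simp
  | succ N ih =>
    have hE : 0 ≤ E := (norm_nonneg _).trans (hxy 0)
    have h1 := ih (fun i => hx i.succ) (fun i => hy i.succ) fun i => hxy i.succ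
    rw [Fin.prod_univ_succ, Fin.prod_univ_succ]
    have e : x 0 * ∏ i : Fin N, x i.succ - y 0 * ∏ i : Fin N, y i.succ =
        x 0 * (∏ i : Fin N, x i.succ - ∏ i : Fin N, y i.succ) +
          (x 0 - y 0) * ∏ i : Fin N, y i.succ := by ring
    have h2 : ‖∏ i : Fin N, y i.succ‖ ≤ Y ^ N := by
      rw [norm_prod]
      refine (prod_le_prod (fun _ _ => norm_nonneg _) fun i _ => hy (Fin.succ i)).trans_eq ?_
      simp
    rw [e]
    refine (norm_add_le _ _).trans ?_
    rw [norm_mul, norm_mul]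
    have h3 : Y * (N * (Y ^ (N - 1) * E)) = N * (Y ^ N * E) := by
      rcases N with _ | N
      · simp
      · rw [Nat.add_sub_cancel]; ring
    calc _ ≤ Y * (N * (Y ^ (N - 1) * E)) + E * Y ^ N := by
          gcongr
          · exact hx 0
          · exact hxy 0
      _ = _ := by rw [h3]; simp only [Nat.add_sub_cancel]; push_cast; ring

lemma MvPolynomial.IsHomogeneous.sum_eq_of_mem_support {N κ : ℕ} {M : MvPolynomial (Fin N) ℝ}
    (hM : M.IsHomogeneous κ) {μ : Fin N →₀ ℕ} (hμ : μ ∈ M.support) : ∑ i, μ i = κ := by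
  have : μ.degree = κ := by
    by_contra h
    exact (MvPolynomial.mem_support_iff.1 hμ) (hM.coeff_eq_zero h)
  rw [← this, Finsupp.degree_eq_sum]

/-- A polynomial times a Gaussian, as a function on `ℝ ^ N`. -/
noncomputable def gaussPoly {N : ℕ} (M : MvPolynomial (Fin N) ℝ) (w : ℂ) (x : Fin N → ℝ) : ℂ :=
  ((MvPolynomial.eval x M : ℝ) : ℂ) * Complex.exp (-w * ((∑ i, x i ^ 2 : ℝ) : ℂ))

lemma gaussPoly_eq_sum {N : ℕ} (M : MvPolynomial (Fin N) ℝ) (w : ℂ) (x : Fin N → ℝ) :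
    gaussPoly M w x = ∑ μ ∈ M.support, ((M.coeff μ : ℝ) : ℂ) * ∏ i, gaussMono (μ i) w 0 (x i) := by
  have e : ∀ μ : Fin N →₀ ℕ, ∏ i, gaussMono (μ i) w 0 (x i) =
      (∏ i, (x i : ℂ) ^ μ i) * Complex.exp (-w * ((∑ i, x i ^ 2 : ℝ) : ℂ)) := by
    intro μ
    simp only [gaussMono]
    rw [prod_mul_distrib, ← Complex.exp_sum]
    congr 2
    push_cast
    rw [mul_sum]
    refine sum_congr rfl fun i _ => ?_
    ring
  simp_rw [e]
  rw [gaussPoly, MvPolynomial.eval_eq', Complex.ofReal_sum, sum_mul]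
  refine sum_congr rfl fun μ _ => ?_
  push_cast
  ring

lemma norm_gaussPoly {N : ℕ} (M : MvPolynomial (Fin N) ℝ) (w : ℂ) (x : Fin N → ℝ) :
    ‖gaussPoly M w x‖ = |MvPolynomial.eval x M| * Real.exp (-w.re * ∑ i, x i ^ 2) := by
  rw [gaussPoly, norm_mul, Complex.norm_real, Complex.norm_exp, Complex.re_mul_ofReal,
    Complex.neg_re, Real.norm_eq_abs]

section

variable {N : ℕ} (M : MvPolynomial (Fin N) ℝ)

lemma summable_gaussPoly {w : ℂ} (hw : 0 < w.re) (s : ℝ) :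
    Summable fun b : Fin N → ℤ => ‖gaussPoly M w fun i => s + b i‖ := by
  have h : ∀ μ : Fin N →₀ ℕ, Summable fun b : Fin N → ℤ =>
      ((M.coeff μ : ℝ) : ℂ) * ∏ i, gaussMono (μ i) w 0 (s + b i) := fun μ =>
    ((summable_norm_prod_and_tsum_prod_eq N (fun i n => gaussMono (μ i) w 0 (s + n))
      fun i => summable_norm_gaussMono _ hw 0 s).1.of_norm).mul_left _
  refine Summable.norm ?_
  simp_rw [gaussPoly_eq_sum]
  exact summable_sum fun μ _ => h μ

lemma tsum_gaussPoly {w : ℂ} (hw : 0 < w.re) (s : ℝ) :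
    ∑' b : Fin N → ℤ, gaussPoly M w (fun i => s + b i) =
      ∑ μ ∈ M.support, ((M.coeff μ : ℝ) : ℂ) * ∏ i, ∑' n : ℤ, gaussMono (μ i) w 0 (s + n) := by
  have h : ∀ μ : Fin N →₀ ℕ, _ := fun μ =>
    summable_norm_prod_and_tsum_prod_eq N (fun i n => gaussMono (μ i) w 0 (s + n))
      fun i => summable_norm_gaussMono _ hw 0 s
  simp_rw [gaussPoly_eq_sum]
  rw [Summable.tsum_finsetSum fun μ _ => (h μ).1.of_norm.mul_left _]
  refine sum_congr rfl fun μ _ => ?_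
  rw [tsum_mul_left, (h μ).2]

lemma integrable_gaussPoly {w : ℂ} (hw : 0 < w.re) : Integrable (gaussPoly M w) := by
  have : gaussPoly M w =
      fun x => ∑ μ ∈ M.support, ((M.coeff μ : ℝ) : ℂ) * ∏ i, gaussMono (μ i) w 0 (x i) :=
    funext fun x => gaussPoly_eq_sum M w x
  rw [this]
  exact integrable_finsetSum _ fun μ _ =>
    (Integrable.fintype_prod fun i => integrable_gaussMono (μ i) hw 0).const_mul _

lemma integral_gaussPoly {w : ℂ} (hw : 0 < w.re) :
    ∫ x, gaussPoly M w x =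
      ∑ μ ∈ M.support, ((M.coeff μ : ℝ) : ℂ) * ∏ i, gaussMoment (μ i) w 0 := by
  simp_rw [gaussPoly_eq_sum]
  rw [integral_finsetSum _ fun μ _ =>
    (Integrable.fintype_prod fun i => integrable_gaussMono (μ i) hw 0).const_mul _]
  refine sum_congr rfl fun μ _ => ?_
  rw [integral_const_mul, integral_fintype_prod_volume_eq_prod]
  rfl

variable {M} {κ : ℕ}

lemma norm_sum_coeff_prod_sub_le (hM : M.IsHomogeneous κ) {S I : ℕ → ℂ} {P c Y E : ℝ}
    (hP : 0 < P) (hc : 0 ≤ c) (hY : 0 ≤ Y)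
    (hS : ∀ k ≤ κ, ‖S k‖ ≤ c * P ^ k * Y) (hI : ∀ k ≤ κ, ‖I k‖ ≤ c * P ^ k * Y)
    (hSI : ∀ k ≤ κ, ‖S k - I k‖ ≤ c * P ^ k * E) :
    ‖∑ μ ∈ M.support, ((M.coeff μ : ℝ) : ℂ) * ∏ i, S (μ i) -
      ∑ μ ∈ M.support, ((M.coeff μ : ℝ) : ℂ) * ∏ i, I (μ i)‖ ≤
      (∑ μ ∈ M.support, |M.coeff μ|) * N * c ^ (N - 1) * c * P ^ κ * (Y ^ (N - 1) * E) := by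
  rw [← sum_sub_distrib]
  refine (norm_sum_le _ _).trans ?_
  rw [sum_mul, sum_mul, sum_mul, sum_mul, sum_mul]
  refine sum_le_sum fun μ hμ => ?_
  have hdeg : ∑ i, μ i = κ := hM.sum_eq_of_mem_support hμ
  have hle : ∀ i, μ i ≤ κ := fun i => by
    rw [← hdeg]; exact single_le_sum (fun _ _ => Nat.zero_le _) (mem_univ i)
  have hp : ∀ f : ℕ → ℂ, ∏ i, f (μ i) = (P : ℂ) ^ κ * ∏ i, f (μ i) / (P : ℂ) ^ μ i := by
    intro f
    have : (P : ℂ) ≠ 0 := by exact_mod_cast hP.ne'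
    rw [prod_div_distrib, prod_pow_eq_pow_sum, hdeg]
    field_simp
  have hb : ∀ {z : ℂ} {i : Fin N} {R : ℝ}, ‖z‖ ≤ c * P ^ μ i * R → ‖z / (P : ℂ) ^ μ i‖ ≤ c * R := by
    intro z i R h
    rw [norm_div, norm_pow, Complex.norm_real, Real.norm_of_nonneg hP.le,
      div_le_iff₀ (by positivity)]
    linarith
  rw [← mul_sub, norm_mul, Complex.norm_real, Real.norm_eq_abs, hp S, hp I, ← mul_sub, norm_mul,
    norm_pow, Complex.norm_real, Real.norm_of_nonneg hP.le]
  have key := norm_prod_sub_prod_le_of_le N (x := fun i => S (μ i) / (P : ℂ) ^ μ i)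
    (y := fun i => I (μ i) / (P : ℂ) ^ μ i) (Y := c * Y) (E := c * E) (by positivity)
    (fun i => hb (hS _ (hle i))) (fun i => hb (hI _ (hle i))) fun i => by
      rw [← sub_div]; exact hb (hSI _ (hle i))
  calc _ ≤ |M.coeff μ| * (P ^ κ * (N * ((c * Y) ^ (N - 1) * (c * E)))) := by gcongr
    _ = _ := by rw [mul_pow]; ring

lemma norm_sum_coeff_prod_le (hM : M.IsHomogeneous κ) {S : ℕ → ℂ} {P c Y : ℝ}
    (hS : ∀ k ≤ κ, ‖S k‖ ≤ c * P ^ k * Y) :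
    ‖∑ μ ∈ M.support, ((M.coeff μ : ℝ) : ℂ) * ∏ i, S (μ i)‖ ≤
      (∑ μ ∈ M.support, |M.coeff μ|) * c ^ N * P ^ κ * Y ^ N := by
  refine (norm_sum_le _ _).trans ?_
  rw [sum_mul, sum_mul, sum_mul]
  refine sum_le_sum fun μ hμ => ?_
  have hdeg : ∑ i, μ i = κ := hM.sum_eq_of_mem_support hμ
  have hle : ∀ i, μ i ≤ κ := fun i => by
    rw [← hdeg]; exact single_le_sum (fun _ _ => Nat.zero_le _) (mem_univ i)
  rw [norm_mul, Complex.norm_real, Real.norm_eq_abs, norm_prod]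
  calc _ ≤ |M.coeff μ| * ∏ i, (c * P ^ μ i * Y) := by
        gcongr with i; exact hS _ (hle i)
    _ = _ := by
        rw [prod_mul_distrib, prod_mul_distrib, prod_pow_eq_pow_sum, hdeg]
        simp only [prod_const, card_univ, Fintype.card_fin]
        ring

end

/-- The exponent `1 / P ^ 2 - 2 π i α`; its negative exponential runs over the circle of radius
`exp (-1 / P ^ 2)`. -/
noncomputable def circleExponent (P α : ℝ) : ℂ :=
  1 / (P : ℂ) ^ 2 - 2 * Real.pi * Complex.I * α

lemma circleExponent_eq (P α : ℝ) :
    circleExponent P α = ((1 / P ^ 2 : ℝ) : ℂ) - ((2 * Real.pi * α : ℝ) : ℂ) * Complex.I := by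
  rw [circleExponent]; push_cast; ring

lemma re_circleExponent (P α : ℝ) : (circleExponent P α).re = 1 / P ^ 2 := by
  rw [circleExponent_eq, Complex.sub_re, Complex.ofReal_re, Complex.re_ofReal_mul, Complex.I_re,
    mul_zero, sub_zero]

lemma im_circleExponent (P α : ℝ) : (circleExponent P α).im = -(2 * Real.pi * α) := by
  rw [circleExponent_eq, Complex.sub_im, Complex.ofReal_im, Complex.im_ofReal_mul, Complex.I_im,
    mul_one, zero_sub]

lemma continuous_circleExponent (P : ℝ) : Continuous (circleExponent P) := by
  unfold circleExponent
  fun_prop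

lemma norm_circleExponent_sq (P α : ℝ) :
    ‖circleExponent P α‖ ^ 2 = (1 / P ^ 2) ^ 2 + (2 * Real.pi * α) ^ 2 := by
  rw [Complex.sq_norm, Complex.normSq_apply, re_circleExponent, im_circleExponent]
  ring

lemma norm_circleExponent_pos {P : ℝ} (hP : 0 < P) (α : ℝ) : 0 < ‖circleExponent P α‖ := by
  refine norm_pos_iff.2 fun h => ?_
  have := re_circleExponent P α
  rw [h, Complex.zero_re] at this
  have h2 : 0 < 1 / P ^ 2 := by positivity
  linarith

lemma norm_circleExponent_div_three_le {P α : ℝ} (hP : 1 ≤ P) (hα : |α| ≤ 1 / 2) :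
    ‖circleExponent P α‖ / 3 ≤ ‖1 - Complex.exp (-circleExponent P α)‖ := by
  set u : ℝ := 1 / P ^ 2 with hu
  have hu0 : 0 < u := by positivity
  have hu1 : u ≤ 1 := by
    rw [hu, div_le_one (by positivity)]; nlinarith
  set r := Real.exp (-u) with hr
  have hr3 : 1 / 3 ≤ r := by
    have h1 : Real.exp (-1) ≤ r := Real.exp_le_exp.2 (by linarith)
    have h2 : Real.exp (-1) * Real.exp 1 = 1 := by rw [← Real.exp_add]; simp
    have h3 := Real.exp_one_lt_d9
    nlinarith [Real.exp_pos (-1)]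
  have hr1 : u / 3 ≤ 1 - r := by
    have h1 : r * Real.exp u = 1 := by rw [hr, ← Real.exp_add]; simp
    have h2 := Real.add_one_le_exp u
    nlinarith
  have hsin : 2 * |α| ≤ |Real.sin (Real.pi * α)| := by
    have h := Real.mul_abs_le_abs_sin (x := Real.pi * α) (by
      rw [abs_mul, abs_of_pos Real.pi_pos]; nlinarith [Real.pi_pos])
    rw [abs_mul, abs_of_pos Real.pi_pos] at h
    have e : 2 / Real.pi * (Real.pi * |α|) = 2 * |α| := by
      field_simp
    linarith
  have hsin2 : 4 * α ^ 2 ≤ Real.sin (Real.pi * α) ^ 2 := by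
    rw [← sq_abs α, ← sq_abs (Real.sin _)]
    nlinarith [abs_nonneg α]
  have e : ‖1 - Complex.exp (-circleExponent P α)‖ ^ 2 =
      (1 - r) ^ 2 + 4 * r * Real.sin (Real.pi * α) ^ 2 := by
    rw [Complex.sq_norm, Complex.normSq_apply, Complex.sub_re, Complex.sub_im, Complex.exp_re,
      Complex.exp_im, Complex.neg_re, Complex.neg_im, re_circleExponent, im_circleExponent,
      ← hu, ← hr, neg_neg, Complex.one_re, Complex.one_im,
      show 2 * Real.pi * α = 2 * (Real.pi * α) by ring, Real.cos_two_mul, Real.sin_two_mul]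
    have := Real.sin_sq_add_cos_sq (Real.pi * α)
    have h2 : Real.sin (Real.pi * α) ^ 2 = 1 - Real.cos (Real.pi * α) ^ 2 := by linarith
    ring_nf
    rw [h2]
    ring
  refine (sq_le_sq₀ (by positivity) (norm_nonneg _)).1 ?_
  rw [e, div_pow, norm_circleExponent_sq, ← hu]
  have hpi : Real.pi ^ 2 ≤ 12 := by nlinarith [Real.pi_lt_d2, Real.pi_pos]
  have h1 : (u / 3) ^ 2 ≤ (1 - r) ^ 2 := by
    apply pow_le_pow_left₀ (by positivity) hr1
  have h2 : 4 * (1 / 3) * (4 * α ^ 2) ≤ 4 * r * Real.sin (Real.pi * α) ^ 2 := by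
    gcongr
  have h3 : (2 * Real.pi * α) ^ 2 ≤ 48 * α ^ 2 := by
    nlinarith [sq_nonneg α]
  linarith [sq_nonneg α]

/-- The geometric sum that extracts the coefficients of index at most `L` of a power series in
`exp (-w)`. -/
noncomputable def dualKernel (L : ℕ) (w : ℂ) : ℂ := ∑ n ∈ range (L + 1), Complex.exp (n * w)

lemma norm_dualKernel_le {P α : ℝ} (hP : 1 ≤ P) (hα : |α| ≤ 1 / 2) {L : ℕ}
    (hL : (L : ℝ) + 1 ≤ P ^ 2) :
    ‖dualKernel L (circleExponent P α)‖ ≤ 12 / ‖circleExponent P α‖ := by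
  set w := circleExponent P α with hw
  have hw0 : 0 < ‖w‖ := norm_circleExponent_pos (by linarith) α
  have h1 := norm_circleExponent_div_three_le hP hα
  rw [← hw] at h1
  have hre : w.re = 1 / P ^ 2 := re_circleExponent P α
  have hexp : ‖Complex.exp w - 1‖ = Real.exp (1 / P ^ 2) * ‖1 - Complex.exp (-w)‖ := by
    rw [← hre, ← Complex.norm_exp, ← norm_mul, mul_sub, ← Complex.exp_add]
    simp
  have h2 : ‖w‖ / 3 ≤ ‖Complex.exp w - 1‖ := by
    rw [hexp]
    have : 1 ≤ Real.exp (1 / P ^ 2) := Real.one_le_exp (by positivity)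
    nlinarith [norm_nonneg (1 - Complex.exp (-w))]
  have hne : Complex.exp w ≠ 1 := by
    intro h; rw [h, sub_self, norm_zero] at h2; linarith
  have e : dualKernel L w = (Complex.exp w ^ (L + 1) - 1) / (Complex.exp w - 1) := by
    rw [← geom_sum_eq hne, dualKernel]
    exact sum_congr rfl fun n _ => Complex.exp_nat_mul _ _
  have h3 : ‖Complex.exp w ^ (L + 1) - 1‖ ≤ 4 := by
    refine (norm_sub_le _ _).trans ?_
    rw [← Complex.exp_nat_mul, Complex.norm_exp, norm_one]
    have e2 : (((L + 1 : ℕ) : ℂ) * w).re = ((L : ℝ) + 1) * (1 / P ^ 2) := by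
      rw [← hre, Complex.mul_re, Complex.natCast_re, Complex.natCast_im]; push_cast; ring
    have h4 : ((L : ℝ) + 1) * (1 / P ^ 2) ≤ 1 := by
      rw [mul_one_div, div_le_one (by positivity)]; exact hL
    have h5 := Real.exp_le_exp.2 h4
    have h6 := Real.exp_one_lt_d9
    rw [e2]
    linarith
  rw [e, norm_div, div_le_div_iff₀ (by linarith) hw0]
  nlinarith

lemma integral_exp_int_mul_circleExponent (P : ℝ) (j : ℤ) :
    ∫ α in (-(1 / 2) : ℝ)..(1 / 2), Complex.exp (j * circleExponent P α) =
      if j = 0 then 1 else 0 := by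
  split_ifs with h
  · subst h; simp; norm_num
  · have hc : (-(2 * Real.pi * Complex.I * j) : ℂ) ≠ 0 := by
      simp [h, Real.pi_ne_zero]
    have e : ∀ α : ℝ, Complex.exp (j * circleExponent P α) =
        Complex.exp (j * (1 / (P : ℂ) ^ 2)) * Complex.exp (-(2 * Real.pi * Complex.I * j) * α) := by
      intro α
      rw [← Complex.exp_add, circleExponent]
      congr 1; ring
    simp_rw [e]
    rw [intervalIntegral.integral_const_mul, integral_exp_mul_complex hc]
    have e2 : Complex.exp (-(2 * Real.pi * Complex.I * j) * ((1 / 2 : ℝ) : ℂ)) =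
        Complex.exp (-(2 * Real.pi * Complex.I * j) * ((-(1 / 2) : ℝ) : ℂ)) := by
      rw [Complex.exp_eq_exp_iff_exists_int]
      refine ⟨-j, ?_⟩
      push_cast; ring
    rw [e2]; simp

section

variable {ι : Type*} {c : ι → ℂ} {Q : ι → ℕ} {P : ℝ}

lemma norm_mul_exp_neg_mul_circleExponent (P α : ℝ) (c : ℂ) (n : ℕ) :
    ‖c * Complex.exp (-circleExponent P α * n)‖ = ‖c‖ * Real.exp (-(1 / P ^ 2) * n) := by
  rw [norm_mul, Complex.norm_exp, ← Complex.ofReal_natCast, Complex.re_mul_ofReal,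
    Complex.neg_re, re_circleExponent]

lemma continuous_tsum_exp_circleExponent
    (hc : Summable fun b => ‖c b‖ * Real.exp (-(1 / P ^ 2) * Q b)) :
    Continuous fun α : ℝ => ∑' b, c b * Complex.exp (-circleExponent P α * Q b) := by
  refine continuous_tsum (fun b => ?_) hc fun b α => ?_
  · have := continuous_circleExponent P
    fun_prop
  · exact (norm_mul_exp_neg_mul_circleExponent P α _ _).le

/-- Cauchy's formula for a partial sum of the coefficients of a generating function. -/
lemma integral_tsum_mul_dualKernel [Countable ι]
    (hc : Summable fun b => ‖c b‖ * Real.exp (-(1 / P ^ 2) * Q b)) (L : ℕ) :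
    ∫ α in (-(1 / 2) : ℝ)..(1 / 2), (∑' b, c b * Complex.exp (-circleExponent P α * Q b)) *
      dualKernel L (circleExponent P α) = ∑' b, if Q b ≤ L then c b else 0 := by
  have hcont := continuous_circleExponent P
  have hK : Continuous fun α => dualKernel L (circleExponent P α) := by
    unfold dualKernel; fun_prop
  have hKb : ∀ α, ‖dualKernel L (circleExponent P α)‖ ≤
      ∑ n ∈ range (L + 1), Real.exp (n * (1 / P ^ 2)) := by
    intro α
    refine (norm_sum_le _ _).trans (sum_le_sum fun n _ => ?_)
    rw [Complex.norm_exp, ← Complex.ofReal_natCast, Complex.re_ofReal_mul, re_circleExponent]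
  set B := ∑ n ∈ range (L + 1), Real.exp (n * (1 / P ^ 2)) with hB
  have hB0 : 0 ≤ B := (norm_nonneg _).trans (hKb 0)
  have hs : ∀ α, Summable fun b => c b * Complex.exp (-circleExponent P α * Q b) := fun α =>
    Summable.of_norm (hc.congr fun b => (norm_mul_exp_neg_mul_circleExponent P α _ _).symm)
  have key := intervalIntegral.hasSum_integral_of_dominated_convergence (μ := volume)
    (a := -(1 / 2)) (b := 1 / 2)
    (F := fun b α => c b * Complex.exp (-circleExponent P α * Q b) *
      dualKernel L (circleExponent P α))
    (f := fun α => (∑' b, c b * Complex.exp (-circleExponent P α * Q b)) *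
      dualKernel L (circleExponent P α))
    (fun b _ => ‖c b‖ * Real.exp (-(1 / P ^ 2) * Q b) * B)
    (fun b => by
      apply Continuous.aestronglyMeasurable
      fun_prop)
    (fun b => Eventually.of_forall fun α _ => by
      rw [norm_mul, norm_mul_exp_neg_mul_circleExponent]
      gcongr
      exact hKb α)
    (Eventually.of_forall fun α _ => hc.mul_right B)
    intervalIntegrable_const
    (Eventually.of_forall fun α _ => (hs α).hasSum.mul_right _)
  rw [← key.tsum_eq]
  refine tsum_congr fun b => ?_
  have e : ∀ α, c b * Complex.exp (-circleExponent P α * Q b) *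
      dualKernel L (circleExponent P α) =
      ∑ n ∈ range (L + 1), c b * Complex.exp (((n - Q b : ℤ) : ℂ) * circleExponent P α) := by
    intro α
    rw [dualKernel, mul_sum]
    refine sum_congr rfl fun n _ => ?_
    rw [mul_assoc, ← Complex.exp_add]
    congr 2
    push_cast; ring
  simp_rw [e]
  rw [intervalIntegral.integral_finsetSum fun n _ => by
    apply Continuous.intervalIntegrable
    fun_prop]
  simp_rw [intervalIntegral.integral_const_mul, integral_exp_int_mul_circleExponent]
  have e2 : ∀ n : ℕ, ((n - Q b : ℤ) = 0) ↔ n = Q b := fun n => by omega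
  simp_rw [e2, mul_ite, mul_one, mul_zero]
  rw [sum_ite_eq']
  simp

end

lemma hasDerivAt_iterate_fwdDiff {f f' : ℝ → ℝ} (h : ∀ x, HasDerivAt f (f' x) x) (j : ℕ) (x : ℝ) :
    HasDerivAt ((fwdDiff (1 : ℝ))^[j] f) ((fwdDiff (1 : ℝ))^[j] f' x) x := by
  induction j generalizing f f' with
  | zero => exact h x
  | succ j ih =>
    refine ih (f := fwdDiff (1 : ℝ) f) (f' := fwdDiff (1 : ℝ) f') fun y => ?_
    exact ((h (y + 1)).comp_add_const y 1).sub (h y)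

lemma hasDerivAt_sqrt_pow (n : ℕ) (x : ℝ) :
    HasDerivAt (fun x => √x ^ (n + 3)) ((n + 3) / 2 * √x ^ (n + 1)) x := by
  have hne : ∀ y : ℝ, y ≠ 0 →
      HasDerivAt (fun x => √x ^ (n + 3)) ((n + 3) / 2 * √y ^ (n + 1)) y := by
    intro y hy
    have h := (Real.hasDerivAt_sqrt hy).pow (n + 3)
    refine h.congr_deriv ?_
    rcases lt_or_gt_of_ne hy with h0 | h0
    · simp [Real.sqrt_eq_zero_of_nonpos h0.le]
    · have := Real.sqrt_pos.2 h0
      rw [show n + 3 - 1 = n + 1 + 1 from rfl, pow_succ]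
      push_cast
      field_simp
  rcases eq_or_ne x 0 with rfl | hx
  · exact hasDerivAt_of_hasDerivAt_of_ne hne (by fun_prop) (by fun_prop)
  · exact hne x hx

/-- The iterated differences of `x ↦ max x 0 ^ (n / 2)` of order less than `n / 2` are
nonnegative. -/
lemma iterate_fwdDiff_sqrt_pow_nonneg (j n : ℕ) (hn : 2 * j + 1 ≤ n) (x : ℝ) :
    0 ≤ (fwdDiff (1 : ℝ))^[j] (fun x => √x ^ n) x := by
  induction j generalizing n x with
  | zero => simp only [Function.iterate_zero, id]; positivity
  | succ j ih =>
    obtain ⟨n, rfl⟩ : ∃ k, n = k + 3 := ⟨n - 3, by omega⟩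
    have hd := hasDerivAt_iterate_fwdDiff (hasDerivAt_sqrt_pow n) j
    have hmono : Monotone ((fwdDiff (1 : ℝ))^[j] fun x => √x ^ (n + 3)) := by
      refine monotone_of_deriv_nonneg (fun y => (hd y).differentiableAt) fun y => ?_
      rw [(hd y).deriv]
      have e : (fun x : ℝ => (n + 3 : ℝ) / 2 * √x ^ (n + 1)) =
          ((n + 3 : ℝ) / 2) • fun x => √x ^ (n + 1) := rfl
      rw [e, fwdDiff_iter_const_smul, Pi.smul_apply, smul_eq_mul]
      exact mul_nonneg (by positivity) (ih (n + 1) (by omega) y)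
    rw [Function.iterate_succ_apply']
    exact sub_nonneg.2 (hmono (by linarith))

lemma fourth_difference_sqrt_pow_nonneg (n : ℕ) (hn : 9 ≤ n) (x : ℝ) :
    0 ≤ √(x + 4) ^ n - 4 * √(x + 3) ^ n + 6 * √(x + 2) ^ n - 4 * √(x + 1) ^ n + √x ^ n := by
  have h := iterate_fwdDiff_sqrt_pow_nonneg 4 n hn x
  simp only [Function.iterate_succ_apply', Function.iterate_zero, id, fwdDiff] at h
  ring_nf at h ⊢
  exact h

/-- Summation by parts for power series. -/
lemma hasSum_sub_shift_mul_pow {a : ℤ → ℝ} (ha : a (-1) = 0) {z S : ℂ}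
    (h : HasSum (fun n : ℕ => (a n : ℂ) * z ^ n) S) :
    HasSum (fun n : ℕ => ((a n - a (n - 1) : ℝ) : ℂ) * z ^ n) ((1 - z) * S) := by
  have h1 : HasSum (fun n : ℕ => (a ((n : ℤ) - 1) : ℂ) * z ^ n) (z * S) := by
    rw [← hasSum_nat_add_iff' 1]
    simp only [range_one, sum_singleton, Nat.cast_zero, zero_sub, ha, Complex.ofReal_zero,
      zero_mul, sub_zero]
    refine (h.mul_left z).congr_fun ?_
    intro n
    push_cast
    rw [add_sub_cancel_right, pow_succ]
    ring
  rw [sub_mul, one_mul]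
  refine (h.sub h1).congr_fun fun n => ?_
  push_cast; ring

/-- The tent function. -/
noncomputable def tent (x : ℝ) : ℝ := max 0 (1 - |x|)

lemma tent_nonneg (x : ℝ) : 0 ≤ tent x := le_max_left _ _

lemma tent_sub_eq (n t : ℝ) :
    tent (t - n) = max (n + 1 - t) 0 - 2 * max (n - t) 0 + max (n - 1 - t) 0 := by
  unfold tent
  rcases abs_cases (t - n) with ⟨h, h'⟩ | ⟨h, h'⟩ <;> rw [h] <;>
  rcases max_cases 0 (1 - |t - n|) with ⟨h1, h1'⟩ | ⟨h1, h1'⟩ <;> rw [h] at h1 h1' <;> rw [h1] <;>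
  rcases max_cases (n + 1 - t) 0 with ⟨h2, h2'⟩ | ⟨h2, h2'⟩ <;>
  rcases max_cases (n - t) 0 with ⟨h3, h3'⟩ | ⟨h3, h3'⟩ <;>
  rcases max_cases (n - 1 - t) 0 with ⟨h4, h4'⟩ | ⟨h4, h4'⟩ <;> linarith

lemma sum_tent_sub (L : ℕ) {t : ℝ} (ht : 0 ≤ t) :
    ∑ n ∈ range (L + 1), tent (t - n) = max (L + 1 - t) 0 - max (L - t) 0 := by
  induction L with
  | zero =>
    rw [zero_add, sum_range_one, tent_sub_eq, max_eq_right (a := ((0 : ℕ) : ℝ) - t) (by simpa),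
      max_eq_right (a := ((0 : ℕ) : ℝ) - 1 - t) (by push_cast; linarith)]
    ring
  | succ L ih =>
    rw [sum_range_succ, ih, tent_sub_eq]
    push_cast
    rw [add_sub_cancel_right (L : ℝ) 1]
    ring

/-- The piecewise linear interpolation of `t ↦ exp (-w t)` at the natural numbers. -/
noncomputable def expInterp (w : ℂ) (t : ℝ) : ℂ :=
  (1 - Int.fract t : ℝ) * Complex.exp (-w) ^ ⌊t⌋₊ +
    (Int.fract t : ℝ) * Complex.exp (-w) ^ (⌊t⌋₊ + 1)

lemma hasSum_tent_mul_pow (w : ℂ) {t : ℝ} (ht : 0 ≤ t) :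
    HasSum (fun n : ℕ => (tent (t - n) : ℂ) * Complex.exp (-w) ^ n) (expInterp w t) := by
  set k := ⌊t⌋₊ with hk
  have hfr : t = k + Int.fract t := by
    rw [hk, natCast_floor_eq_intCast_floor ht]
    exact (Int.floor_add_fract t).symm
  have h0 := Int.fract_nonneg t
  have h1 := Int.fract_lt_one t
  set θ := Int.fract t
  have hsum := hasSum_sum_of_ne_finset_zero (s := {k, k + 1})
    (L := SummationFilter.unconditional ℕ)
    (f := fun n : ℕ => (tent (t - n) : ℂ) * Complex.exp (-w) ^ n) fun n hn => by
      have hn' : n ≠ k ∧ n ≠ k + 1 := by simpa using hn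
      have : tent (t - n) = 0 := by
        refine max_eq_left ?_
        rcases lt_or_gt_of_ne hn'.1 with h | h
        · have : (n : ℝ) + 1 ≤ k := by exact_mod_cast h
          rw [abs_of_nonneg (by linarith)]; linarith
        · have : (k : ℝ) + 2 ≤ n := by exact_mod_cast (by omega : k + 2 ≤ n)
          rw [abs_of_nonpos (by linarith)]; linarith
      rw [this]; simp
  convert hsum using 1
  rw [sum_pair (by omega), expInterp]
  have e1 : tent (t - k) = 1 - θ := by
    rw [tent, hfr, add_sub_cancel_left, abs_of_nonneg h0, max_eq_right (by linarith)]
  have e2 : tent (t - (k + 1 : ℕ)) = θ := by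
    rw [tent, abs_of_nonpos (by push_cast; linarith), max_eq_right (by push_cast; linarith)]
    push_cast; linarith
  rw [e1, e2]

lemma norm_exp_sub_expInterp_le {w : ℂ} (h0 : 0 ≤ w.re) (h1 : w.re ≤ 1) {t : ℝ} (ht : 0 ≤ t) :
    ‖Complex.exp (-w * t) - expInterp w t‖ ≤ 5 * ‖w‖ ^ 2 * Real.exp (-w.re * t) := by
  set k := ⌊t⌋₊ with hk
  have hfr : t = k + Int.fract t := by
    rw [hk, natCast_floor_eq_intCast_floor ht]
    exact (Int.floor_add_fract t).symm
  have hθ0 := Int.fract_nonneg t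
  have hθ1 := Int.fract_lt_one t
  rw [expInterp, ← hk]
  set θ := Int.fract t
  have e : Complex.exp (-w * t) - ((1 - θ : ℝ) * Complex.exp (-w) ^ k +
      (θ : ℝ) * Complex.exp (-w) ^ (k + 1)) = Complex.exp (-w * t) *
      (1 - ((1 - θ : ℝ) * Complex.exp (w * θ) + (θ : ℝ) * Complex.exp (-(w * (1 - θ : ℝ))))) := by
    rw [mul_sub, mul_add, mul_one, ← Complex.exp_nat_mul, ← Complex.exp_nat_mul,
      mul_left_comm, ← Complex.exp_add, mul_left_comm, ← Complex.exp_add, hfr]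
    congr 3
    · congr 1; push_cast; ring
    · congr 1; push_cast; ring
  rw [e, norm_mul, Complex.norm_exp, Complex.re_mul_ofReal, Complex.neg_re, mul_comm]
  refine mul_le_mul_of_nonneg_right ?_ (Real.exp_pos _).le
  rcases le_or_gt ‖w‖ 1 with hw | hw
  · have e2 : (1 - ((1 - θ : ℝ) * Complex.exp (w * θ) +
        (θ : ℝ) * Complex.exp (-(w * (1 - θ : ℝ)))) : ℂ) =
        -((1 - θ : ℝ) * (Complex.exp (w * θ) - 1 - w * θ) +
        (θ : ℝ) * (Complex.exp (-(w * (1 - θ : ℝ))) - 1 - -(w * (1 - θ : ℝ)))) := by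
      push_cast; ring
    have hb1 : ‖w * θ‖ ≤ ‖w‖ := by
      rw [norm_mul, Complex.norm_real, Real.norm_of_nonneg hθ0]
      nlinarith [norm_nonneg w]
    have hb2 : ‖-(w * (1 - θ : ℝ))‖ ≤ ‖w‖ := by
      rw [norm_neg, norm_mul, Complex.norm_real, Real.norm_of_nonneg (by linarith)]
      nlinarith [norm_nonneg w]
    have hc1 := (Complex.norm_exp_sub_one_sub_id_le (hb1.trans hw)).trans
      (pow_le_pow_left₀ (norm_nonneg _) hb1 2)
    have hc2 := (Complex.norm_exp_sub_one_sub_id_le (hb2.trans hw)).trans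
      (pow_le_pow_left₀ (norm_nonneg _) hb2 2)
    rw [e2, norm_neg]
    refine (norm_add_le _ _).trans ?_
    rw [norm_mul, norm_mul, Complex.norm_real, Complex.norm_real,
      Real.norm_of_nonneg hθ0, Real.norm_of_nonneg (by linarith : (0 : ℝ) ≤ 1 - θ)]
    nlinarith [sq_nonneg ‖w‖]
  · have hb1 : ‖Complex.exp (w * θ)‖ ≤ 3 := by
      rw [Complex.norm_exp, Complex.re_mul_ofReal]
      have h : Real.exp (w.re * θ) ≤ Real.exp 1 := Real.exp_le_exp.2 (by nlinarith)
      linarith [Real.exp_one_lt_d9]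
    have hb2 : ‖Complex.exp (-(w * (1 - θ : ℝ)))‖ ≤ 3 := by
      rw [Complex.norm_exp, Complex.neg_re, Complex.re_mul_ofReal]
      have h : Real.exp (-(w.re * (1 - θ))) ≤ 1 := Real.exp_le_one_iff.2 (by nlinarith)
      linarith
    refine (norm_sub_le _ _).trans ?_
    have := norm_add_le ((1 - θ : ℝ) * Complex.exp (w * θ))
      ((θ : ℝ) * Complex.exp (-(w * (1 - θ : ℝ))))
    rw [norm_mul, norm_mul, Complex.norm_real, Complex.norm_real,
      Real.norm_of_nonneg hθ0, Real.norm_of_nonneg (by linarith : (0 : ℝ) ≤ 1 - θ)] at this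
    rw [norm_one]
    nlinarith [norm_nonneg (Complex.exp (w * θ))]

section

variable {ν : Measure ℝ}

/-- The mass that `ν` assigns to the tent centred at `n`. -/
noncomputable def tentCoeff (ν : Measure ℝ) (n : ℕ) : ℝ := ∫ t, tent (t - n) ∂ν

lemma tentCoeff_nonneg (n : ℕ) : 0 ≤ tentCoeff ν n := integral_nonneg fun _ => tent_nonneg _

lemma continuous_tent : Continuous tent := by unfold tent; fun_prop

lemma tent_sub_le_exp {u : ℝ} (hu : 0 ≤ u) (n t : ℝ) :
    tent (t - n) ≤ tent (t - n) * (Real.exp (u * (n + 1)) * Real.exp (-u * t)) := by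
  rcases (tent_nonneg (t - n)).eq_or_lt with h | h
  · rw [← h, zero_mul]
  · have h1 : t - n ≤ 1 := by
      unfold tent at h
      have := (lt_max_iff.1 h).resolve_left (lt_irrefl _)
      linarith [le_abs_self (t - n)]
    refine le_mul_of_one_le_right h.le ?_
    rw [← Real.exp_add]
    exact Real.one_le_exp (by nlinarith)

lemma tent_le_one (x : ℝ) : tent x ≤ 1 := max_le zero_le_one (by linarith [abs_nonneg x])

lemma integrable_tent_sub (hexp : Integrable (fun t => Real.exp (-1 * t)) ν) (n : ℝ) :
    Integrable (fun t => tent (t - n)) ν := by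
  refine (hexp.const_mul (Real.exp (1 * (n + 1)))).mono'
    (continuous_tent.comp (continuous_sub_right n)).aestronglyMeasurable
    (Eventually.of_forall fun t => ?_)
  rw [Real.norm_of_nonneg (tent_nonneg _)]
  refine (tent_sub_le_exp zero_le_one n t).trans ?_
  exact mul_le_of_le_one_left (by positivity) (tent_le_one _)

lemma sum_tent_sub_le_one (m : ℕ) {t : ℝ} (ht : 0 ≤ t) : ∑ n ∈ range m, tent (t - n) ≤ 1 := by
  refine (sum_le_sum_of_subset_of_nonneg (range_subset_range.2 m.le_succ)
    fun _ _ _ => tent_nonneg _).trans ?_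
  rw [sum_tent_sub m ht]
  rcases max_cases ((m : ℝ) + 1 - t) 0 with ⟨h, h'⟩ | ⟨h, h'⟩ <;>
  rcases max_cases ((m : ℝ) - t) 0 with ⟨h1, h1'⟩ | ⟨h1, h1'⟩ <;> linarith

lemma sum_tentCoeff_mul_pow_le (h0 : ∀ᵐ t ∂ν, 0 ≤ t)
    (hexp : ∀ ε : ℝ, 0 < ε → Integrable (fun t => Real.exp (-ε * t)) ν) {u : ℝ} (hu : 0 < u)
    (hu1 : u ≤ 1) (m : ℕ) :
    ∑ n ∈ range m, tentCoeff ν n * Real.exp (-u) ^ n ≤ 3 * ∫ t, Real.exp (-u * t) ∂ν := by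
  simp_rw [tentCoeff, ← integral_mul_const]
  rw [← integral_finsetSum (range m)
      fun (n : ℕ) _ => (integrable_tent_sub (hexp 1 one_pos) (n : ℝ)).mul_const _,
    ← integral_const_mul]
  refine integral_mono_ae
    (integrable_finsetSum _ fun n _ => (integrable_tent_sub (hexp 1 one_pos) n).mul_const _)
    ((hexp u hu).const_mul 3) ?_
  filter_upwards [h0] with t ht
  have h1 : ∀ n : ℕ, tent (t - n) * Real.exp (-u) ^ n ≤
      tent (t - n) * (3 * Real.exp (-u * t)) := by
    intro n
    refine (mul_le_mul_of_nonneg_right (tent_sub_le_exp hu.le n t) (by positivity)).trans ?_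
    rw [mul_assoc]
    refine mul_le_mul_of_nonneg_left ?_ (tent_nonneg _)
    rw [← Real.exp_nat_mul, mul_right_comm, ← Real.exp_add,
      show u * ((n : ℝ) + 1) + n * -u = u by ring]
    refine mul_le_mul_of_nonneg_right ?_ (Real.exp_pos _).le
    linarith [Real.exp_le_exp.2 hu1, Real.exp_one_lt_d9]
  calc _ ≤ ∑ n ∈ range m, tent (t - n) * (3 * Real.exp (-u * t)) := sum_le_sum fun n _ => h1 n
    _ ≤ 1 * (3 * Real.exp (-u * t)) := by
        rw [← sum_mul]
        exact mul_le_mul_of_nonneg_right (sum_tent_sub_le_one m ht) (by positivity)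
    _ = _ := one_mul _

lemma summable_tentCoeff_mul_pow (h0 : ∀ᵐ t ∂ν, 0 ≤ t)
    (hexp : ∀ ε : ℝ, 0 < ε → Integrable (fun t => Real.exp (-ε * t)) ν) {u : ℝ} (hu : 0 < u)
    (hu1 : u ≤ 1) : Summable fun n => tentCoeff ν n * Real.exp (-u) ^ n :=
  summable_of_sum_range_le (fun n => mul_nonneg (tentCoeff_nonneg n) (by positivity))
    fun m => sum_tentCoeff_mul_pow_le h0 hexp hu hu1 m

lemma norm_exp_neg_pow (w : ℂ) (n : ℕ) : ‖Complex.exp (-w) ^ n‖ = Real.exp (-w.re) ^ n := by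
  rw [norm_pow, Complex.norm_exp, Complex.neg_re]

lemma hasSum_tentCoeff (h0 : ∀ᵐ t ∂ν, 0 ≤ t)
    (hexp : ∀ ε : ℝ, 0 < ε → Integrable (fun t => Real.exp (-ε * t)) ν) {w : ℂ} (hw : 0 < w.re)
    (hw1 : w.re ≤ 1) :
    HasSum (fun n : ℕ => (tentCoeff ν n : ℂ) * Complex.exp (-w) ^ n)
      (∫ t, expInterp w t ∂ν) := by
  have key := hasSum_integral_of_summable_integral_norm (μ := ν)
    (F := fun (n : ℕ) t => (tent (t - n) : ℂ) * Complex.exp (-w) ^ n)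
    (fun n => (integrable_tent_sub (hexp 1 one_pos) n).ofReal.mul_const _) (by
      refine (summable_tentCoeff_mul_pow h0 hexp hw hw1).congr fun n => ?_
      rw [tentCoeff, ← integral_mul_const]
      refine integral_congr_ae (Eventually.of_forall fun t => ?_)
      simp only
      rw [norm_mul, norm_exp_neg_pow, Complex.norm_real, Real.norm_of_nonneg (tent_nonneg _)])
  have e : ∫ t, ∑' n : ℕ, (tent (t - n) : ℂ) * Complex.exp (-w) ^ n ∂ν =
      ∫ t, expInterp w t ∂ν := by
    refine integral_congr_ae ?_
    filter_upwards [h0] with t ht using (hasSum_tent_mul_pow w ht).tsum_eq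
  rw [e] at key
  refine key.congr_fun fun n => ?_
  rw [integral_mul_const, integral_complex_ofReal, tentCoeff]

lemma measurable_expInterp (w : ℂ) : Measurable (expInterp w) := by
  have h1 : Measurable fun t : ℝ => Complex.exp (-w) ^ ⌊t⌋₊ :=
    (measurable_from_nat (f := fun n => Complex.exp (-w) ^ n)).comp Nat.measurable_floor
  have h2 : Measurable fun t : ℝ => Complex.exp (-w) ^ (⌊t⌋₊ + 1) :=
    (measurable_from_nat (f := fun n => Complex.exp (-w) ^ (n + 1))).comp Nat.measurable_floor
  have h3 : Measurable fun t : ℝ => (Int.fract t : ℝ) := measurable_fract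
  unfold expInterp
  exact ((measurable_const.sub h3).complex_ofReal.mul h1).add (h3.complex_ofReal.mul h2)

lemma norm_integral_exp_sub_tsum_tentCoeff_le (h0 : ∀ᵐ t ∂ν, 0 ≤ t)
    (hexp : ∀ ε : ℝ, 0 < ε → Integrable (fun t => Real.exp (-ε * t)) ν) {w : ℂ} (hw : 0 < w.re)
    (hw1 : w.re ≤ 1) :
    ‖∫ t : ℝ, Complex.exp (-w * t) ∂ν - ∑' n : ℕ, (tentCoeff ν n : ℂ) * Complex.exp (-w) ^ n‖ ≤
      5 * ‖w‖ ^ 2 * ∫ t, Real.exp (-w.re * t) ∂ν := by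
  have hb : ∀ᵐ t : ℝ ∂ν, ‖Complex.exp (-w * t) - expInterp w t‖ ≤
      5 * ‖w‖ ^ 2 * Real.exp (-w.re * t) := by
    filter_upwards [h0] with t ht using norm_exp_sub_expInterp_le hw.le hw1 ht
  have hi1 : Integrable (fun t : ℝ => Complex.exp (-w * t)) ν := by
    refine (hexp _ hw).mono' (by fun_prop) (Eventually.of_forall fun t => le_of_eq ?_)
    rw [Complex.norm_exp, Complex.re_mul_ofReal, Complex.neg_re]
  have hm := (hexp _ hw).const_mul (5 * ‖w‖ ^ 2)
  have hi2 : Integrable (fun t : ℝ => Complex.exp (-w * t) - expInterp w t) ν :=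
    hm.mono' (hi1.aestronglyMeasurable.sub (measurable_expInterp w).aestronglyMeasurable) hb
  have hi3 : Integrable (expInterp w) ν := by
    refine (hi1.sub hi2).congr (Eventually.of_forall fun t => ?_)
    simp
  rw [(hasSum_tentCoeff h0 hexp hw hw1).tsum_eq, ← integral_sub hi1 hi3, ← integral_const_mul]
  exact norm_integral_le_of_norm_le hm hb

/-- Power series with coefficients `tentCoeff ν` decay quadratically off the positive axis. -/
lemma norm_tsum_tentCoeff_mul_le (h0 : ∀ᵐ t ∂ν, 0 ≤ t)
    (hexp : ∀ ε : ℝ, 0 < ε → Integrable (fun t => Real.exp (-ε * t)) ν) {D : ℕ} (hD : 9 ≤ D)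
    {W : ℝ} (hW0 : 0 ≤ W) (hW : ∀ T : ℝ, 0 ≤ T → ∫ t, max (T - t) 0 ∂ν = W * √T ^ D) {w : ℂ}
    (hw : 0 < w.re) (hw1 : w.re ≤ 1) :
    ‖1 - Complex.exp (-w)‖ ^ 2 * ‖∑' n : ℕ, (tentCoeff ν n : ℂ) * Complex.exp (-w) ^ n‖ ≤
      w.re ^ 2 * (3 * ∫ t, Real.exp (-w.re * t) ∂ν) := by
  have hW' : ∀ T : ℝ, ∫ t, max (T - t) 0 ∂ν = W * √T ^ D := by
    intro T
    rcases le_or_gt 0 T with hT | hT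
    · exact hW T hT
    · rw [Real.sqrt_eq_zero_of_nonpos hT.le, zero_pow (by omega), mul_zero]
      refine integral_eq_zero_of_ae ?_
      filter_upwards [h0] with t ht
      exact max_eq_right (by linarith)
  have hmaxi : ∀ T : ℝ, Integrable (fun t => max (T - t) 0) ν := by
    intro T
    refine ((hexp 1 one_pos).const_mul (Real.exp T)).mono' (by fun_prop)
      (Eventually.of_forall fun t => ?_)
    rw [Real.norm_of_nonneg (le_max_right _ _), ← Real.exp_add]
    refine max_le ?_ (Real.exp_pos _).le
    have := Real.add_one_le_exp (T + -1 * t)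
    linarith
  set a : ℤ → ℝ := fun n => W * (√((n : ℝ) + 1) ^ D - 2 * √(n : ℝ) ^ D + √((n : ℝ) - 1) ^ D)
    with ha
  have hD0 : D ≠ 0 := by omega
  have hneg : ∀ x : ℝ, x ≤ 0 → √x ^ D = 0 := fun x hx => by
    rw [Real.sqrt_eq_zero_of_nonpos hx, zero_pow hD0]
  have hac : ∀ n : ℕ, a n = tentCoeff ν n := by
    intro n
    rw [tentCoeff]
    simp_rw [tent_sub_eq]
    have hi := (hmaxi ((n : ℝ) + 1)).sub ((hmaxi n).const_mul 2)
    simp only [Pi.sub_def] at hi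
    rw [integral_add hi (hmaxi _), integral_sub (hmaxi _) ((hmaxi _).const_mul 2),
      integral_const_mul, hW',
      hW', hW', ha]
    push_cast; ring
  have ha1 : a (-1) = 0 := by
    simp only [ha]
    rw [hneg _ (by norm_num), hneg _ (by norm_num), hneg _ (by norm_num)]
    ring
  have ha2 : a (-2) = 0 := by
    simp only [ha]
    rw [hneg _ (by norm_num), hneg _ (by norm_num), hneg _ (by norm_num)]
    ring
  have hb : ∀ n : ℤ, 0 ≤ a n - a (n - 1) - (a (n - 1) - a (n - 1 - 1)) := by
    intro n
    have h := mul_nonneg hW0 (fourth_difference_sqrt_pow_nonneg D hD ((n : ℝ) - 3))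
    simp only [ha]
    push_cast
    have e1 : (n : ℝ) - 3 + 4 = n + 1 := by ring
    have e2 : (n : ℝ) - 3 + 3 = n := by ring
    have e3 : (n : ℝ) - 3 + 2 = n - 1 := by ring
    have e4 : (n : ℝ) - 3 + 1 = n - 1 - 1 := by ring
    have e5 : (n : ℝ) - 3 = n - 1 - 1 - 1 := by ring
    have e6 : (n : ℝ) - 1 + 1 = n := by ring
    have e7 : (n : ℝ) - 1 - 1 + 1 = n - 1 := by ring
    rw [e1, e2, e3, e4, e5] at h
    rw [e6, e7]
    linarith
  have hdiff : ∀ v : ℂ, 0 < v.re → v.re ≤ 1 →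
      HasSum (fun n : ℕ => ((a n - a (n - 1) - (a (n - 1) - a (n - 1 - 1)) : ℝ) : ℂ) *
        Complex.exp (-v) ^ n) ((1 - Complex.exp (-v)) * ((1 - Complex.exp (-v)) *
          ∑' n : ℕ, (tentCoeff ν n : ℂ) * Complex.exp (-v) ^ n)) := by
    intro v hv hv1
    have h := (hasSum_tentCoeff h0 hexp hv hv1).summable.hasSum
    simp_rw [← hac] at h ⊢
    have h2 := hasSum_sub_shift_mul_pow ha1 h
    refine hasSum_sub_shift_mul_pow (a := fun n : ℤ => a n - a (n - 1)) ?_ h2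
    norm_num [ha1, ha2]
  have hR := hdiff (w.re : ℂ) (by simpa) (by simpa)
  have hw' := hdiff w hw hw1
  have hsum := summable_tentCoeff_mul_pow h0 hexp hw hw1
  have e1 : (1 - Complex.exp (-(w.re : ℂ))) * ((1 - Complex.exp (-(w.re : ℂ))) *
      ∑' n : ℕ, (tentCoeff ν n : ℂ) * Complex.exp (-(w.re : ℂ)) ^ n) =
      (((1 - Real.exp (-w.re)) ^ 2 * ∑' n : ℕ, tentCoeff ν n * Real.exp (-w.re) ^ n : ℝ) : ℂ) := by
    push_cast; ring
  have e2 : ∀ n : ℕ, ((a n - a (n - 1) - (a (n - 1) - a (n - 1 - 1)) : ℝ) : ℂ) *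
      Complex.exp (-(w.re : ℂ)) ^ n = (((a n - a (n - 1) - (a (n - 1) - a (n - 1 - 1))) *
        Real.exp (-w.re) ^ n : ℝ) : ℂ) := by
    intro n; push_cast; ring
  rw [e1] at hR
  simp_rw [e2] at hR
  have hR' := Complex.hasSum_ofReal.1 hR
  have h1 : ‖(1 - Complex.exp (-w)) * ((1 - Complex.exp (-w)) *
      ∑' n : ℕ, (tentCoeff ν n : ℂ) * Complex.exp (-w) ^ n)‖ ≤
      (1 - Real.exp (-w.re)) ^ 2 * ∑' n : ℕ, tentCoeff ν n * Real.exp (-w.re) ^ n := by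
    rw [← hw'.tsum_eq]
    refine tsum_of_norm_bounded hR' fun n => le_of_eq ?_
    rw [norm_mul, norm_exp_neg_pow, Complex.norm_real, Real.norm_of_nonneg (hb n)]
  rw [norm_mul, norm_mul, ← mul_assoc, ← pow_two] at h1
  refine h1.trans ?_
  have h2 : ∑' n : ℕ, tentCoeff ν n * Real.exp (-w.re) ^ n ≤ 3 * ∫ t, Real.exp (-w.re * t) ∂ν :=
    hsum.tsum_le_of_sum_range_le fun m => sum_tentCoeff_mul_pow_le h0 hexp hw hw1 m
  have h3 : 1 - Real.exp (-w.re) ≤ w.re := by linarith [Real.add_one_le_exp (-w.re)]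
  have h4 : 0 ≤ 1 - Real.exp (-w.re) := by
    have : Real.exp (-w.re) ≤ 1 := Real.exp_le_one_iff.2 (by linarith)
    linarith
  have h5 : 0 ≤ ∑' n : ℕ, tentCoeff ν n * Real.exp (-w.re) ^ n :=
    tsum_nonneg fun n => mul_nonneg (tentCoeff_nonneg n) (by positivity)
  gcongr

lemma measureReal_Iic_le_sum_tentCoeff (h0 : ∀ᵐ t ∂ν, 0 ≤ t)
    (hexp : Integrable (fun t => Real.exp (-1 * t)) ν) (L : ℕ) :
    ν.real (Set.Iic (L : ℝ)) ≤ ∑ n ∈ range (L + 1), tentCoeff ν n ∧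
      ∑ n ∈ range (L + 1), tentCoeff ν n ≤ ν.real (Set.Iic ((L : ℝ) + 1)) := by
  have hi : ∀ T : ℝ, Integrable ((Set.Iic T).indicator fun _ => (1 : ℝ)) ν := by
    intro T
    refine (hexp.const_mul (Real.exp T)).mono'
      ((measurable_const.indicator measurableSet_Iic).aestronglyMeasurable)
      (Eventually.of_forall fun t => ?_)
    by_cases ht : t ∈ Set.Iic T
    · rw [Set.indicator_of_mem ht, norm_one, ← Real.exp_add]
      exact Real.one_le_exp (by linarith [Set.mem_Iic.1 ht])
    · rw [Set.indicator_of_notMem ht, norm_zero]; positivity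
  have e : ∀ T : ℝ, ν.real (Set.Iic T) = ∫ t, (Set.Iic T).indicator (fun _ => (1 : ℝ)) t ∂ν := by
    intro T
    rw [integral_indicator_const _ measurableSet_Iic, smul_eq_mul, mul_one]
  simp_rw [tentCoeff]
  have hs := integrable_finsetSum (range (L + 1))
    fun (n : ℕ) _ => integrable_tent_sub (ν := ν) hexp (n : ℝ)
  rw [← integral_finsetSum (range (L + 1)) fun (n : ℕ) _ => integrable_tent_sub hexp (n : ℝ), e, e]
  constructor
  · refine integral_mono_ae (hi _) hs ?_
    filter_upwards [h0] with t ht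
    rw [sum_tent_sub L ht]
    refine Set.indicator_apply_le' (fun h => ?_) fun h => ?_
    · have := Set.mem_Iic.1 h
      rw [max_eq_left (by linarith), max_eq_left (by linarith)]; linarith
    · rw [← sum_tent_sub L ht]; exact sum_nonneg fun _ _ => tent_nonneg _
  · refine integral_mono_ae hs (hi _) ?_
    filter_upwards [h0] with t ht
    refine Set.le_indicator_apply (fun h => sum_tent_sub_le_one _ ht) fun h => ?_
    rw [sum_tent_sub L ht]
    have : (L : ℝ) + 1 < t := not_le.1 h
    rw [max_eq_right (by linarith), max_eq_right (by linarith), sub_zero]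

end

section

variable {N : ℕ} {M : MvPolynomial (Fin N) ℝ} {κ : ℕ}

lemma eval_smul_of_isHomogeneous (hM : M.IsHomogeneous κ) (R : ℝ) (x : Fin N → ℝ) :
    MvPolynomial.eval (R • x) M = R ^ κ * MvPolynomial.eval x M := by
  rw [MvPolynomial.eval_eq', MvPolynomial.eval_eq', mul_sum]
  refine sum_congr rfl fun μ hμ => ?_
  have hdeg : ∑ i, μ i = κ := hM.sum_eq_of_mem_support hμ
  simp only [Pi.smul_apply, smul_eq_mul, mul_pow]
  rw [prod_mul_distrib, prod_pow_eq_pow_sum, hdeg]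
  ring

/-- The image under `x ↦ |x| ^ 2` of the measure with density `M`. -/
noncomputable def radialMeasure (M : MvPolynomial (Fin N) ℝ) : Measure ℝ :=
  (volume.withDensity fun x : Fin N → ℝ => ENNReal.ofReal (MvPolynomial.eval x M)).map
    fun x => ∑ i, x i ^ 2

lemma measurable_sum_sq : Measurable fun x : Fin N → ℝ => ∑ i, x i ^ 2 := by fun_prop

lemma measurable_ofReal_eval (M : MvPolynomial (Fin N) ℝ) :
    Measurable fun x : Fin N → ℝ => ENNReal.ofReal (MvPolynomial.eval x M) :=
  (MvPolynomial.continuous_eval M).measurable.ennreal_ofReal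

lemma radialMeasure_ae_nonneg (M : MvPolynomial (Fin N) ℝ) : ∀ᵐ t ∂radialMeasure M, 0 ≤ t := by
  rw [radialMeasure, ae_map_iff measurable_sum_sq.aemeasurable measurableSet_Ici]
  exact Eventually.of_forall fun x => sum_nonneg fun i _ => sq_nonneg _

variable {E : Type*} [NormedAddCommGroup E] [NormedSpace ℝ E]

lemma integral_radialMeasure (hM0 : ∀ x, 0 ≤ MvPolynomial.eval x M) {φ : ℝ → E}
    (hφ : StronglyMeasurable φ) :
    ∫ t, φ t ∂radialMeasure M = ∫ x, MvPolynomial.eval x M • φ (∑ i, x i ^ 2) := by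
  rw [radialMeasure, integral_map measurable_sum_sq.aemeasurable hφ.aestronglyMeasurable,
    integral_withDensity_eq_integral_toReal_smul (measurable_ofReal_eval M)
      (Eventually.of_forall fun x => ENNReal.ofReal_lt_top)]
  simp_rw [ENNReal.toReal_ofReal (hM0 _)]

lemma integral_radialMeasure_scale (hM : M.IsHomogeneous κ) (hM0 : ∀ x, 0 ≤ MvPolynomial.eval x M)
    {φ : ℝ → E} (hφ : StronglyMeasurable φ) {R : ℝ} (hR : 0 < R) :
    ∫ t, φ t ∂radialMeasure M = R ^ (N + κ) • ∫ t, φ (R ^ 2 * t) ∂radialMeasure M := by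
  rw [integral_radialMeasure hM0 hφ, integral_radialMeasure hM0
    (φ := fun t => φ (R ^ 2 * t)) (hφ.comp_measurable (measurable_const_mul (R ^ 2)))]
  have h := Measure.integral_comp_smul_of_nonneg (volume : Measure (Fin N → ℝ))
    (fun x => MvPolynomial.eval x M • φ (∑ i, x i ^ 2)) R (hR := hR.le)
  have e : ∀ x : Fin N → ℝ, MvPolynomial.eval (R • x) M • φ (∑ i, (R • x) i ^ 2) =
      R ^ κ • MvPolynomial.eval x M • φ (R ^ 2 * ∑ i, x i ^ 2) := by
    intro x
    rw [eval_smul_of_isHomogeneous hM, mul_smul, mul_sum]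
    simp only [Pi.smul_apply, smul_eq_mul, mul_pow]
  simp_rw [e] at h
  rw [integral_smul, Module.finrank_fin_fun] at h
  rw [pow_add, mul_smul, h, smul_inv_smul₀ (by positivity)]

lemma integrable_exp_radialMeasure (hM0 : ∀ x, 0 ≤ MvPolynomial.eval x M) {ε : ℝ} (hε : 0 < ε) :
    Integrable (fun t => Real.exp (-ε * t)) (radialMeasure M) := by
  rw [radialMeasure, integrable_map_measure (by fun_prop) measurable_sum_sq.aemeasurable,
    integrable_withDensity_iff_integrable_smul' (measurable_ofReal_eval M)
      (Eventually.of_forall fun x => ENNReal.ofReal_lt_top)]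
  refine (integrable_gaussPoly M (w := ε) (by simpa)).norm.congr (Eventually.of_forall fun x => ?_)
  simp only [norm_gaussPoly, Complex.ofReal_re, ENNReal.toReal_ofReal (hM0 x), smul_eq_mul,
    Function.comp, abs_of_nonneg (hM0 x)]

lemma integral_exp_neg_mul_radialMeasure (hM0 : ∀ x, 0 ≤ MvPolynomial.eval x M) (w : ℂ) :
    ∫ t : ℝ, Complex.exp (-w * t) ∂radialMeasure M = ∫ x, gaussPoly M w x := by
  rw [integral_radialMeasure hM0 (Continuous.stronglyMeasurable (by fun_prop))]
  simp_rw [Complex.real_smul]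
  rfl

lemma integral_max_radialMeasure (hM : M.IsHomogeneous κ)
    (hM0 : ∀ x, 0 ≤ MvPolynomial.eval x M) {T : ℝ} (hT : 0 ≤ T) :
    ∫ t, max (T - t) 0 ∂radialMeasure M =
      (∫ t, max (1 - t) 0 ∂radialMeasure M) * √T ^ (N + κ + 2) := by
  rcases hT.eq_or_lt with rfl | hT
  · rw [Real.sqrt_zero, zero_pow (by omega), mul_zero]
    refine integral_eq_zero_of_ae ?_
    filter_upwards [radialMeasure_ae_nonneg M] with t ht
    exact max_eq_right (by linarith)
  · rw [integral_radialMeasure_scale hM hM0 (Continuous.stronglyMeasurable (by fun_prop))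
      (Real.sqrt_pos.2 hT), pow_add _ (N + κ) 2, Real.sq_sqrt hT.le, smul_eq_mul]
    have : ∀ t : ℝ, max (T - T * t) 0 = T * max (1 - t) 0 := fun t => by
      rw [mul_max_of_nonneg _ _ hT.le]; ring_nf
    simp_rw [this]
    rw [integral_const_mul]; ring

lemma integral_exp_radialMeasure (hM : M.IsHomogeneous κ)
    (hM0 : ∀ x, 0 ≤ MvPolynomial.eval x M) {P : ℝ} (hP : 0 < P) :
    ∫ t, Real.exp (-(1 / P ^ 2) * t) ∂radialMeasure M =
      P ^ (N + κ) * ∫ t, Real.exp (-t) ∂radialMeasure M := by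
  rw [integral_radialMeasure_scale hM hM0 (Continuous.stronglyMeasurable (by fun_prop)) hP,
    smul_eq_mul]
  congr 2 with t
  field_simp

lemma measureReal_Iic_radialMeasure (hM : M.IsHomogeneous κ)
    (hM0 : ∀ x, 0 ≤ MvPolynomial.eval x M) {T : ℝ} (hT : 0 < T) :
    (radialMeasure M).real (Set.Iic T) = √T ^ (N + κ) * (radialMeasure M).real (Set.Iic 1) := by
  have e : ∀ T : ℝ, (radialMeasure M).real (Set.Iic T) =
      ∫ t, (Set.Iic T).indicator (fun _ => (1 : ℝ)) t ∂radialMeasure M := by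
    intro T
    rw [integral_indicator_const _ measurableSet_Iic, smul_eq_mul, mul_one]
  rw [e, e, integral_radialMeasure_scale hM hM0
    (stronglyMeasurable_const.indicator measurableSet_Iic) (Real.sqrt_pos.2 hT), smul_eq_mul,
    Real.sq_sqrt hT.le]
  congr 2 with t
  have : T * t ∈ Set.Iic T ↔ t ∈ Set.Iic 1 := by
    rw [Set.mem_Iic, Set.mem_Iic, mul_le_iff_le_one_right hT]
  by_cases h : t ∈ Set.Iic 1
  · rw [Set.indicator_of_mem h, Set.indicator_of_mem (this.2 h)]
  · rw [Set.indicator_of_notMem h, Set.indicator_of_notMem fun h' => h (this.1 h')]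

end

lemma norm_circleExponent_le (P α : ℝ) : ‖circleExponent P α‖ ≤ 8 * (1 / P ^ 2 + |α|) := by
  have h : ‖circleExponent P α‖ ≤ |1 / P ^ 2| + |2 * Real.pi * α| := by
    have := Complex.norm_le_abs_re_add_abs_im (circleExponent P α)
    rwa [re_circleExponent, im_circleExponent, abs_neg] at this
  have h0 : 0 ≤ 1 / P ^ 2 := by positivity
  rw [abs_of_nonneg h0, abs_mul, abs_of_pos (by positivity)] at h
  nlinarith [Real.pi_lt_d2, abs_nonneg α]

lemma inv_sq_le_norm_circleExponent (P α : ℝ) : 1 / P ^ 2 ≤ ‖circleExponent P α‖ := by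
  rw [← re_circleExponent P α]
  exact (le_abs_self _).trans (Complex.abs_re_le_norm _)

lemma six_mul_abs_le_norm_circleExponent (P α : ℝ) : 6 * |α| ≤ ‖circleExponent P α‖ := by
  have h := Complex.abs_im_le_norm (circleExponent P α)
  rw [im_circleExponent, abs_neg, abs_mul, abs_of_pos (by positivity)] at h
  nlinarith [Real.pi_gt_d2, abs_nonneg α]

lemma exists_uniform_bound {p : ℕ → ℝ → Prop} (hp : ∀ k C C', C ≤ C' → p k C → p k C')
    (h : ∀ k, ∃ C, 0 < C ∧ p k C) (κ : ℕ) : ∃ C, 0 < C ∧ ∀ k ≤ κ, p k C := by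
  choose C hC hpC using h
  refine ⟨∑ k ∈ range (κ + 1), C k, sum_pos (fun k _ => hC k) ⟨0, by simp⟩, fun k hk => ?_⟩
  exact hp k _ _ (single_le_sum (f := C) (fun i _ => (hC i).le) (by simp; omega)) (hpC k)

section

variable {N κ : ℕ} {M : MvPolynomial (Fin N) ℝ}

/-- Near the origin the lattice sum is close to the corresponding integral. -/
lemma norm_tsum_gaussPoly_sub_integral_le (hN : 5 ≤ N) (hM : M.IsHomogeneous κ) {D : ℕ}
    (hD : N + κ = D + 4) (s : ℝ) : ∃ C : ℝ, 0 < C ∧ ∀ P : ℝ, 1 ≤ P → ∀ α : ℝ, |α| ≤ 1 / P →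
      ‖∑' b : Fin N → ℤ, gaussPoly M (circleExponent P α) (fun i => s + b i) -
        ∫ x, gaussPoly M (circleExponent P α) x‖ ≤ C * P ^ (D + 3) * ‖circleExponent P α‖ := by
  obtain ⟨C₁, hC₁, h₁⟩ := exists_uniform_bound (p := fun k C => ∀ P : ℝ, 0 < P → ∀ w : ℂ,
      w.re = 1 / P ^ 2 → ∀ s : ℝ, ‖∑' n : ℤ, gaussMono k w 0 (s + n) - gaussMoment k w 0‖ ≤
      C * (‖w‖ * P) ^ 3 * P ^ (k + 1))
    (fun k C C' h hC P hP w hw s => (hC P hP w hw s).trans (by gcongr))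
    norm_tsum_gaussMono_sub_le κ
  obtain ⟨C₂, hC₂, h₂⟩ := exists_uniform_bound (p := fun k C => ∀ P : ℝ, 0 < P → ∀ w : ℂ,
      w.re = 1 / P ^ 2 → ‖gaussMoment k w 0‖ ≤ C * P ^ k * √(1 / ‖w‖))
    (fun k C C' h hC P hP w hw => (hC P hP w hw).trans (by gcongr))
    norm_gaussMoment_zero_le κ
  obtain ⟨C₃, hC₃, h₃⟩ := exists_uniform_bound (p := fun k C => ∀ P : ℝ, 0 < P → ∀ α : ℝ,
      ∀ a : ℤ, ∀ q : ℕ, 0 < q → (q : ℝ) ≤ P → IsCoprime a (q : ℤ) →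
      |α - a / q| ≤ 1 / (q * P) → ∀ s : ℝ,
      ‖∑' n : ℤ, gaussMono k (1 / P ^ 2 - 2 * Real.pi * Complex.I * α) 0 (s + n)‖ ^ 2 ≤
        C * P ^ (2 * k) / (q * (1 / P ^ 2 + |α - a / q|)))
    (fun k C C' h hC P hP α a q hq hqP hc ha s =>
      (hC P hP α a q hq hqP hc ha s).trans (by gcongr))
    norm_sq_tsum_gaussMono_le κ
  set c := C₁ + C₂ + √(8 * C₃) with hc
  have hc0 : 0 < c := by positivity
  have hA : 0 ≤ ∑ μ ∈ M.support, |M.coeff μ| := sum_nonneg fun _ _ => abs_nonneg _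
  refine ⟨(∑ μ ∈ M.support, |M.coeff μ|) * N * c ^ (N - 1) * c + 1, by positivity,
    fun P hP α hα => ?_⟩
  have hP0 : 0 < P := by linarith
  have hw0 := norm_circleExponent_pos hP0 α
  have hre : 0 < (circleExponent P α).re := by rw [re_circleExponent]; positivity
  have hwP := inv_sq_le_norm_circleExponent P α
  have hwle := norm_circleExponent_le P α
  rw [tsum_gaussPoly M hre s, integral_gaussPoly M hre]
  have hS : ∀ k ≤ κ, ‖∑' n : ℤ, gaussMono k (circleExponent P α) 0 (s + n)‖ ≤
      √(8 * C₃) * P ^ k * √(1 / ‖circleExponent P α‖) := by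
    intro k hk
    have h := h₃ k hk P hP0 α 0 1 one_pos (by simpa) isCoprime_one_right
      (by simpa using hα) s
    refine (sq_le_sq₀ (norm_nonneg _) (by positivity)).1 (h.trans ?_)
    rw [mul_pow, mul_pow, Real.sq_sqrt (by positivity), Real.sq_sqrt (by positivity), ← pow_mul,
      mul_comm 2 k, mul_one_div]
    simp only [Int.cast_zero, Nat.cast_one, zero_div, sub_zero, one_mul]
    rw [div_le_div_iff₀ (by positivity) hw0]
    calc _ ≤ C₃ * P ^ (k * 2) * (8 * (1 / P ^ 2 + |α|)) := by gcongr
      _ = _ := by ring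
  set w := circleExponent P α with hw
  set Y := √(1 / ‖w‖) with hY
  have hY0 : 0 ≤ Y := Real.sqrt_nonneg _
  have hYP : Y ≤ P := by
    rw [hY, Real.sqrt_le_left hP0.le, div_le_iff₀ hw0]
    have := mul_le_mul_of_nonneg_left hwP (sq_nonneg P)
    rwa [mul_one_div_cancel (by positivity)] at this
  have hY2 : Y ^ 2 = 1 / ‖w‖ := Real.sq_sqrt (by positivity)
  have key := norm_sum_coeff_prod_sub_le hM (S := fun k => ∑' n : ℤ, gaussMono k w 0 (s + n))
    (I := fun k => gaussMoment k w 0) (P := P) (c := c) (Y := Y) (E := ‖w‖ ^ 3 * P ^ 4) hP0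
    hc0.le hY0
    (fun k hk => (hS k hk).trans (by
      gcongr
      rw [hc]; linarith))
    (fun k hk => (h₂ k hk P hP0 w (re_circleExponent P α)).trans (by
      gcongr
      rw [hc]; linarith [Real.sqrt_nonneg (8 * C₃)]))
    fun k hk => (h₁ k hk P hP0 w (re_circleExponent P α) s).trans (by
      rw [show c * P ^ k * (‖w‖ ^ 3 * P ^ 4) = c * (‖w‖ * P) ^ 3 * P ^ (k + 1) by ring]
      gcongr
      rw [hc]; linarith [Real.sqrt_nonneg (8 * C₃)])
  refine key.trans ?_
  have hYN : Y ^ (N - 1) ≤ P ^ (N - 5) * (1 / ‖w‖) ^ 2 := by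
    rw [show N - 1 = N - 5 + 2 * 2 by omega, pow_add, pow_mul, hY2]
    gcongr
  set A := (∑ μ ∈ M.support, |M.coeff μ|) * N * c ^ (N - 1) * c
  have hA' : 0 ≤ A := by positivity
  calc A * P ^ κ * (Y ^ (N - 1) * (‖w‖ ^ 3 * P ^ 4))
      ≤ A * P ^ κ * (P ^ (N - 5) * (1 / ‖w‖) ^ 2 * (‖w‖ ^ 3 * P ^ 4)) := by gcongr
    _ = A * P ^ (D + 3) * ‖w‖ := by
        rw [show D + 3 = κ + (N - 5) + 4 by omega, pow_add, pow_add]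
        field_simp
    _ ≤ _ := by gcongr; linarith

/-- Weyl's bound for the lattice sum. -/
lemma norm_tsum_gaussPoly_le (hN : 5 ≤ N) (hM : M.IsHomogeneous κ) {D : ℕ}
    (hD : N + κ = D + 4) (s : ℝ) : ∃ C : ℝ, 0 < C ∧ ∀ P : ℝ, 1 ≤ P → ∀ α : ℝ, ∀ a : ℤ, ∀ q : ℕ,
      0 < q → (q : ℝ) ≤ P → IsCoprime a (q : ℤ) → |α - a / q| ≤ 1 / (q * P) →
      ‖∑' b : Fin N → ℤ, gaussPoly M (circleExponent P α) (fun i => s + b i)‖ ≤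
        C * P ^ D * (1 / (q ^ 2 * √q)) * (1 / (1 / P ^ 2 + |α - a / q|) ^ 2) := by
  obtain ⟨C₃, hC₃, h₃⟩ := exists_uniform_bound (p := fun k C => ∀ P : ℝ, 0 < P → ∀ α : ℝ,
      ∀ a : ℤ, ∀ q : ℕ, 0 < q → (q : ℝ) ≤ P → IsCoprime a (q : ℤ) →
      |α - a / q| ≤ 1 / (q * P) → ∀ s : ℝ,
      ‖∑' n : ℤ, gaussMono k (1 / P ^ 2 - 2 * Real.pi * Complex.I * α) 0 (s + n)‖ ^ 2 ≤
        C * P ^ (2 * k) / (q * (1 / P ^ 2 + |α - a / q|)))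
    (fun k C C' h hC P hP α a q hq hqP hc ha s =>
      (hC P hP α a q hq hqP hc ha s).trans (by gcongr))
    norm_sq_tsum_gaussMono_le κ
  have hA : 0 ≤ ∑ μ ∈ M.support, |M.coeff μ| := sum_nonneg fun _ _ => abs_nonneg _
  refine ⟨(∑ μ ∈ M.support, |M.coeff μ|) * √C₃ ^ N + 1, by positivity,
    fun P hP α a q hq hqP hcop ha => ?_⟩
  have hP0 : 0 < P := by linarith
  have hq0 : (0 : ℝ) < q := by exact_mod_cast hq
  have hre : 0 < (circleExponent P α).re := by rw [re_circleExponent]; positivity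
  rw [tsum_gaussPoly M hre s]
  set τ := 1 / P ^ 2 + |α - a / q| with hτ
  have hτ0 : 0 < τ := by positivity
  set y := √(1 / (q * τ)) with hy
  have hy0 : 0 ≤ y := Real.sqrt_nonneg _
  have hy2 : y ^ 2 = 1 / (q * τ) := Real.sq_sqrt (by positivity)
  have hyq : y ≤ P * (1 / √q) := by
    rw [hy, Real.sqrt_le_left (by positivity), mul_pow, div_pow, Real.sq_sqrt hq0.le, one_pow]
    rw [div_le_iff₀ (by positivity)]
    have h1 : 1 / P ^ 2 ≤ τ := by rw [hτ]; linarith [abs_nonneg (α - a / q)]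
    have h2 := mul_le_mul_of_nonneg_left h1 (sq_nonneg P)
    rw [mul_one_div_cancel (by positivity)] at h2
    calc (1 : ℝ) ≤ P ^ 2 * τ := h2
      _ = _ := by field_simp
  have hyP : y ≤ P := by
    refine hyq.trans (mul_le_of_le_one_right hP0.le ?_)
    rw [div_le_one (by positivity), Real.one_le_sqrt]
    exact_mod_cast hq
  have key := norm_sum_coeff_prod_le hM (c := √C₃) (P := P) (Y := y)
    (S := fun k => ∑' n : ℤ, gaussMono k (circleExponent P α) 0 (s + n)) fun k hk => by
      refine (sq_le_sq₀ (norm_nonneg _) (by positivity)).1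
        ((h₃ k hk P hP0 α a q hq hqP hcop ha s).trans_eq ?_)
      rw [mul_pow, mul_pow, Real.sq_sqrt hC₃.le, hy2, ← pow_mul, mul_comm 2 k, mul_one_div]
  refine key.trans ?_
  set A := (∑ μ ∈ M.support, |M.coeff μ|) * √C₃ ^ N
  have hA' : 0 ≤ A := by positivity
  have hyN : y ^ N ≤ P ^ (N - 5) * (P * (1 / √q)) * (1 / (q * τ)) ^ 2 := by
    have e : y ^ N = y ^ (N - 5) * y * (y ^ 2) ^ 2 := by
      rw [← pow_mul, ← pow_succ, ← pow_add]; congr 1; omega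
    rw [e, hy2]
    gcongr
  calc A * P ^ κ * y ^ N
      ≤ A * P ^ κ * (P ^ (N - 5) * (P * (1 / √q)) * (1 / (q * τ)) ^ 2) := by gcongr
    _ = A * P ^ D * (1 / (q ^ 2 * √q)) * (1 / τ ^ 2) := by
        rw [show D = κ + (N - 5) + 1 by omega, pow_add, pow_add]
        field_simp
    _ ≤ _ := by gcongr; linarith

end

/-- The (unnormalised) Cauchy density. -/
noncomputable def cauchyKernel (δ x : ℝ) : ℝ := 1 / (δ ^ 2 + x ^ 2)

lemma cauchyKernel_nonneg (δ x : ℝ) : 0 ≤ cauchyKernel δ x := by unfold cauchyKernel; positivity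

lemma continuous_cauchyKernel {δ : ℝ} (hδ : 0 < δ) : Continuous (cauchyKernel δ) := by
  unfold cauchyKernel
  exact continuous_const.div (by fun_prop) fun x => by positivity

lemma integral_cauchyKernel_le {δ : ℝ} (hδ : 0 < δ) (x : ℝ) :
    ∫ α in (-(1 / 2) : ℝ)..(1 / 2), cauchyKernel δ (α - x) ≤ Real.pi / δ := by
  have hd : ∀ α ∈ Set.uIcc (-(1 / 2) : ℝ) (1 / 2),
      HasDerivAt (fun α => Real.arctan ((α - x) / δ) / δ) (cauchyKernel δ (α - x)) α := by
    intro α _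
    have h := ((((hasDerivAt_id α).sub_const x).div_const δ).arctan).div_const δ
    refine h.congr_deriv ?_
    rw [cauchyKernel, id]
    field_simp
  rw [intervalIntegral.integral_eq_sub_of_hasDerivAt hd
    (((continuous_cauchyKernel hδ).comp (continuous_sub_right x)).intervalIntegrable _ _),
    ← sub_div]
  have h1 := Real.arctan_lt_pi_div_two ((1 / 2 - x) / δ)
  have h2 := Real.neg_pi_div_two_lt_arctan ((-(1 / 2) - x) / δ)
  gcongr
  linarith

/-- The weight with which the major arc at `k / q` enters the error term. -/
noncomputable def arcWeight (q : ℕ) : ℝ := ((q : ℝ) ^ (5 / 4 : ℝ))⁻¹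

lemma arcWeight_nonneg (q : ℕ) : 0 ≤ arcWeight q := by unfold arcWeight; positivity

lemma summable_arcWeight : Summable arcWeight := Real.summable_nat_rpow_inv.2 (by norm_num)

lemma one_div_mul_sqrt_mul_le {q k : ℕ} (hk : 0 < k) (hkq : k ≤ q) :
    1 / (q * √q * k) ≤ arcWeight q * arcWeight k := by
  have hk0 : (0 : ℝ) < k := by exact_mod_cast hk
  have hq0 : (0 : ℝ) < q := by exact_mod_cast hk.trans_le hkq
  rw [arcWeight, arcWeight, ← mul_inv, one_div]
  refine inv_anti₀ (by positivity) ?_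
  have e1 : (q : ℝ) ^ (5 / 4 : ℝ) * (q : ℝ) ^ (1 / 4 : ℝ) = q * √q := by
    rw [← Real.rpow_add hq0, Real.sqrt_eq_rpow, ← Real.rpow_one_add' hq0.le (by norm_num)]
    norm_num
  have e2 : (k : ℝ) ^ (5 / 4 : ℝ) = k * (k : ℝ) ^ (1 / 4 : ℝ) := by
    rw [← Real.rpow_one_add' hk0.le (by norm_num)]; norm_num
  have h : (k : ℝ) ^ (1 / 4 : ℝ) ≤ (q : ℝ) ^ (1 / 4 : ℝ) :=
    Real.rpow_le_rpow hk0.le (by exact_mod_cast hkq) (by norm_num)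
  rw [e2, ← e1]
  calc _ ≤ (q : ℝ) ^ (5 / 4 : ℝ) * (k * (q : ℝ) ^ (1 / 4 : ℝ)) := by gcongr
    _ = _ := by ring

/-- The contribution of all arcs centred at nonzero rationals. -/
noncomputable def arcSum (P : ℕ) (α : ℝ) : ℝ :=
  ∑ q ∈ range (P + 1), ∑ k ∈ range (P + 1), arcWeight q * arcWeight k *
    (cauchyKernel (1 / P ^ 2) (α - k / q) + cauchyKernel (1 / P ^ 2) (α - -(k / q)))

lemma continuous_arcSum {P : ℕ} (hP : 0 < P) : Continuous (arcSum P) := by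
  have := continuous_cauchyKernel (δ := 1 / (P : ℝ) ^ 2) (by positivity)
  unfold arcSum
  fun_prop

lemma integral_arcSum_le {P : ℕ} (hP : 0 < P) :
    ∫ α in (-(1 / 2) : ℝ)..(1 / 2), arcSum P α ≤
      2 * Real.pi * (∑' q, arcWeight q) ^ 2 * P ^ 2 := by
  have hδ : 0 < 1 / (P : ℝ) ^ 2 := by positivity
  have hc := continuous_cauchyKernel hδ
  have hi : ∀ x : ℝ, IntervalIntegrable (fun α => cauchyKernel (1 / (P : ℝ) ^ 2) (α - x)) volume
      (-(1 / 2)) (1 / 2) := fun x => (hc.comp (continuous_sub_right x)).intervalIntegrable _ _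
  have hV : ∑ q ∈ range (P + 1), arcWeight q ≤ ∑' q, arcWeight q :=
    summable_arcWeight.sum_le_tsum _ fun q _ => arcWeight_nonneg q
  have hV0 : 0 ≤ ∑ q ∈ range (P + 1), arcWeight q := sum_nonneg fun q _ => arcWeight_nonneg q
  unfold arcSum
  have hinner : ∀ q : ℕ, IntervalIntegrable (fun α => ∑ k ∈ range (P + 1),
      arcWeight q * arcWeight k * (cauchyKernel (1 / (P : ℝ) ^ 2) (α - k / q) +
        cauchyKernel (1 / (P : ℝ) ^ 2) (α - -(k / q)))) volume (-(1 / 2)) (1 / 2) := fun q =>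
    Continuous.intervalIntegrable (by fun_prop) _ _
  rw [intervalIntegral.integral_finsetSum fun q _ => hinner q]
  calc _ ≤ ∑ q ∈ range (P + 1), ∑ k ∈ range (P + 1),
        arcWeight q * arcWeight k * (2 * Real.pi * P ^ 2) := by
        refine sum_le_sum fun q _ => ?_
        rw [intervalIntegral.integral_finsetSum fun k _ => ((hi _).add (hi _)).const_mul _]
        refine sum_le_sum fun k _ => ?_
        rw [intervalIntegral.integral_const_mul, intervalIntegral.integral_add (hi _) (hi _)]
        refine mul_le_mul_of_nonneg_left ?_ (mul_nonneg (arcWeight_nonneg _) (arcWeight_nonneg _))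
        have h1 := integral_cauchyKernel_le hδ (k / q)
        have h2 := integral_cauchyKernel_le hδ (-(k / q))
        rw [div_div_eq_mul_div, div_one] at h1 h2
        linarith
    _ = (2 * Real.pi * P ^ 2) * (∑ q ∈ range (P + 1), arcWeight q) ^ 2 := by
        simp_rw [pow_two (∑ q ∈ range (P + 1), arcWeight q), ← sum_mul, ← mul_sum, ← sum_mul]
        ring
    _ ≤ (2 * Real.pi * P ^ 2) * (∑' q, arcWeight q) ^ 2 := by gcongr
    _ = _ := by ring

lemma arcWeight_mul_cauchyKernel_le_arcSum {P q : ℕ} {a : ℤ} (hq : q ≤ P) (ha : a.natAbs ≤ P)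
    (α : ℝ) : arcWeight q * arcWeight a.natAbs * cauchyKernel (1 / (P : ℝ) ^ 2) (α - a / q) ≤
      arcSum P α := by
  have hnn : ∀ q k : ℕ, 0 ≤ arcWeight q * arcWeight k *
      (cauchyKernel (1 / (P : ℝ) ^ 2) (α - k / q) +
        cauchyKernel (1 / (P : ℝ) ^ 2) (α - -(k / q))) := fun q k =>
    mul_nonneg (mul_nonneg (arcWeight_nonneg _) (arcWeight_nonneg _))
      (add_nonneg (cauchyKernel_nonneg _ _) (cauchyKernel_nonneg _ _))
  have h1 : arcWeight q * arcWeight a.natAbs * (cauchyKernel (1 / (P : ℝ) ^ 2)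
      (α - a.natAbs / q) + cauchyKernel (1 / (P : ℝ) ^ 2) (α - -(a.natAbs / q))) ≤ arcSum P α :=
    (single_le_sum (f := fun k : ℕ => arcWeight q * arcWeight k *
      (cauchyKernel (1 / (P : ℝ) ^ 2) (α - k / q) +
        cauchyKernel (1 / (P : ℝ) ^ 2) (α - -(k / q))))
      (fun k _ => hnn q k) (mem_range.2 (Nat.lt_succ_of_le ha))).trans
    (single_le_sum (f := fun q : ℕ => ∑ k ∈ range (P + 1), arcWeight q * arcWeight k *
      (cauchyKernel (1 / (P : ℝ) ^ 2) (α - k / q) +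
        cauchyKernel (1 / (P : ℝ) ^ 2) (α - -(k / q))))
      (fun q _ => sum_nonneg fun k _ => hnn q k) (mem_range.2 (Nat.lt_succ_of_le hq)))
  refine le_trans ?_ h1
  refine mul_le_mul_of_nonneg_left ?_ (mul_nonneg (arcWeight_nonneg _) (arcWeight_nonneg _))
  rcases Int.natAbs_eq a with h | h
  · have : (a : ℝ) = a.natAbs := by
      rw [Nat.cast_natAbs, abs_of_nonneg (by omega)]
    rw [this]
    exact le_add_of_nonneg_right (cauchyKernel_nonneg _ _)
  · have : (a : ℝ) = -(a.natAbs : ℝ) := by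
      rw [Nat.cast_natAbs, abs_of_nonpos (by omega), Int.cast_neg, neg_neg]
    rw [this, neg_div]
    exact le_add_of_nonneg_left (cauchyKernel_nonneg _ _)

/-- Dirichlet approximation of a point that is not close to the origin. -/
lemma exists_rat_approx {P : ℕ} (hP : 0 < P) {α : ℝ} (h1 : 1 / (P : ℝ) < |α|) (h2 : |α| ≤ 1 / 2) :
    ∃ (a : ℤ) (q : ℕ), 0 < q ∧ q ≤ P ∧ IsCoprime a (q : ℤ) ∧ |α - a / q| ≤ 1 / (q * P) ∧
      0 < a.natAbs ∧ a.natAbs ≤ q ∧ (a.natAbs : ℝ) ≤ 2 * q * |α| := by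
  obtain ⟨r, hr, hrP⟩ := Real.exists_rat_abs_sub_le_and_den_le α hP
  have hP0 : (0 : ℝ) < P := by exact_mod_cast hP
  have hP1 : (1 : ℝ) ≤ P := by exact_mod_cast hP
  have hq0 : (0 : ℝ) < r.den := by exact_mod_cast r.den_pos
  have hq1 : (1 : ℝ) ≤ r.den := by exact_mod_cast r.den_pos
  rw [Rat.cast_def] at hr
  have hle : |α - r.num / r.den| ≤ 1 / (r.den * P) := by
    refine hr.trans (one_div_le_one_div_of_le (by positivity) ?_)
    nlinarith
  have habs : ((r.num.natAbs : ℕ) : ℝ) = |(r.num : ℝ)| := by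
    rw [Nat.cast_natAbs, Int.cast_abs]
  have hhalf : |α - r.num / r.den| * r.den ≤ 1 / 2 := by
    calc _ ≤ 1 / (((P : ℝ) + 1) * r.den) * r.den := by gcongr
      _ = 1 / ((P : ℝ) + 1) := by field_simp
      _ ≤ 1 / 2 := one_div_le_one_div_of_le (by norm_num) (by linarith)
  have hnum : |(r.num : ℝ)| = |(r.num : ℝ) / r.den| * r.den := by
    rw [abs_div, abs_of_pos hq0]; field_simp
  have hne : r.num ≠ 0 := by
    intro h0
    have hd : r.den = 1 := by
      have := r.reduced
      rwa [h0, Int.natAbs_zero, Nat.coprime_zero_left] at this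
    rw [h0, hd] at hle
    simp only [Int.cast_zero, zero_div, sub_zero, Nat.cast_one, one_mul] at hle
    linarith
  have htri := abs_sub_abs_le_abs_sub α ((r.num : ℝ) / r.den)
  have htri' := abs_sub_abs_le_abs_sub ((r.num : ℝ) / r.den) α
  rw [abs_sub_comm _ α] at htri'
  have hpos : 0 < r.num.natAbs := Int.natAbs_pos.2 hne
  have hone : (1 : ℝ) ≤ |(r.num : ℝ)| := by rw [← habs]; exact_mod_cast hpos
  have hup : |(r.num : ℝ)| ≤ |α| * r.den + 1 / 2 := by rw [hnum]; nlinarith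
  refine ⟨r.num, r.den, r.den_pos, hrP, Int.isCoprime_iff_nat_coprime.2 ?_, hle, hpos, ?_, ?_⟩
  · simpa using r.reduced
  · have : |(r.num : ℝ)| ≤ r.den := by nlinarith
    rw [← habs] at this
    exact_mod_cast this
  · rw [habs]; nlinarith

lemma norm_exp_sub_one_le_mul {z : ℂ} {c : ℝ} (hc : 0 ≤ c) (hz : z.re ≤ c) :
    ‖Complex.exp z - 1‖ ≤ (Real.exp c + 1) * ‖z‖ := by
  have hc1 : 1 ≤ Real.exp c := Real.one_le_exp hc
  rcases le_total ‖z‖ 1 with h | h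
  · refine (Complex.norm_exp_sub_one_le h).trans ?_
    gcongr
    linarith
  · have h1 : ‖Complex.exp z - 1‖ ≤ Real.exp c + 1 := by
      refine (norm_sub_le _ _).trans ?_
      rw [norm_one, Complex.norm_exp]
      gcongr
    nlinarith

lemma one_div_norm_circleExponent_sq_le (P α : ℝ) :
    1 / ‖circleExponent P α‖ ^ 2 ≤ cauchyKernel (1 / P ^ 2) α := by
  unfold cauchyKernel
  rcases eq_or_ne ((1 / P ^ 2) ^ 2 + α ^ 2) 0 with h | h
  · have h1 : (1 / P ^ 2) ^ 2 = 0 := by nlinarith [sq_nonneg (1 / P ^ 2), sq_nonneg α]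
    have h2 : α ^ 2 = 0 := by nlinarith [sq_nonneg (1 / P ^ 2), sq_nonneg α]
    rw [norm_circleExponent_sq, h1, mul_pow, h2]
    simp
  · refine one_div_le_one_div_of_le (lt_of_le_of_ne (by positivity) h.symm) ?_
    rw [norm_circleExponent_sq, mul_pow]
    have : (1 : ℝ) ≤ (2 * Real.pi) ^ 2 := by nlinarith [Real.pi_gt_three]
    nlinarith [sq_nonneg α]

section

variable {N κ : ℕ} {M : MvPolynomial (Fin N) ℝ}

/-- The power series that discretises the Laplace transform of the radial measure. -/
noncomputable def tentSeries (M : MvPolynomial (Fin N) ℝ) (w : ℂ) : ℂ :=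
  ∑' n : ℕ, (tentCoeff (radialMeasure M) n : ℂ) * Complex.exp (-w) ^ n

lemma re_circleExponent_pos_le {P : ℝ} (hP : 1 ≤ P) (α : ℝ) :
    0 < (circleExponent P α).re ∧ (circleExponent P α).re ≤ 1 := by
  rw [re_circleExponent]
  refine ⟨by positivity, ?_⟩
  rw [div_le_one (by positivity)]
  nlinarith

lemma norm_integral_gaussPoly_sub_tentSeries_le (hM : M.IsHomogeneous κ)
    (hM0 : ∀ x, 0 ≤ MvPolynomial.eval x M) : ∃ C : ℝ, 0 < C ∧ ∀ P : ℝ, 1 ≤ P → ∀ α : ℝ,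
      ‖(∫ x, gaussPoly M (circleExponent P α) x) - tentSeries M (circleExponent P α)‖ ≤
        C * P ^ (N + κ) * ‖circleExponent P α‖ ^ 2 := by
  have hE : 0 ≤ ∫ t, Real.exp (-t) ∂radialMeasure M := integral_nonneg fun t => (Real.exp_pos _).le
  refine ⟨5 * (∫ t, Real.exp (-t) ∂radialMeasure M) + 1, by positivity, fun P hP α => ?_⟩
  obtain ⟨h1, h2⟩ := re_circleExponent_pos_le hP α
  have h := norm_integral_exp_sub_tsum_tentCoeff_le (radialMeasure_ae_nonneg M)
    (fun ε hε => integrable_exp_radialMeasure hM0 hε) h1 h2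
  rw [re_circleExponent, integral_exp_radialMeasure hM hM0 (by linarith),
    integral_exp_neg_mul_radialMeasure hM0] at h
  refine h.trans ?_
  have : 0 ≤ P ^ (N + κ) * ‖circleExponent P α‖ ^ 2 := by positivity
  nlinarith

lemma norm_tentSeries_le (hM : M.IsHomogeneous κ) (hM0 : ∀ x, 0 ≤ MvPolynomial.eval x M) {D : ℕ}
    (hD : N + κ = D + 4) (hD3 : 3 ≤ D) : ∃ C : ℝ, 0 < C ∧ ∀ P : ℝ, 1 ≤ P → ∀ α : ℝ, |α| ≤ 1 / 2 →
      ‖tentSeries M (circleExponent P α)‖ ≤ C * P ^ D * (1 / ‖circleExponent P α‖ ^ 2) := by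
  have hE : 0 ≤ ∫ t, Real.exp (-t) ∂radialMeasure M := integral_nonneg fun t => (Real.exp_pos _).le
  refine ⟨27 * (∫ t, Real.exp (-t) ∂radialMeasure M) + 1, by positivity, fun P hP α hα => ?_⟩
  obtain ⟨h1, h2⟩ := re_circleExponent_pos_le hP α
  have hw0 := norm_circleExponent_pos (P := P) (by linarith) α
  have h := norm_tsum_tentCoeff_mul_le (radialMeasure_ae_nonneg M)
    (fun ε hε => integrable_exp_radialMeasure hM0 hε) (D := N + κ + 2) (by omega)
    (integral_nonneg fun t => le_max_right _ _)
    (fun T hT => integral_max_radialMeasure hM hM0 hT) h1 h2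
  rw [re_circleExponent, integral_exp_radialMeasure hM hM0 (by linarith), hD] at h
  have h3 := norm_circleExponent_div_three_le hP hα
  change _ * ‖tentSeries M _‖ ≤ _ at h
  set x := ‖circleExponent P α‖
  set y := ‖tentSeries M (circleExponent P α)‖
  set I := ∫ t, Real.exp (-t) ∂radialMeasure M
  have h4 : (x / 3) ^ 2 * y ≤ (1 / P ^ 2) ^ 2 * (3 * (P ^ (D + 4) * I)) := by
    refine le_trans ?_ h
    gcongr
  have h5 : (1 / P ^ 2) ^ 2 * (3 * (P ^ (D + 4) * I)) = 3 * I * P ^ D := by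
    rw [pow_add]; field_simp
  rw [h5] at h4
  rw [mul_one_div, le_div_iff₀ (by positivity)]
  have : 0 ≤ P ^ D := by positivity
  nlinarith

end

lemma sq_le_two_mul_cauchyKernel {P α : ℝ} (hP : 0 < P) (hα : |α| ≤ 1 / P) :
    P ^ 2 ≤ 2 * cauchyKernel (1 / P) α := by
  have h : α ^ 2 ≤ (1 / P) ^ 2 := sq_le_sq' (by linarith [neg_abs_le α]) ((le_abs_self α).trans hα)
  have hpos : 0 < (1 / P) ^ 2 := by positivity
  rw [cauchyKernel, mul_one_div, le_div_iff₀ (by positivity)]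
  calc P ^ 2 * ((1 / P) ^ 2 + α ^ 2) ≤ P ^ 2 * ((1 / P) ^ 2 + (1 / P) ^ 2) := by gcongr
    _ = 2 := by field_simp; norm_num

section

variable {N κ : ℕ} {M : MvPolynomial (Fin N) ℝ}

/-- The minor and major arc estimates combined into one majorant. -/
lemma norm_tsum_gaussPoly_sub_tentSeries_mul_le (hN : 5 ≤ N) (hM : M.IsHomogeneous κ)
    (hM0 : ∀ x, 0 ≤ MvPolynomial.eval x M) {D : ℕ} (hD : N + κ = D + 4) (hD3 : 3 ≤ D) (s : ℝ) :
    ∃ C : ℝ, 0 < C ∧ ∀ P : ℕ, 0 < P → ∀ α : ℝ, |α| ≤ 1 / 2 →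
      ‖∑' b : Fin N → ℤ, gaussPoly M (circleExponent P α) (fun i => s + b i) -
        tentSeries M (circleExponent P α)‖ * (12 / ‖circleExponent P α‖) ≤
      C * (P ^ (D + 1) * cauchyKernel (1 / P) α + P ^ D * arcSum P α) := by
  obtain ⟨C₁, hC₁, h₁⟩ := norm_tsum_gaussPoly_sub_integral_le hN hM hD s
  obtain ⟨C₂, hC₂, h₂⟩ := norm_tsum_gaussPoly_le hN hM hD s
  obtain ⟨C₃, hC₃, h₃⟩ := norm_integral_gaussPoly_sub_tentSeries_le hM hM0
  obtain ⟨C₄, hC₄, h₄⟩ := norm_tentSeries_le hM hM0 hD hD3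
  refine ⟨24 * (C₁ + 16 * C₃) + 12 * C₄ + 12 * C₂, by positivity, fun P hP α hα => ?_⟩
  have hP1 : (1 : ℝ) ≤ P := by exact_mod_cast hP
  have hP0 : (0 : ℝ) < P := by linarith
  have hw0 := norm_circleExponent_pos hP0 α
  have h₃' := h₃ P hP1 α
  have h₄' := h₄ P hP1 α hα
  rw [hD] at h₃'
  have hc1 : 0 ≤ (P : ℝ) ^ (D + 1) * cauchyKernel (1 / P) α :=
    mul_nonneg (by positivity) (cauchyKernel_nonneg _ _)
  have hc2 : 0 ≤ (P : ℝ) ^ D * arcSum P α := by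
    refine mul_nonneg (by positivity) (sum_nonneg fun q _ => sum_nonneg fun k _ => ?_)
    exact mul_nonneg (mul_nonneg (arcWeight_nonneg _) (arcWeight_nonneg _))
      (add_nonneg (cauchyKernel_nonneg _ _) (cauchyKernel_nonneg _ _))
  set H := tentSeries M (circleExponent P α) with hH
  set G := ∑' b : Fin N → ℤ, gaussPoly M (circleExponent P α) (fun i => s + b i) with hG
  set x := ‖circleExponent P α‖ with hx
  rcases le_or_gt |α| (1 / (P : ℝ)) with hnear | hfar
  · have h₁' := h₁ P hP1 α hnear
    have hxP : x ≤ 16 / P := by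
      refine (norm_circleExponent_le P α).trans ?_
      have : 1 / (P : ℝ) ^ 2 ≤ 1 / P := one_div_le_one_div_of_le hP0 (by nlinarith)
      rw [show 16 / (P : ℝ) = 8 * (1 / P + 1 / P) by ring]
      gcongr
    have hsum : ‖G - H‖ ≤ (C₁ + 16 * C₃) * P ^ (D + 3) * x := by
      have e : G - H = (G - ∫ y, gaussPoly M (circleExponent P α) y) +
        ((∫ y, gaussPoly M (circleExponent P α) y) - H) := by ring
      rw [e]
      refine (norm_add_le _ _).trans ((add_le_add h₁' h₃').trans ?_)
      have : C₃ * P ^ (D + 4) * x ^ 2 ≤ 16 * C₃ * P ^ (D + 3) * x := by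
        calc C₃ * P ^ (D + 4) * x ^ 2 = C₃ * P ^ (D + 4) * x * x := by ring
          _ ≤ C₃ * P ^ (D + 4) * x * (16 / P) := by gcongr
          _ = _ := by rw [pow_succ (P : ℝ) (D + 3)]; field_simp
      linarith
    have hk := sq_le_two_mul_cauchyKernel hP0 hnear
    calc ‖G - H‖ * (12 / x) ≤ (C₁ + 16 * C₃) * P ^ (D + 3) * x * (12 / x) := by gcongr
      _ = 12 * (C₁ + 16 * C₃) * (P ^ (D + 1) * P ^ 2) := by rw [← pow_add]; field_simp
      _ ≤ 12 * (C₁ + 16 * C₃) * (P ^ (D + 1) * (2 * cauchyKernel (1 / P) α)) := by gcongr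
      _ = 24 * (C₁ + 16 * C₃) * (P ^ (D + 1) * cauchyKernel (1 / P) α) := by ring
      _ ≤ _ := by
        have : 0 ≤ (12 * C₄ + 12 * C₂) * (P ^ (D + 1) * cauchyKernel (1 / P) α) := by positivity
        have : 0 ≤ (24 * (C₁ + 16 * C₃) + 12 * C₄ + 12 * C₂) * (P ^ D * arcSum P α) := by
          positivity
        linarith
  · have h6 := six_mul_abs_le_norm_circleExponent P α
    rw [← hx] at h6
    have hα0 : 0 < |α| := lt_trans (by positivity) hfar
    have hHb : ‖H‖ * (12 / x) ≤ 12 * C₄ * (P ^ (D + 1) * cauchyKernel (1 / P) α) := by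
      have hxP : 1 / x ≤ P := by
        rw [div_le_iff₀ hw0]
        rw [div_lt_iff₀ hP0] at hfar
        nlinarith
      have hxk : 1 / x ^ 2 ≤ cauchyKernel (1 / P) α := by
        unfold cauchyKernel
        refine one_div_le_one_div_of_le (by positivity) ?_
        have h1 : (1 / (P : ℝ)) ^ 2 ≤ |α| ^ 2 := by gcongr
        have h2 : (6 * |α|) ^ 2 ≤ x ^ 2 := by gcongr
        rw [sq_abs] at h1
        rw [mul_pow, sq_abs] at h2
        nlinarith
      calc ‖H‖ * (12 / x) ≤ C₄ * P ^ D * (1 / x ^ 2) * (12 / x) := by gcongr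
        _ = 12 * C₄ * P ^ D * (1 / x) * (1 / x ^ 2) := by ring
        _ ≤ 12 * C₄ * P ^ D * P * cauchyKernel (1 / P) α := by gcongr
        _ = _ := by ring
    obtain ⟨a, q, hq0, hqP, hcop, hβ, ha0, haq, haα⟩ := exists_rat_approx hP hfar hα
    have h₂' := h₂ P hP1 α a q hq0 (by exact_mod_cast hqP) hcop hβ
    have hq0' : (0 : ℝ) < q := by exact_mod_cast hq0
    have ha0' : (0 : ℝ) < a.natAbs := by exact_mod_cast ha0
    have hGb : ‖G‖ * (12 / x) ≤ 12 * C₂ * (P ^ D * arcSum P α) := by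
      have hxa : 1 / x ≤ q / a.natAbs := by
        rw [div_le_div_iff₀ hw0 ha0']
        nlinarith
      have hker : 1 / (1 / (P : ℝ) ^ 2 + |α - a / q|) ^ 2 ≤
          cauchyKernel (1 / (P : ℝ) ^ 2) (α - a / q) := by
        unfold cauchyKernel
        refine one_div_le_one_div_of_le (by positivity) ?_
        rw [← sq_abs (α - a / q)]
        have : 0 ≤ 1 / (P : ℝ) ^ 2 * |α - a / q| := by positivity
        nlinarith
      have hck := cauchyKernel_nonneg (1 / (P : ℝ) ^ 2) (α - a / q)
      calc ‖G‖ * (12 / x) ≤ C₂ * P ^ D * (1 / (q ^ 2 * √q)) *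
            (1 / (1 / P ^ 2 + |α - a / q|) ^ 2) * (12 / x) := by gcongr
        _ = 12 * C₂ * P ^ D * (1 / (q ^ 2 * √q)) * (1 / x) *
            (1 / (1 / P ^ 2 + |α - a / q|) ^ 2) := by ring
        _ ≤ 12 * C₂ * P ^ D * (1 / (q ^ 2 * √q)) * (q / a.natAbs) *
            cauchyKernel (1 / (P : ℝ) ^ 2) (α - a / q) := by gcongr
        _ = 12 * C₂ * P ^ D * ((1 / (q * √q * a.natAbs)) *
            cauchyKernel (1 / (P : ℝ) ^ 2) (α - a / q)) := by
          field_simp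
        _ ≤ 12 * C₂ * P ^ D * (arcWeight q * arcWeight a.natAbs *
            cauchyKernel (1 / (P : ℝ) ^ 2) (α - a / q)) := by
          gcongr
          exact one_div_mul_sqrt_mul_le ha0 haq
        _ ≤ 12 * C₂ * P ^ D * arcSum P α := by
          gcongr
          exact arcWeight_mul_cauchyKernel_le_arcSum hqP (haq.trans hqP) α
        _ = _ := by ring
    calc ‖G - H‖ * (12 / x) ≤ (‖G‖ + ‖H‖) * (12 / x) := by
          gcongr
          exact norm_sub_le _ _
      _ = ‖G‖ * (12 / x) + ‖H‖ * (12 / x) := by ring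
      _ ≤ _ := by
        have : 0 ≤ (24 * (C₁ + 16 * C₃) + 12 * C₂) * (P ^ (D + 1) * cauchyKernel (1 / P) α) := by
          positivity
        have : 0 ≤ (24 * (C₁ + 16 * C₃) + 12 * C₄) * (P ^ D * arcSum P α) := by positivity
        linarith

end

section

variable {N κ : ℕ} {M : MvPolynomial (Fin N) ℝ}

lemma gaussPoly_of_sum_sq_eq (w : ℂ) {x : Fin N → ℝ} {n : ℕ} {c : ℝ}
    (h : ∑ i, x i ^ 2 = n + c) : (MvPolynomial.eval x M : ℂ) * Complex.exp (-w * n) =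
      Complex.exp (w * c) * gaussPoly M w x := by
  rw [gaussPoly, h, mul_left_comm, ← Complex.exp_add]
  congr 2
  push_cast
  ring

lemma tsum_mul_exp_eq_tentSeries (w : ℂ) :
    ∑' n : ℕ, (tentCoeff (radialMeasure M) n : ℂ) * Complex.exp (-w * n) = tentSeries M w := by
  refine tsum_congr fun n => ?_
  rw [mul_comm (-w), Complex.exp_nat_mul]

lemma summable_norm_tentCoeff_mul_exp (hM0 : ∀ x, 0 ≤ MvPolynomial.eval x M) {P : ℝ} (hP : 1 ≤ P) :
    Summable fun n : ℕ => ‖(tentCoeff (radialMeasure M) n : ℂ)‖ * Real.exp (-(1 / P ^ 2) * n) := by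
  obtain ⟨h1, h2⟩ := re_circleExponent_pos_le hP 0
  rw [re_circleExponent] at h1 h2
  refine (summable_tentCoeff_mul_pow (radialMeasure_ae_nonneg M)
    (fun ε hε => integrable_exp_radialMeasure hM0 hε) h1 h2).congr fun n => ?_
  rw [Complex.norm_real, Real.norm_of_nonneg (tentCoeff_nonneg n), mul_comm (-(1 / P ^ 2)),
    Real.exp_nat_mul]

lemma summable_norm_eval_mul_exp (M : MvPolynomial (Fin N) ℝ) {s c : ℝ} {Q : (Fin N → ℤ) → ℕ}
    (hQ : ∀ b : Fin N → ℤ, ∑ i, (s + b i) ^ 2 = Q b + c) {P : ℝ} (hP : 1 ≤ P) :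
    Summable fun b : Fin N → ℤ => ‖(MvPolynomial.eval (fun i => s + (b i : ℝ)) M : ℂ)‖ *
      Real.exp (-(1 / P ^ 2) * Q b) := by
  refine ((summable_gaussPoly M (re_circleExponent_pos_le hP 0).1 s).mul_left
    ‖Complex.exp (circleExponent P 0 * c)‖).congr fun b => ?_
  rw [← norm_mul, ← gaussPoly_of_sum_sq_eq _ (hQ b), norm_mul_exp_neg_mul_circleExponent]

/-- The circle method: the truncated lattice sum against its discretised radial model. -/
lemma abs_tsum_ite_sub_sum_tentCoeff_le (hN : 5 ≤ N) (hM : M.IsHomogeneous κ)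
    (hM0 : ∀ x, 0 ≤ MvPolynomial.eval x M) {D : ℕ} (hD : N + κ = D + 4) (hD3 : 3 ≤ D) {s c : ℝ}
    (hc : 0 ≤ c) {Q : (Fin N → ℤ) → ℕ}
    (hQ : ∀ b : Fin N → ℤ, ∑ i, (s + b i) ^ 2 = Q b + c) :
    ∃ C : ℝ, 0 < C ∧ ∀ P : ℕ, 0 < P → ∀ L : ℕ, (L : ℝ) + 1 ≤ P ^ 2 →
      |(∑' b : Fin N → ℤ, if Q b ≤ L then MvPolynomial.eval (fun i => s + (b i : ℝ)) M else 0) -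
        ∑ n ∈ range (L + 1), tentCoeff (radialMeasure M) n| ≤ C * P ^ (D + 2) := by
  obtain ⟨C₁, hC₁, h₁⟩ := norm_tsum_gaussPoly_sub_tentSeries_mul_le hN hM hM0 hD hD3 s
  obtain ⟨C₂, hC₂, h₂⟩ := norm_tentSeries_le hM hM0 hD hD3
  set A := Real.exp c * C₁ with hA
  set B := 12 * (Real.exp c + 1) * c * C₂ with hB
  have hA0 : 0 < A := by positivity
  have hB0 : 0 ≤ B := by positivity
  refine ⟨A * (Real.pi + 2 * Real.pi * (∑' q, arcWeight q) ^ 2) + B * Real.pi, by positivity,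
    fun P hP L hL => ?_⟩
  have hP1 : (1 : ℝ) ≤ P := by exact_mod_cast hP
  have hP0 : (0 : ℝ) < P := by linarith
  have hsG := summable_norm_eval_mul_exp M hQ hP1
  have hsH := summable_norm_tentCoeff_mul_exp hM0 hP1
  have hK : Continuous fun α => dualKernel L (circleExponent P α) := by
    have := continuous_circleExponent P
    unfold dualKernel
    fun_prop
  have hG := integral_tsum_mul_dualKernel hsG L
  have hH := integral_tsum_mul_dualKernel (Q := id) hsH L
  have hGc := (continuous_tsum_exp_circleExponent hsG).fun_mul hK
  have hHc := (continuous_tsum_exp_circleExponent (Q := id) hsH).fun_mul hK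
  have hsum : (∑' n : ℕ, if id n ≤ L then (tentCoeff (radialMeasure M) n : ℂ) else 0) =
      ((∑ n ∈ range (L + 1), tentCoeff (radialMeasure M) n : ℝ) : ℂ) := by
    rw [tsum_eq_sum (s := range (L + 1))]
    · push_cast
      refine sum_congr rfl fun n hn => if_pos ?_
      exact Nat.lt_succ_iff.1 (mem_range.1 hn)
    · intro n hn
      refine if_neg fun h => hn (mem_range.2 (Nat.lt_succ_of_le h))
  have hcast : (∑' b : Fin N → ℤ,
      if Q b ≤ L then (MvPolynomial.eval (fun i => s + (b i : ℝ)) M : ℂ) else 0) =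
      ((∑' b : Fin N → ℤ,
        if Q b ≤ L then MvPolynomial.eval (fun i => s + (b i : ℝ)) M else 0 : ℝ) : ℂ) := by
    rw [Complex.ofReal_tsum]
    refine tsum_congr fun b => ?_
    split_ifs <;> simp
  rw [hsum] at hH
  rw [hcast] at hG
  rw [← Real.norm_eq_abs, ← Complex.norm_real, Complex.ofReal_sub, ← hG, ← hH,
    ← intervalIntegral.integral_sub (hGc.intervalIntegrable _ _) (hHc.intervalIntegrable _ _)]
  have hpt : ∀ α ∈ Set.Ioc (-(1 / 2) : ℝ) (1 / 2),
      ‖(∑' b : Fin N → ℤ, (MvPolynomial.eval (fun i => s + (b i : ℝ)) M : ℂ) *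
          Complex.exp (-circleExponent P α * Q b)) * dualKernel L (circleExponent P α) -
        (∑' n : ℕ, (tentCoeff (radialMeasure M) n : ℂ) *
          Complex.exp (-circleExponent P α * (id n : ℕ))) * dualKernel L (circleExponent P α)‖ ≤
      A * (P ^ (D + 1) * cauchyKernel (1 / P) α + P ^ D * arcSum P α) +
        B * P ^ D * cauchyKernel (1 / P ^ 2) α := by
    intro α hα
    have hα2 : |α| ≤ 1 / 2 := abs_le.2 ⟨hα.1.le, hα.2⟩
    simp_rw [id, tsum_mul_exp_eq_tentSeries, fun b => gaussPoly_of_sum_sq_eq (M := M)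
      (circleExponent P α) (hQ b), tsum_mul_left]
    have h₁' := h₁ P hP α hα2
    have h₂' := h₂ P hP1 α hα2
    have hk := norm_dualKernel_le hP1 hα2 hL
    have hx := one_div_norm_circleExponent_sq_le P α
    have hw0 := norm_circleExponent_pos hP0 α
    have hre : (circleExponent P α * c).re ≤ c := by
      rw [Complex.re_mul_ofReal]
      exact mul_le_of_le_one_left hc (re_circleExponent_pos_le hP1 α).2
    have he : ‖Complex.exp (circleExponent P α * c)‖ ≤ Real.exp c := by
      rw [Complex.norm_exp]
      exact Real.exp_le_exp.2 hre
    have he1 := norm_exp_sub_one_le_mul hc hre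
    rw [norm_mul, Complex.norm_of_nonneg hc] at he1
    set H := tentSeries M (circleExponent P α)
    set G := ∑' b : Fin N → ℤ, gaussPoly M (circleExponent P α) (fun i => s + b i)
    set x := ‖circleExponent P α‖
    set e := Complex.exp (circleExponent P α * c)
    set k := dualKernel L (circleExponent P α)
    have hid : e * G * k - H * k = e * (G - H) * k + (e - 1) * H * k := by ring
    rw [hid]
    refine (norm_add_le _ _).trans (add_le_add ?_ ?_)
    · rw [norm_mul, norm_mul, hA]
      calc ‖e‖ * ‖G - H‖ * ‖k‖ ≤ Real.exp c * ‖G - H‖ * (12 / x) := by gcongr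
        _ = Real.exp c * (‖G - H‖ * (12 / x)) := by ring
        _ ≤ Real.exp c * (C₁ * (P ^ (D + 1) * cauchyKernel (1 / P) α + P ^ D * arcSum P α)) := by
          gcongr
        _ = _ := by ring
    · rw [norm_mul, norm_mul, hB]
      calc ‖e - 1‖ * ‖H‖ * ‖k‖ ≤
            (Real.exp c + 1) * (x * c) * (C₂ * P ^ D * (1 / x ^ 2)) * (12 / x) := by gcongr
        _ = 12 * (Real.exp c + 1) * c * C₂ * P ^ D * (1 / x ^ 2) := by field_simp
        _ ≤ 12 * (Real.exp c + 1) * c * C₂ * P ^ D * cauchyKernel (1 / P ^ 2) α := by gcongr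
  have hk1 := continuous_cauchyKernel (δ := 1 / (P : ℝ)) (by positivity)
  have hk2 := continuous_cauchyKernel (δ := 1 / (P : ℝ) ^ 2) (by positivity)
  have hk3 := continuous_arcSum hP
  have hi1 : IntervalIntegrable (cauchyKernel (1 / (P : ℝ))) volume (-(1 / 2)) (1 / 2) :=
    hk1.intervalIntegrable _ _
  have hi2 : IntervalIntegrable (cauchyKernel (1 / (P : ℝ) ^ 2)) volume (-(1 / 2)) (1 / 2) :=
    hk2.intervalIntegrable _ _
  have hi3 : IntervalIntegrable (arcSum P) volume (-(1 / 2)) (1 / 2) := hk3.intervalIntegrable _ _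
  refine (intervalIntegral.norm_integral_le_of_norm_le (by norm_num)
    (Eventually.of_forall fun α hα => hpt α hα)
    (Continuous.intervalIntegrable (by fun_prop) _ _)).trans ?_
  rw [intervalIntegral.integral_add (((hi1.const_mul _).add (hi3.const_mul _)).const_mul _)
    (hi2.const_mul _), intervalIntegral.integral_const_mul, intervalIntegral.integral_const_mul,
    intervalIntegral.integral_add (hi1.const_mul _) (hi3.const_mul _),
    intervalIntegral.integral_const_mul, intervalIntegral.integral_const_mul]
  have j1 := integral_cauchyKernel_le (δ := 1 / (P : ℝ)) (by positivity) 0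
  have j2 := integral_cauchyKernel_le (δ := 1 / (P : ℝ) ^ 2) (by positivity) 0
  have j3 := integral_arcSum_le hP
  simp_rw [sub_zero] at j1 j2
  calc _ ≤ A * (P ^ (D + 1) * (Real.pi / (1 / P)) +
        P ^ D * (2 * Real.pi * (∑' q, arcWeight q) ^ 2 * P ^ 2)) +
        B * P ^ D * (Real.pi / (1 / P ^ 2)) := by gcongr
    _ = _ := by
      rw [div_div_eq_mul_div, div_div_eq_mul_div, div_one]
      ring

end

lemma abs_sqrt_add_pow_sub_le {T a A : ℝ} (hT : 1 ≤ T) (ha : |a| ≤ A) (n : ℕ) :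
    |√(T + a) ^ (n + 2) - √T ^ (n + 2)| ≤ A * (n + 2) * (1 + A) ^ (n + 1) * √T ^ n := by
  have hA : 0 ≤ A := (abs_nonneg a).trans ha
  have hv : 0 < √T := Real.sqrt_pos.2 (by linarith)
  have hvv : √T ^ 2 = T := Real.sq_sqrt (by linarith)
  obtain ⟨ha1, ha2⟩ := abs_le.1 ha
  have hu0 := Real.sqrt_nonneg (T + a)
  have hu : √(T + a) ≤ (1 + A) * √T := by
    rw [← Real.sqrt_sq (by positivity : 0 ≤ 1 + A), ← Real.sqrt_mul (by positivity)]
    refine Real.sqrt_le_sqrt ?_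
    nlinarith [mul_nonneg hA (by linarith : 0 ≤ T)]
  have hmax : max |√(T + a)| |√T| ≤ (1 + A) * √T := by
    rw [abs_of_nonneg hu0, abs_of_pos hv]
    exact max_le hu (by nlinarith)
  have hdiff : |√(T + a) - √T| * √T ≤ A := by
    rcases le_or_gt 0 (T + a) with h | h
    · have h1 : (√(T + a) - √T) * (√(T + a) + √T) = a := by
        have := Real.sq_sqrt h
        nlinarith
      have h2 : |√(T + a) - √T| * (√(T + a) + √T) = |a| := by
        rw [← h1, abs_mul, abs_of_pos (by linarith : 0 < √(T + a) + √T), h1]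
      nlinarith [abs_nonneg (√(T + a) - √T)]
    · rw [Real.sqrt_eq_zero_of_nonpos h.le, zero_sub, abs_neg, abs_of_pos hv]
      nlinarith
  calc _ ≤ |√(T + a) - √T| * (n + 2 : ℕ) * max |√(T + a)| |√T| ^ (n + 2 - 1) :=
        abs_pow_sub_pow_le ..
    _ ≤ |√(T + a) - √T| * (n + 2 : ℕ) * ((1 + A) * √T) ^ (n + 2 - 1) := by gcongr
    _ = |√(T + a) - √T| * √T * ((n + 2) * (1 + A) ^ (n + 1) * √T ^ n) := by
        rw [Nat.add_sub_assoc (by norm_num), mul_pow, pow_succ (√T) n]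
        push_cast
        ring
    _ ≤ A * ((n + 2) * (1 + A) ^ (n + 1) * √T ^ n) := by gcongr
    _ = _ := by ring

section

variable {N κ : ℕ} {M : MvPolynomial (Fin N) ℝ}

/-- Sharp lattice point asymptotics for a nonnegative homogeneous weight in at least five
variables. -/
theorem abs_tsum_ite_sum_sq_le_sub_le (hN : 5 ≤ N) (hM : M.IsHomogeneous κ)
    (hM0 : ∀ x, 0 ≤ MvPolynomial.eval x M) {D : ℕ} (hD : N + κ = D + 4) (hD3 : 3 ≤ D) {s c : ℝ}
    (hc : 0 ≤ c) {Q : (Fin N → ℤ) → ℕ}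
    (hQ : ∀ b : Fin N → ℤ, ∑ i, (s + b i) ^ 2 = Q b + c) :
    ∃ C : ℝ, ∀ T : ℝ, 1 ≤ T → c ≤ T →
      |(∑' b : Fin N → ℤ, if ∑ i, (s + b i) ^ 2 ≤ T then
          MvPolynomial.eval (fun i => s + (b i : ℝ)) M else 0) -
        (radialMeasure M).real (Set.Iic 1) * √T ^ (N + κ)| ≤ C * √T ^ (D + 2) := by
  obtain ⟨C, hC, h⟩ := abs_tsum_ite_sub_sum_tentCoeff_le hN hM hM0 hD hD3 hc hQ
  set V := (radialMeasure M).real (Set.Iic 1) with hV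
  have hV0 : 0 ≤ V := measureReal_nonneg
  set B := (1 + c) * ((D + 2 : ℕ) + 2) * (1 + (1 + c)) ^ (D + 2 + 1) with hB
  refine ⟨C * 3 ^ (D + 2) + V * B, fun T hT hcT => ?_⟩
  set L := ⌊T - c⌋₊ with hL
  have hLle : (L : ℝ) ≤ T - c := Nat.floor_le (by linarith)
  have hLlt : T - c < L + 1 := Nat.lt_floor_add_one _
  have hiff : ∀ b : Fin N → ℤ, ∑ i, (s + b i) ^ 2 ≤ T ↔ Q b ≤ L := by
    intro b
    rw [hQ, hL, Nat.le_floor_iff (by linarith), le_sub_iff_add_le]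
  simp_rw [hiff]
  have hP : √(T + 1) ≤ ⌈√(T + 1)⌉₊ := Nat.le_ceil _
  have hPpos : 0 < ⌈√(T + 1)⌉₊ := Nat.ceil_pos.2 (Real.sqrt_pos.2 (by linarith))
  have hP2 : (⌈√(T + 1)⌉₊ : ℝ) ≤ 3 * √T := by
    have h1 : √(T + 1) ≤ 2 * √T := by
      rw [show (2 : ℝ) = √(2 ^ 2) by simp, ← Real.sqrt_mul (by norm_num)]
      exact Real.sqrt_le_sqrt (by linarith)
    have h2 : 1 ≤ √T := Real.one_le_sqrt.2 hT
    linarith [Nat.ceil_lt_add_one (Real.sqrt_nonneg (T + 1))]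
  have hLP : (L : ℝ) + 1 ≤ (⌈√(T + 1)⌉₊ : ℝ) ^ 2 := by
    calc (L : ℝ) + 1 ≤ T + 1 := by linarith
      _ = √(T + 1) ^ 2 := (Real.sq_sqrt (by linarith)).symm
      _ ≤ _ := by gcongr
  have hmain := h _ hPpos L hLP
  obtain ⟨hlow, hup⟩ := measureReal_Iic_le_sum_tentCoeff (radialMeasure_ae_nonneg M)
    (integrable_exp_radialMeasure hM0 one_pos) L
  have hnn : 0 ≤ ∑ n ∈ range (L + 1), tentCoeff (radialMeasure M) n :=
    sum_nonneg fun n _ => tentCoeff_nonneg n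
  rw [measureReal_Iic_radialMeasure hM hM0 (by positivity), ← hV] at hup
  set S := ∑ n ∈ range (L + 1), tentCoeff (radialMeasure M) n
  have hup' : S ≤ √(T + 1) ^ (N + κ) * V := by
    refine hup.trans ?_
    gcongr
    linarith
  have hlow' : √(T + -(1 + c)) ^ (N + κ) * V ≤ S := by
    rcases le_or_gt (T + -(1 + c)) 0 with h0 | h0
    · rw [Real.sqrt_eq_zero_of_nonpos h0, zero_pow (by omega), zero_mul]
      exact hnn
    · rw [measureReal_Iic_radialMeasure hM hM0 (by linarith), ← hV] at hlow
      refine le_trans ?_ hlow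
      gcongr
      linarith
  have hd1 := abs_sqrt_add_pow_sub_le (A := 1 + c) hT
    (by rw [abs_one]; linarith : |(1 : ℝ)| ≤ 1 + c) (D + 2)
  have hd2 := abs_sqrt_add_pow_sub_le (A := 1 + c) hT
    (by rw [abs_neg, abs_of_nonneg (by linarith)] : |-(1 + c)| ≤ 1 + c) (D + 2)
  rw [← hB, show D + 2 + 2 = N + κ by omega] at hd1 hd2
  have hd1' := mul_le_mul_of_nonneg_left (abs_le.1 hd1).2 hV0
  have hd2' := mul_le_mul_of_nonneg_left (abs_le.1 hd2).1 hV0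
  have hpow : C * (⌈√(T + 1)⌉₊ : ℝ) ^ (D + 2) ≤ C * 3 ^ (D + 2) * √T ^ (D + 2) := by
    rw [mul_assoc, ← mul_pow]
    gcongr
  rw [abs_le] at hmain ⊢
  constructor <;> nlinarith

end

lemma setIntegral_closedBall_eval {N : ℕ} {M : MvPolynomial (Fin N) ℝ}
    (hM0 : ∀ x, 0 ≤ MvPolynomial.eval x M) :
    ∫ x in Metric.closedBall (0 : EuclideanSpace ℝ (Fin N)) 1, MvPolynomial.eval x.ofLp M =
      (radialMeasure M).real (Set.Iic 1) := by
  have h1 : (radialMeasure M).real (Set.Iic 1) =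
      ∫ t, (Set.Iic (1 : ℝ)).indicator (fun _ => (1 : ℝ)) t ∂radialMeasure M := by
    rw [integral_indicator_const _ measurableSet_Iic, smul_eq_mul, mul_one]
  rw [h1, integral_radialMeasure hM0 (stronglyMeasurable_const.indicator measurableSet_Iic),
    ← integral_indicator Metric.isClosed_closedBall.measurableSet,
    ← (EuclideanSpace.volume_preserving_symm_measurableEquiv_toLp (Fin N)).integral_comp']
  refine integral_congr_ae (Eventually.of_forall fun x => ?_)
  have hx : x ∈ Metric.closedBall (0 : EuclideanSpace ℝ (Fin N)) 1 ↔ ∑ i, x i ^ 2 ≤ 1 := by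
    rw [mem_closedBall_zero_iff, ← EuclideanSpace.real_norm_sq_eq, sq_le_one_iff₀ (norm_nonneg _)]
  by_cases h : ∑ i, x i ^ 2 ≤ 1
  · simp [Set.indicator, hx, h]
  · simp [Set.indicator, hx, h]

/-- The Weyl multiplicity polynomial of the unitary group. -/
noncomputable def weylPoly (N : ℕ) : MvPolynomial (Fin N) ℝ :=
  ∏ p ∈ univ.filter (fun p : Fin N × Fin N => p.1 < p.2),
    MvPolynomial.C ((((p.2 : ℕ) : ℝ) - ((p.1 : ℕ) : ℝ)) ^ 2)⁻¹ *
      (MvPolynomial.X p.1 - MvPolynomial.X p.2) ^ 2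

lemma eval_weylPoly {N : ℕ} (x : Fin N → ℝ) : MvPolynomial.eval x (weylPoly N) =
    ∏ p ∈ univ.filter (fun p : Fin N × Fin N => p.1 < p.2),
      ((x p.1 - x p.2) ^ 2 / (((p.2 : ℕ) : ℝ) - ((p.1 : ℕ) : ℝ)) ^ 2) := by
  simp only [weylPoly, map_prod, map_mul, map_pow, map_sub, MvPolynomial.eval_C,
    MvPolynomial.eval_X]
  exact prod_congr rfl fun p _ => by rw [div_eq_inv_mul]

lemma eval_weylPoly_nonneg {N : ℕ} (x : Fin N → ℝ) : 0 ≤ MvPolynomial.eval x (weylPoly N) := by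
  rw [eval_weylPoly]
  exact prod_nonneg fun p _ => by positivity

lemma card_filter_lt_mul_two (N : ℕ) :
    (univ.filter fun p : Fin N × Fin N => p.1 < p.2).card * 2 = N * (N - 1) := by
  have h : (univ.filter fun p : Fin N × Fin N => p.1 < p.2).card = ∑ j : Fin N, (j : ℕ) := by
    simp_rw [card_filter, Fintype.sum_prod_type_right, ← card_filter]
    refine sum_congr rfl fun j _ => ?_
    rw [← Fin.card_Iio j]
    congr 1
    ext i
    simp
  rw [h, Fin.sum_univ_eq_sum_range (fun i => i), sum_range_id_mul_two]

lemma isHomogeneous_weylPoly (N : ℕ) : (weylPoly N).IsHomogeneous (N * (N - 1)) := by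
  rw [← card_filter_lt_mul_two, ← smul_eq_mul, ← sum_const]
  refine MvPolynomial.IsHomogeneous.prod _ _ _ fun p _ => ?_
  exact ((((MvPolynomial.isHomogeneous_X _ _).sub (MvPolynomial.isHomogeneous_X _ _)).pow
    2).C_mul _)

/-- The half-sum of positive roots of `U(N)` is integral up to a common shift by `0` or `1 / 2`. -/
lemma exists_int_shift (N : ℕ) : ∃ σ : ℤ, (σ = 0 ∨ σ = 1) ∧ ∃ t : Fin N → ℤ,
    ∀ j : Fin N, ((N : ℝ) + 1) / 2 - ((j : ℕ) + 1) = σ / 2 + t j := by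
  rcases Nat.even_or_odd' N with ⟨k, rfl | rfl⟩
  · refine ⟨1, Or.inr rfl, fun j => k - ((j : ℕ) + 1), fun j => ?_⟩
    push_cast
    ring
  · refine ⟨0, Or.inl rfl, fun j => k + 1 - ((j : ℕ) + 1), fun j => ?_⟩
    push_cast
    ring

lemma sum_half_add_sq {N : ℕ} {σ : ℤ} (hσ : σ = 0 ∨ σ = 1) (b : Fin N → ℤ) :
    ∑ i, ((σ : ℝ) / 2 + b i) ^ 2 =
      ((∑ i, b i * (b i + σ)).toNat : ℝ) + N * ((σ : ℝ) / 2) ^ 2 := by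
  have h : 0 ≤ ∑ i, b i * (b i + σ) := by
    refine sum_nonneg fun i _ => ?_
    rcases hσ with rfl | rfl
    · nlinarith [sq_nonneg (b i)]
    · rcases le_or_gt 0 (b i) with h | h
      · positivity
      · exact mul_nonneg_of_nonpos_of_nonpos h.le (by omega)
  have e : ((∑ i, b i * (b i + σ)).toNat : ℝ) = ((∑ i, b i * (b i + σ) : ℤ) : ℝ) := by
    rw [← Int.cast_natCast, Int.toNat_of_nonneg h]
  have hN : (N : ℝ) * ((σ : ℝ) / 2) ^ 2 = ∑ _i : Fin N, ((σ : ℝ) / 2) ^ 2 := by simp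
  rw [e, hN]
  push_cast
  rw [← sum_add_distrib]
  exact sum_congr rfl fun i _ => by ring

/-- **Sharp Weyl law for the unitary group U(N), rank N ≥ 5 (Theorem 5.1, unitary case).**
With `d = dim U(N) = N²`, `ρ_j = (N+1)/2 − j`, the multiplicity polynomial
`m(x) = ∏_{j<k}(x_j−x_k)²/(k−j)²`, and the spectral counting function
`𝓝(λ) = (N!)⁻¹ Σ_{b∈ℤᴺ} m(b+ρ) 1_{|b+ρ|² ≤ λ+|ρ|²}`, one has
`𝓝(λ) = C λ^{d/2} + O(λ^{(d−2)/2})` where `C = (N!)⁻¹ ∫_{|x|≤1} m`. -/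
theorem stmt12 (N : ℕ) (hN : 5 ≤ N) (d : ℕ) (hd : d = N ^ 2)
    (ρ : EuclideanSpace ℝ (Fin N))
    (hρ : ∀ j : Fin N, ρ j = ((N : ℝ) + 1) / 2 - ((j : ℕ) + 1))
    (m : EuclideanSpace ℝ (Fin N) → ℝ)
    (hm : ∀ x, m x =
      ∏ p ∈ Finset.univ.filter (fun p : Fin N × Fin N => p.1 < p.2),
        ((x p.1 - x p.2) ^ 2 / (((p.2 : ℕ) : ℝ) - ((p.1 : ℕ) : ℝ)) ^ 2))
    (𝓝 : ℝ → ℝ)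
    (h𝓝 : ∀ lam : ℝ, 𝓝 lam = (1 / (N.factorial : ℝ)) *
      ∑' b : Fin N → ℤ,
        if ‖((EuclideanSpace.equiv (Fin N) ℝ).symm fun i => (b i : ℝ) + ρ i)‖ ^ 2
            ≤ lam + ‖ρ‖ ^ 2 then
          m ((EuclideanSpace.equiv (Fin N) ℝ).symm fun i => (b i : ℝ) + ρ i) else 0)
    (C : ℝ)
    (hC : C = (1 / (N.factorial : ℝ)) *
      ∫ x in Metric.closedBall (0 : EuclideanSpace ℝ (Fin N)) 1, m x) :
    (fun lam : ℝ => 𝓝 lam - C * lam ^ ((d : ℝ) / 2))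
      =O[atTop] (fun lam : ℝ => lam ^ (((d : ℝ) - 2) / 2)) := by
  have hκ : N + N * (N - 1) = N ^ 2 := by
    obtain ⟨n, rfl⟩ : ∃ n, N = n + 1 := ⟨N - 1, by omega⟩
    rw [Nat.add_sub_cancel]
    ring
  have hN2 : 25 ≤ N ^ 2 := by nlinarith
  have hm' : ∀ x, m x = MvPolynomial.eval x.ofLp (weylPoly N) := fun x => by
    rw [hm, eval_weylPoly]
  obtain ⟨σ, hσ, t, ht⟩ := exists_int_shift N
  have hcount : ∀ lam : ℝ, 𝓝 lam = (1 / (N.factorial : ℝ)) * ∑' b : Fin N → ℤ,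
      if ∑ i, ((σ : ℝ) / 2 + b i) ^ 2 ≤ lam + ‖ρ‖ ^ 2 then
        MvPolynomial.eval (fun i => (σ : ℝ) / 2 + (b i : ℝ)) (weylPoly N) else 0 := by
    intro lam
    rw [h𝓝]
    congr 1
    refine Eq.trans ?_ ((Equiv.addRight t).tsum_eq _)
    refine tsum_congr fun b => ?_
    have e : (fun i => (b i : ℝ) + ρ i) = fun i => (σ : ℝ) / 2 + ((b + t) i : ℤ) := by
      ext i
      rw [hρ, ht, Pi.add_apply]
      push_cast
      ring
    rw [hm', EuclideanSpace.real_norm_sq_eq, e]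
    rfl
  have hV : C = (1 / (N.factorial : ℝ)) * (radialMeasure (weylPoly N)).real (Set.Iic 1) := by
    rw [hC, ← setIntegral_closedBall_eval eval_weylPoly_nonneg]
    simp_rw [hm']
  obtain ⟨K, hK⟩ := abs_tsum_ite_sum_sq_le_sub_le hN (isHomogeneous_weylPoly N)
    eval_weylPoly_nonneg (D := N ^ 2 - 4) (by omega) (by omega) (by positivity)
    (sum_half_add_sq hσ)
  rw [hκ, show N ^ 2 - 4 + 2 = N ^ 2 - 2 by omega] at hK
  set V := (radialMeasure (weylPoly N)).real (Set.Iic 1) with hVdef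
  have hV0 : 0 ≤ V := measureReal_nonneg
  set R := ‖ρ‖ ^ 2 with hR
  have hR0 : 0 ≤ R := by positivity
  set n := N ^ 2 - 2 with hn
  have hnd : N ^ 2 = n + 2 := by omega
  set B := R * (n + 2) * (1 + R) ^ (n + 1) with hB
  refine IsBigO.of_bound ((1 / (N.factorial : ℝ)) * (|K| * (1 + R) ^ n + V * B)) ?_
  filter_upwards [eventually_ge_atTop (max 1 (N * ((σ : ℝ) / 2) ^ 2))] with lam hlam
  have hlam1 : 1 ≤ lam := (le_max_left _ _).trans hlam
  have hlam0 : 0 ≤ lam := by linarith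
  have hlam2 : N * ((σ : ℝ) / 2) ^ 2 ≤ lam + R := by linarith [(le_max_right _ _).trans hlam]
  have hmain := hK (lam + R) (by linarith) hlam2
  have hdiff := abs_sqrt_add_pow_sub_le hlam1 (abs_of_nonneg hR0).le n
  rw [← hB] at hdiff
  have e1 : lam ^ ((d : ℝ) / 2) = √lam ^ (n + 2) := by
    rw [Real.rpow_div_two_eq_sqrt _ hlam0, hd, hnd, Real.rpow_natCast]
  have e2 : lam ^ (((d : ℝ) - 2) / 2) = √lam ^ n := by
    rw [Real.rpow_div_two_eq_sqrt _ hlam0, hd, hnd, ← Real.rpow_natCast]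
    push_cast
    ring_nf
  have hsqrt : √(lam + R) ≤ (1 + R) * √lam := by
    rw [← Real.sqrt_sq (by positivity : 0 ≤ 1 + R), ← Real.sqrt_mul (by positivity)]
    refine Real.sqrt_le_sqrt ?_
    nlinarith [mul_nonneg hR0 hlam0]
  rw [hnd] at hmain
  rw [e1, e2, hcount, hV, mul_assoc (1 / (N.factorial : ℝ)), ← mul_sub, norm_mul,
    Real.norm_of_nonneg (by positivity : 0 ≤ 1 / (N.factorial : ℝ)), Real.norm_eq_abs,
    Real.norm_of_nonneg (by positivity : 0 ≤ √lam ^ n), mul_assoc]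
  refine mul_le_mul_of_nonneg_left ?_ (by positivity)
  set S := ∑' b : Fin N → ℤ, if ∑ i, ((σ : ℝ) / 2 + b i) ^ 2 ≤ lam + R then
        MvPolynomial.eval (fun i => (σ : ℝ) / 2 + (b i : ℝ)) (weylPoly N) else 0
  calc |S - V * √lam ^ (n + 2)| = |(S - V * √(lam + R) ^ (n + 2)) +
        V * (√(lam + R) ^ (n + 2) - √lam ^ (n + 2))| := by ring_nf
    _ ≤ K * √(lam + R) ^ n + V * (B * √lam ^ n) := by
      refine (abs_add_le _ _).trans (add_le_add hmain ?_)
      rw [abs_mul, abs_of_nonneg hV0]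
      gcongr
    _ ≤ |K| * ((1 + R) * √lam) ^ n + V * (B * √lam ^ n) := by
      gcongr
      exact le_abs_self K
    _ = _ := by rw [mul_pow]; ring
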